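/- arXiv:1604.04209 — 3 statements merged into one kernel-verified Lean document; each statement's English description precedes it below -/
import Mathlib

section
/- Let $G$ and $H$ be groups and $R$ a Dedekind domain such that $R$ admits a resolution by finitely generated free $R[G]$-modules. Let $M$ be an $R[G]$-module that is finitely generated and free as an $R$-module, and let $N$ be any $R[H]$-module. Then there is a short exact Künneth sequence $0 \to \bigoplus_{p+q=n} H^p(G,M) \otimes_R H^q(H,N) \to H^n(G \times H, M \otimes_R N) \to \bigoplus_{p+q=n+1} \mathrm{Tor}_1^R(H^p(G,M), H^q(H,N)) \to 0$. -/
open CategoryTheory TensorProduct DirectSum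

/-- The trivial module admits a resolution by finitely generated free
`R[G]`-modules. -/
def HasFinFreeResolution (R : Type) [CommRing R] (G : Type) [Group G] : Prop :=
  ∃ P : ProjectiveResolution (Rep.trivial R G R),
    ∀ n : ℕ, Module.Free (MonoidAlgebra R G) ((P.complex.X n).ρ.asModule) ∧
      Module.Finite (MonoidAlgebra R G) ((P.complex.X n).ρ.asModule)

/-- The exterior tensor product representation of `G × H` on `M ⊗ N`. -/
noncomputable def extTprod {R : Type} [CommRing R] {G H : Type} [Group G] [Group H]
    (M : Rep R G) (N : Rep R H) : Representation R (G × H) (M ⊗[R] N) :=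
  Representation.tprod (M.ρ.comp (MonoidHom.fst G H)) (N.ρ.comp (MonoidHom.snd G H))

namespace Kunneth

section Core

variable {R : Type*} [CommRing R]

/-- The submodule of coboundaries in degree `q` of a sequence of linear maps. -/
def coboundaries {U : ℕ → Type*} [∀ q, AddCommGroup (U q)] [∀ q, Module R (U q)]
    (d : ∀ q, U q →ₗ[R] U (q + 1)) : ∀ q, Submodule R (U q)
  | 0 => ⊥
  | q + 1 => LinearMap.range (d q)

/-- The map induced on the product of all degrees by a sequence of linear maps. -/
def shift {U : ℕ → Type*} [∀ q, AddCommGroup (U q)] [∀ q, Module R (U q)]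
    (d : ∀ q, U q →ₗ[R] U (q + 1)) : (∀ q, U q) →ₗ[R] ∀ q, U q :=
  LinearMap.pi fun q => match q with
    | 0 => 0
    | q + 1 => d q ∘ₗ LinearMap.proj q

section shift

variable {U : ℕ → Type*} [∀ q, AddCommGroup (U q)] [∀ q, Module R (U q)]
    (d : ∀ q, U q →ₗ[R] U (q + 1))

@[simp] lemma shift_zero (x : ∀ q, U q) : shift d x 0 = 0 := rfl

@[simp] lemma shift_succ (x : ∀ q, U q) (q : ℕ) : shift d x (q + 1) = d q (x q) := rfl

lemma shift_mem_coboundaries (x : ∀ q, U q) (q : ℕ) : shift d x q ∈ coboundaries d q := by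
  cases q with
  | zero => exact Submodule.zero_mem _
  | succ q => exact ⟨x q, rfl⟩

lemma exists_shift_eq (y : ∀ q, U q) (hy : ∀ q, y q ∈ coboundaries d q) :
    ∃ x, shift d x = y := by
  choose x hx using fun q => hy (q + 1)
  refine ⟨x, funext fun q => ?_⟩
  cases q with
  | zero => exact ((Submodule.mem_bot R).1 (hy 0)).symm
  | succ q => exact hx q

end shift

/-- Families indexed by `ℕ × ℕ` which are supported in total degree `n`. -/
def supported {U : ℕ → ℕ → Type*} [∀ p q, AddCommGroup (U p q)] [∀ p q, Module R (U p q)]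
    (P : ℕ → ℕ → Prop) : Submodule R (∀ p q, U p q) where
  carrier := {x | ∀ p q, ¬ P p q → x p q = 0}
  add_mem' hx hy p q h := by simp [hx p q h, hy p q h]
  zero_mem' p q h := rfl
  smul_mem' r x hx p q h := by simp [hx p q h]

/-- Evaluation of a bigraded family at a bidegree. -/
def evalAt {U : ℕ → ℕ → Type*} [∀ p q, AddCommGroup (U p q)] [∀ p q, Module R (U p q)]
    (p q : ℕ) : (∀ p q, U p q) →ₗ[R] U p q where
  toFun x := x p q
  map_add' _ _ := rfl
  map_smul' _ _ := rfl

lemma exists_lift {X Y Z : Type*} [AddCommGroup X] [AddCommGroup Y] [AddCommGroup Z]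
    [Module R X] [Module R Y] [Module R Z] (f : X →ₗ[R] Y) (hf : Function.Surjective f)
    (g : X →ₗ[R] Z) (h : ∀ x, f x = 0 → g x = 0) : ∃ k : Y →ₗ[R] Z, ∀ x, k (f x) = g x := by
  refine ⟨(LinearMap.ker f).liftQ g (fun x hx => h x hx) ∘ₗ
    (f.quotKerEquivOfSurjective hf).symm.toLinearMap, fun x => ?_⟩
  have : (f.quotKerEquivOfSurjective hf).symm (f x) = Submodule.Quotient.mk x := by
    rw [LinearEquiv.symm_apply_eq]; rfl
  simp only [LinearMap.comp_apply, LinearEquiv.coe_coe, this]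
  rfl

variable {U V L T : ℕ → ℕ → Type*}
  [∀ p q, AddCommGroup (U p q)] [∀ p q, Module R (U p q)]
  [∀ p q, AddCommGroup (V p q)] [∀ p q, Module R (V p q)]
  [∀ p q, AddCommGroup (L p q)] [∀ p q, Module R (L p q)]
  [∀ p q, AddCommGroup (T p q)] [∀ p q, Module R (T p q)]
  (dU : ∀ p q, U p q →ₗ[R] U p (q + 1)) (dV : ∀ p q, V p q →ₗ[R] V p (q + 1))
  (j : ∀ p q, V p q →ₗ[R] U p q)

/-- The differential of the product of the mapping cones of `j p`, with signs as in the total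
complex of a double complex. -/
def coneD : ((∀ p q, U p q) × (∀ p q, V p q)) →ₗ[R] ((∀ p q, U p q) × (∀ p q, V p q)) :=
  LinearMap.prod
    (LinearMap.pi fun p =>
      (LinearMap.pi fun q => j p q ∘ₗ LinearMap.proj q) ∘ₗ LinearMap.proj p ∘ₗ
        LinearMap.snd R _ _ + ((-1) ^ p : R) • shift (dU p) ∘ₗ LinearMap.proj p ∘ₗ
          LinearMap.fst R _ _)
    (LinearMap.pi fun p => -((-1) ^ p : R) • shift (dV p) ∘ₗ LinearMap.proj p ∘ₗ
          LinearMap.snd R _ _)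

lemma coneD_fst (e : (∀ p q, U p q) × (∀ p q, V p q)) (p q : ℕ) :
    (coneD dU dV j e).1 p q = j p q (e.2 p q) + ((-1) ^ p : R) • shift (dU p) (e.1 p) q := rfl

lemma coneD_snd (e : (∀ p q, U p q) × (∀ p q, V p q)) (p q : ℕ) :
    (coneD dU dV j e).2 p q = -((-1) ^ p : R) • shift (dV p) (e.2 p) q := rfl

lemma neg_one_pow_smul_smul {X : Type*} [AddCommGroup X] [Module R X] (p : ℕ) (x : X) :
    ((-1) ^ p : R) • ((-1) ^ p : R) • x = x := by
  rw [smul_smul, ← mul_pow]; simp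

/-- The cocycles of total degree `n` of the product of the mapping cones of `j p`. -/
def coneCycles (n : ℕ) : Submodule R ((∀ p q, U p q) × (∀ p q, V p q)) :=
  (supported (fun p q => p + q = n)).prod (supported (fun p q => p + q = n + 1)) ⊓
    LinearMap.ker (coneD dU dV j)

/-- The Künneth exact sequence for a product of mapping cones, phrased in terms of presentations of
the modules involved. -/
theorem cone_kunneth (n : ℕ)
    (hj : ∀ p q x, dU p q (j p q x) = j p (q + 1) (dV p q x))
    (lam : ∀ p q, LinearMap.ker (dU p q) →ₗ[R] L p q)
    (lam_surj : ∀ p q, Function.Surjective (lam p q))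
    (lam_zero : ∀ p q x, lam p q x = 0 ↔
      ∃ b, dV p q b = 0 ∧ (x : U p q) - j p q b ∈ coboundaries (dU p) q)
    (rho : ∀ p q, ↥(LinearMap.ker (dV p q) ⊓ (coboundaries (dU p) q).comap (j p q)) →ₗ[R] T p q)
    (rho_surj : ∀ p q, Function.Surjective (rho p q))
    (rho_zero : ∀ p q x, rho p q x = 0 ↔ (x : V p q) ∈ coboundaries (dV p) q)
    {H : Type*} [AddCommGroup H] [Module R H]
    (κ : coneCycles dU dV j n →ₗ[R] H)
    (κ_surj : Function.Surjective κ)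
    (κ_zero : ∀ x, κ x = 0 ↔ ∃ y ∈ (supported (R := R) (fun p q => p + q + 1 = n)).prod
      (supported (R := R) (fun p q => p + q = n)), coneD dU dV j y = x) :
    ∃ (f : supported (R := R) (U := L) (fun p q => p + q = n) →ₗ[R] H)
      (g : H →ₗ[R] supported (R := R) (U := T) (fun p q => p + q = n + 1)),
      Function.Injective f ∧ Function.Surjective g ∧ Function.Exact f g := by
  classical
  let W := coneCycles dU dV j n
  have cyc : ∀ w : W, ∀ p q, dV p q (w.1.2 p q) = 0 := fun w p q => by
    have h := congrFun (congrFun (congrArg Prod.snd w.2.2) p) (q + 1)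
    rw [coneD_snd, shift_succ] at h
    have h' := congrArg (fun t => -((-1) ^ p : R) • t) h
    simpa only [neg_smul, smul_neg, neg_neg, neg_one_pow_smul_smul, Prod.snd_zero, Pi.zero_apply,
      smul_zero, neg_zero] using h'
  have cyc' : ∀ w : W, ∀ p q, j p q (w.1.2 p q) = -((-1) ^ p : R) • shift (dU p) (w.1.1 p) q :=
    fun w p q => by
      have h := congrFun (congrFun (congrArg Prod.fst w.2.2) p) q
      rw [coneD_fst] at h
      rw [neg_smul]
      exact eq_neg_of_add_eq_zero_left h
  -- the map to the torsion part
  let ψ : W →ₗ[R] supported (R := R) (U := T) (fun p q => p + q = n + 1) :=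
    LinearMap.codRestrict _ (LinearMap.pi fun p => LinearMap.pi fun q => rho p q ∘ₗ
      LinearMap.codRestrict _ (evalAt p q ∘ₗ LinearMap.snd R _ _ ∘ₗ W.subtype)
        (fun w => ⟨cyc w p q, by
          change j p q (w.1.2 p q) ∈ coboundaries (dU p) q
          rw [cyc' w p q]
          exact Submodule.smul_mem _ _ (shift_mem_coboundaries _ _ _)⟩))
      (fun w p q h => by
        change rho p q _ = 0
        rw [rho_zero]
        change w.1.2 p q ∈ _
        rw [w.2.1.2 p q h]
        exact Submodule.zero_mem _)
  have hψ : ∀ w : W, ψ w = 0 ↔ ∀ p q, w.1.2 p q ∈ coboundaries (dV p) q := fun w => by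
    rw [Subtype.ext_iff, funext_iff]
    simp only [funext_iff]
    exact forall₂_congr fun p q => rho_zero p q _
  obtain ⟨g, hg⟩ := exists_lift κ κ_surj ψ (fun w hw => by
    obtain ⟨y, -, hy⟩ := (κ_zero w).1 hw
    rw [hψ, ← hy]
    intro p q
    rw [coneD_snd]
    exact Submodule.smul_mem _ _ (shift_mem_coboundaries _ _ _))
  -- the map from the tensor part
  let X : Submodule R (∀ p q, U p q) := supported (fun p q => p + q = n) ⊓
    Submodule.pi Set.univ fun p => Submodule.pi Set.univ fun q => LinearMap.ker (dU p q)
  have hX : ∀ x : X, ∀ p q, dU p q (x.1 p q) = 0 := fun x p q => x.2.2 p trivial q trivial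
  let Λ : X →ₗ[R] supported (R := R) (U := L) (fun p q => p + q = n) :=
    LinearMap.codRestrict _ (LinearMap.pi fun p => LinearMap.pi fun q => lam p q ∘ₗ
      LinearMap.codRestrict _ (evalAt p q ∘ₗ X.subtype)
        (fun x => hX x p q))
      (fun x p q h => by
        change lam p q ⟨x.1 p q, _⟩ = 0
        convert (lam p q).map_zero
        exact Subtype.ext (x.2.1 p q h))
  have Λ_apply : ∀ x p q, (Λ x).1 p q = lam p q ⟨x.1 p q, hX x p q⟩ := fun _ _ _ => rfl
  have Λ_surj : Function.Surjective Λ := fun l => by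
    choose z hz using fun p q => lam_surj p q (l.1 p q)
    refine ⟨⟨fun p q => if p + q = n then (z p q : U p q) else 0,
      fun p q h => if_neg h, fun p _ q _ => ?_⟩, ?_⟩
    · change dU p q (if p + q = n then (z p q : U p q) else 0) = 0
      split_ifs
      · exact (z p q).2
      · exact map_zero _
    · ext p q
      rw [Λ_apply]
      by_cases h : p + q = n
      · rw [← hz p q]
        congr 1
        exact Subtype.ext (if_pos h)
      · rw [l.2 p q h]
        convert (lam p q).map_zero
        exact Subtype.ext (if_neg h)
  let φ : X →ₗ[R] H := κ ∘ₗ LinearMap.codRestrict _ (LinearMap.inl R _ _ ∘ₗ X.subtype) (fun x =>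
    ⟨⟨x.2.1, Submodule.zero_mem _⟩, by
      change coneD dU dV j (x.1, 0) = 0
      refine Prod.ext (funext₂ fun p q => ?_) (funext₂ fun p q => ?_)
      · rw [coneD_fst]
        cases q with
        | zero => simp
        | succ q => simp [hX x p q]
      · rw [coneD_snd]
        cases q <;> simp⟩)
  have hφ : ∀ x, φ x = 0 ↔ Λ x = 0 := fun x => by
    constructor
    · intro h
      change κ _ = 0 at h
      obtain ⟨y, hy, hyx⟩ := (κ_zero _).1 h
      change coneD dU dV j y = (x.1, 0) at hyx
      ext p q
      rw [Λ_apply]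
      refine (lam_zero p q _).2 ⟨y.2 p q, ?_, ?_⟩
      · have h := congrFun (congrFun (congrArg Prod.snd hyx) p) (q + 1)
        rw [coneD_snd, shift_succ] at h
        have h' := congrArg (fun t => -((-1) ^ p : R) • t) h
        simpa only [neg_smul, smul_neg, neg_neg, neg_one_pow_smul_smul, Pi.zero_apply,
          smul_zero, neg_zero] using h'
      · have h := congrFun (congrFun (congrArg Prod.fst hyx) p) q
        rw [coneD_fst] at h
        change _ = x.1 p q at h
        change x.1 p q - _ ∈ _
        rw [← h, add_sub_cancel_left]
        exact Submodule.smul_mem _ _ (shift_mem_coboundaries _ _ _)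
    · intro h
      have h1 : ∀ p q, lam p q ⟨x.1 p q, hX x p q⟩ = 0 := fun p q => by rw [← Λ_apply, h]; rfl
      choose b hb hb' using fun p q => (lam_zero p q _).1 (h1 p q)
      choose z hz using fun p => exists_shift_eq (dU p) _ (fun q => hb' p q)
      change κ _ = 0
      refine (κ_zero _).2 ⟨(fun p q => if p + q + 1 = n then ((-1) ^ p : R) • z p q else 0,
        fun p q => if p + q = n then b p q else 0),
        ⟨fun p q h => if_neg h, fun p q h => if_neg h⟩, ?_⟩
      change _ = (x.1, 0)
      refine Prod.ext (funext₂ fun p q => ?_) (funext₂ fun p q => ?_)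
      · rw [coneD_fst]
        by_cases hpq : p + q = n
        · have : ((-1) ^ p : R) • shift (dU p) (fun q => if p + q + 1 = n then
              ((-1) ^ p : R) • z p q else 0) q = shift (dU p) (z p) q := by
            cases q with
            | zero => simp
            | succ q => rw [shift_succ, shift_succ, if_pos (by omega), map_smul,
                neg_one_pow_smul_smul]
          dsimp only
          rw [this, if_pos hpq, hz]
          exact add_sub_cancel _ _
        · have : shift (dU p) (fun q => if p + q + 1 = n then
              ((-1) ^ p : R) • z p q else 0) q = 0 := by
            cases q with
            | zero => simp
            | succ q => rw [shift_succ, if_neg (by omega), map_zero]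
          dsimp only
          rw [this, if_neg hpq, x.2.1 p q hpq]
          simp
      · rw [coneD_snd]
        cases q with
        | zero => simp
        | succ q =>
          rw [shift_succ]
          dsimp only
          split_ifs <;> simp [hb]
  obtain ⟨f, hf⟩ := exists_lift Λ Λ_surj φ (fun x hx => (hφ x).2 hx)
  refine ⟨f, g, ?_, ?_, ?_⟩
  · rw [injective_iff_map_eq_zero]
    intro l hl
    obtain ⟨x, rfl⟩ := Λ_surj l
    rw [hf] at hl
    exact (hφ x).1 hl
  · intro t
    choose b hb using fun p q => rho_surj p q (t.1 p q)
    choose z hz using fun p => exists_shift_eq (dU p) _ (fun q => (b p q).2.2)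
    have hw : ((fun p q => if p + q = n then -((-1) ^ p : R) • z p q else 0,
        fun p q => if p + q = n + 1 then (b p q : V p q) else 0) :
        (∀ p q, U p q) × (∀ p q, V p q)) ∈ W := by
      refine ⟨⟨fun p q h => if_neg h, fun p q h => if_neg h⟩, ?_⟩
      refine Prod.ext (funext₂ fun p q => ?_) (funext₂ fun p q => ?_)
      · rw [coneD_fst]
        have hzz : j p q (b p q) = shift (dU p) (z p) q := by rw [hz]
        dsimp only
        by_cases hpq : p + q = n + 1
        · rw [if_pos hpq, hzz]
          cases q with
          | zero => simp
          | succ q =>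
            rw [shift_succ, shift_succ, if_pos (by omega), neg_smul, map_neg, map_smul, smul_neg,
              neg_one_pow_smul_smul]
            simp
        · rw [if_neg hpq]
          cases q with
          | zero => simp
          | succ q => rw [shift_succ, if_neg (by omega)]; simp
      · rw [coneD_snd]
        cases q with
        | zero => simp
        | succ q =>
          rw [shift_succ]
          dsimp only
          split_ifs
          · rw [(b p q).2.1]; simp
          · simp
    refine ⟨κ ⟨_, hw⟩, ?_⟩
    rw [hg]
    ext p q
    change rho p q ⟨if p + q = n + 1 then (b p q : V p q) else 0, _⟩ = _
    by_cases h : p + q = n + 1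
    · rw [← hb]
      congr 1
      exact Subtype.ext (if_pos h)
    · rw [t.2 p q h]
      convert (rho p q).map_zero
      exact Subtype.ext (if_neg h)
  · intro y
    constructor
    · intro hy
      obtain ⟨w, rfl⟩ := κ_surj y
      rw [hg, hψ] at hy
      choose v hv using fun p => exists_shift_eq (dV p) _ (hy p)
      let y' : (∀ p q, U p q) × (∀ p q, V p q) :=
        (0, fun p q => if p + q = n then -((-1) ^ p : R) • v p q else 0)
      have hy'2 : (coneD dU dV j y').2 = w.1.2 := by
        funext p q
        rw [coneD_snd]
        have e : w.1.2 p q = shift (dV p) (v p) q := by rw [hv]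
        by_cases hpq : p + q = n + 1
        · rw [e]
          cases q with
          | zero => simp
          | succ q =>
            rw [shift_succ, shift_succ]
            simp only [y']
            rw [if_pos (by omega), neg_smul, neg_smul, map_neg, map_smul, smul_neg, neg_neg,
              neg_one_pow_smul_smul]
        · rw [w.2.1.2 p q hpq]
          cases q with
          | zero => simp
          | succ q =>
            rw [shift_succ]
            simp only [y']
            rw [if_neg (by omega)]
            simp
      have hx : w.1.1 - (coneD dU dV j y').1 ∈ X := by
        refine ⟨Submodule.sub_mem _ w.2.1.1 fun p q h => ?_, fun p _ q _ => ?_⟩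
        · rw [coneD_fst]
          simp only [y']
          rw [if_neg h]
          cases q <;> simp
        · change dU p q (w.1.1 p q - (coneD dU dV j y').1 p q) = 0
          have h1 := congrFun (congrFun hy'2 p) (q + 1)
          have h2 := cyc' w p (q + 1)
          rw [← h1, coneD_snd, shift_succ, shift_succ, map_smul] at h2
          have h3 := congrArg (fun t => -((-1) ^ p : R) • t) h2
          simp only [neg_smul, smul_neg, neg_neg, neg_one_pow_smul_smul] at h3
          have h4 : (coneD dU dV j y').1 p q = j p q (y'.2 p q) := by
            rw [coneD_fst]
            cases q <;> simp [y']
          rw [map_sub, h4, hj, h3, sub_self]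
      refine ⟨Λ ⟨_, hx⟩, ?_⟩
      rw [hf, ← sub_eq_zero]
      change κ _ - κ w = 0
      rw [← map_sub, κ_zero]
      refine ⟨-y', Submodule.neg_mem _ ⟨Submodule.zero_mem _, fun p q h => if_neg h⟩, ?_⟩
      rw [map_neg]
      change _ = (w.1.1 - (coneD dU dV j y').1, 0) - w.1
      refine Prod.ext ?_ ?_
      · change -(coneD dU dV j y').1 = w.1.1 - (coneD dU dV j y').1 - w.1.1
        abel
      · change -(coneD dU dV j y').2 = 0 - w.1.2
        rw [hy'2, zero_sub]
    · rintro ⟨l, rfl⟩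
      obtain ⟨x, rfl⟩ := Λ_surj l
      rw [hf]
      change g (κ _) = 0
      rw [hg, hψ]
      intro p q
      exact Submodule.zero_mem _

end Core

section Flat

variable {R : Type*} [CommRing R]

section

variable (K : Type*) [AddCommGroup K] [Module R K] [Module.Flat R K]
  {C C' Y : Type*} [AddCommGroup C] [Module R C] [AddCommGroup C'] [Module R C']
  [AddCommGroup Y] [Module R Y]

/-- For a flat module `K`, the canonical isomorphism of `K ⊗ ker f` with the kernel of `K ⊗ f`. -/
noncomputable def flatKerEquiv (f : C →ₗ[R] C') :
    K ⊗[R] LinearMap.ker f ≃ₗ[R] LinearMap.ker (f.lTensor K) :=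
  (LinearEquiv.ofInjective ((LinearMap.ker f).subtype.lTensor K)
    (Module.Flat.lTensor_preserves_injective_linearMap _
      (LinearMap.ker f).injective_subtype)).trans
    (LinearEquiv.ofEq _ _ (LinearMap.exact_iff.1
      (Module.Flat.lTensor_exact K (LinearMap.exact_subtype_ker_map f))).symm)

lemma coe_flatKerEquiv (f : C →ₗ[R] C') (t : K ⊗[R] LinearMap.ker f) :
    (flatKerEquiv K f t : K ⊗[R] C) = (LinearMap.ker f).subtype.lTensor K t := rfl

/-- The map `ker (K ⊗ f) → K ⊗ Y` induced by a map `ker f → Y`. -/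
noncomputable def flatPres (f : C →ₗ[R] C') (π : LinearMap.ker f →ₗ[R] Y) :
    LinearMap.ker (f.lTensor K) →ₗ[R] K ⊗[R] Y :=
  π.lTensor K ∘ₗ (flatKerEquiv K f).symm.toLinearMap

lemma flatPres_apply (f : C →ₗ[R] C') (π : LinearMap.ker f →ₗ[R] Y)
    (t : K ⊗[R] LinearMap.ker f) : flatPres K f π (flatKerEquiv K f t) = π.lTensor K t := by
  simp [flatPres]

lemma flatPres_surjective (f : C →ₗ[R] C') (π : LinearMap.ker f →ₗ[R] Y)
    (hπ : Function.Surjective π) : Function.Surjective (flatPres K f π) :=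
  (LinearMap.lTensor_surjective K hπ).comp (flatKerEquiv K f).symm.surjective

variable {K} in
lemma flatPres_naturality {K' : Type*} [AddCommGroup K'] [Module R K'] [Module.Flat R K']
    (j : K →ₗ[R] K') (f : C →ₗ[R] C') (π : LinearMap.ker f →ₗ[R] Y)
    (x : LinearMap.ker (f.lTensor K)) (y : LinearMap.ker (f.lTensor K'))
    (h : (y : K' ⊗[R] C) = j.rTensor C x) :
    flatPres K' f π y = j.rTensor Y (flatPres K f π x) := by
  obtain ⟨t, rfl⟩ := (flatKerEquiv K f).surjective x
  have : y = flatKerEquiv K' f (j.rTensor _ t) := by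
    ext
    rw [h, coe_flatKerEquiv, coe_flatKerEquiv]
    exact LinearMap.congr_fun (TensorProduct.ext' fun a b => rfl :
      j.rTensor C ∘ₗ (LinearMap.ker f).subtype.lTensor K =
        (LinearMap.ker f).subtype.lTensor K' ∘ₗ j.rTensor _) t
  rw [this, flatPres_apply, flatPres_apply]
  exact LinearMap.congr_fun (TensorProduct.ext' fun a b => rfl :
    π.lTensor K' ∘ₗ j.rTensor _ = j.rTensor Y ∘ₗ π.lTensor K) t

lemma flatPres_eq_zero_iff (f : C →ₗ[R] C') (π : LinearMap.ker f →ₗ[R] Y)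
    (hπ : Function.Surjective π) (B : Submodule R C)
    (hB : B ≤ LinearMap.ker f) (hπB : ∀ x, π x = 0 ↔ (x : C) ∈ B)
    (x : LinearMap.ker (f.lTensor K)) :
    flatPres K f π x = 0 ↔ (x : K ⊗[R] C) ∈ LinearMap.range (B.subtype.lTensor K) := by
  have hex : Function.Exact (Submodule.inclusion hB) π := fun x => by
    rw [hπB]
    exact ⟨fun h => ⟨⟨x, h⟩, rfl⟩, by rintro ⟨b, rfl⟩; exact b.2⟩
  have hc : (LinearMap.ker f).subtype.lTensor K ∘ₗ (Submodule.inclusion hB).lTensor K =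
      B.subtype.lTensor K := by
    rw [← LinearMap.lTensor_comp]; rfl
  obtain ⟨t, rfl⟩ := (flatKerEquiv K f).surjective x
  rw [flatPres_apply, lTensor_exact K hex hπ t, coe_flatKerEquiv, ← hc]
  have inj := Module.Flat.lTensor_preserves_injective_linearMap (M := K) _
      (LinearMap.ker f).injective_subtype
  constructor
  · rintro ⟨s, rfl⟩
    exact ⟨s, rfl⟩
  · rintro ⟨s, hs⟩
    exact ⟨s, inj hs⟩

end

lemma range_lTensor_coboundaries {C : ℕ → Type*} [∀ q, AddCommGroup (C q)] [∀ q, Module R (C q)]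
    (c : ∀ q, C q →ₗ[R] C (q + 1)) (K : Type*) [AddCommGroup K] [Module R K] (q : ℕ) :
    LinearMap.range ((coboundaries c q).subtype.lTensor K) =
      coboundaries (fun q => (c q).lTensor K) q := by
  cases q with
  | zero =>
    have : (coboundaries c 0).subtype = 0 := by
      ext x
      exact (Submodule.mem_bot R).1 x.2
    rw [this, LinearMap.lTensor_zero, LinearMap.range_zero]
    rfl
  | succ q =>
    change _ = LinearMap.range ((c q).lTensor K)
    have : c q = (LinearMap.range (c q)).subtype ∘ₗ (c q).rangeRestrict := rfl
    conv_rhs => rw [this, LinearMap.lTensor_comp]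
    rw [LinearMap.range_comp_of_range_eq_top]
    · rfl
    · exact LinearMap.range_eq_top.2
        (LinearMap.lTensor_surjective K (c q).surjective_rangeRestrict)

lemma coboundaries_le_ker {C : ℕ → Type*} [∀ q, AddCommGroup (C q)] [∀ q, Module R (C q)]
    (c : ∀ q, C q →ₗ[R] C (q + 1)) (hc : ∀ q x, c (q + 1) (c q x) = 0) (q : ℕ) :
    coboundaries c q ≤ LinearMap.ker (c q) := by
  cases q with
  | zero => exact bot_le
  | succ q =>
    rintro _ ⟨x, rfl⟩
    exact hc q x

lemma flatPres_coboundaries {C : ℕ → Type*} [∀ q, AddCommGroup (C q)] [∀ q, Module R (C q)]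
    (c : ∀ q, C q →ₗ[R] C (q + 1)) (hc : ∀ q x, c (q + 1) (c q x) = 0)
    (K : Type*) [AddCommGroup K] [Module R K] [Module.Flat R K] (q : ℕ)
    {Y : Type*} [AddCommGroup Y] [Module R Y] (π : LinearMap.ker (c q) →ₗ[R] Y)
    (hπ : Function.Surjective π) (hπB : ∀ x, π x = 0 ↔ (x : C q) ∈ coboundaries c q)
    (x : LinearMap.ker ((c q).lTensor K)) :
    flatPres K (c q) π x = 0 ↔
      (x : K ⊗[R] C q) ∈ coboundaries (fun q => (c q).lTensor K) q := by
  rw [flatPres_eq_zero_iff K (c q) π hπ _ (coboundaries_le_ker c hc q) hπB,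
    range_lTensor_coboundaries]

end Flat

section Homology

variable {R : Type*} [Ring R]

lemma shortComplex_homology_pres (S : ShortComplex (ModuleCat R)) :
    ∃ π : LinearMap.ker S.g.hom →ₗ[R] S.homology, Function.Surjective π ∧
      ∀ x, π x = 0 ↔ (x : S.X₂) ∈ LinearMap.range S.f.hom := by
  refine ⟨S.moduleCatHomologyIso.toLinearEquiv.symm.toLinearMap ∘ₗ
    (LinearMap.range S.moduleCatToCycles).mkQ,
    S.moduleCatHomologyIso.toLinearEquiv.symm.surjective.comp (Submodule.mkQ_surjective _),
    fun x => ?_⟩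
  have : (S.moduleCatHomologyIso.toLinearEquiv.symm.toLinearMap ∘ₗ
    (LinearMap.range S.moduleCatToCycles).mkQ) x = 0 ↔
      (LinearMap.range S.moduleCatToCycles).mkQ x = 0 :=
    S.moduleCatHomologyIso.toLinearEquiv.symm.map_eq_zero_iff
  rw [this, Submodule.mkQ_apply, Submodule.Quotient.mk_eq_zero]
  constructor
  · rintro ⟨y, rfl⟩
    exact ⟨y, rfl⟩
  · rintro ⟨y, hy⟩
    exact ⟨y, Subtype.ext hy⟩

lemma homology_pres {ι : Type*} {c : ComplexShape ι} (K : HomologicalComplex (ModuleCat R) c)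
    (i j k : ι) (hi : c.prev j = i) (hk : c.next j = k) :
    ∃ π : LinearMap.ker (K.d j k).hom →ₗ[R] K.homology j, Function.Surjective π ∧
      ∀ x, π x = 0 ↔ (x : K.X j) ∈ LinearMap.range (K.d i j).hom := by
  subst hi hk
  exact shortComplex_homology_pres (K.sc j)

end Homology

section

variable {R : Type*} [CommRing R]

lemma cochainComplex_homology_pres_coboundaries (K : CochainComplex (ModuleCat R) ℕ) (q : ℕ) :
    ∃ π : LinearMap.ker (K.d q (q + 1)).hom →ₗ[R] K.homology q, Function.Surjective π ∧
      ∀ x, π x = 0 ↔ (x : K.X q) ∈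
        coboundaries (U := fun q => K.X q) (fun q => (K.d q (q + 1)).hom) q := by
  cases q with
  | zero =>
    obtain ⟨π, h1, h2⟩ := homology_pres K 0 0 1 (CochainComplex.prev_nat_zero)
      (CochainComplex.next ℕ 0)
    refine ⟨π, h1, fun x => ?_⟩
    rw [h2, K.shape 0 0 (by simp)]
    change _ ∈ LinearMap.range (0 : K.X 0 →ₗ[R] K.X 0) ↔ _
    rw [LinearMap.range_zero]
    rfl
  | succ q =>
    exact homology_pres K q (q + 1) (q + 2) (CochainComplex.prev_nat_succ q)
      (CochainComplex.next ℕ _)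

/-- Two surjections out of the same module with the same kernel have isomorphic targets. -/
lemma exists_equiv_of_ker_eq {E X Y : Type*} [AddCommGroup E] [AddCommGroup X] [AddCommGroup Y]
    [Module R E] [Module R X] [Module R Y] (f : E →ₗ[R] X) (g : E →ₗ[R] Y)
    (hf : Function.Surjective f) (hg : Function.Surjective g) (h : ∀ x, f x = 0 ↔ g x = 0) :
    ∃ e : X ≃ₗ[R] Y, ∀ x, e (f x) = g x := by
  obtain ⟨k, hk⟩ := exists_lift f hf g (fun x hx => (h x).1 hx)
  have hbij : Function.Bijective k := by
    constructor
    · rw [injective_iff_map_eq_zero]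
      intro x hx
      obtain ⟨y, rfl⟩ := hf x
      rw [hk] at hx
      exact (h y).2 hx
    · intro y
      obtain ⟨x, rfl⟩ := hg y
      exact ⟨f x, hk x⟩
  exact ⟨LinearEquiv.ofBijective k hbij, hk⟩

lemma exists_projectiveResolution_tor_one {R : Type} [CommRing R] (X Y : ModuleCat.{0} R) :
    ∃ (P₀ P₁ P₂ : ModuleCat.{0} R) (d₁ : P₁ →ₗ[R] P₀) (d₂ : P₂ →ₗ[R] P₁) (ε : P₀ →ₗ[R] Y)
      (_ : Module.Flat R P₀) (_ : Module.Flat R P₁)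
      (_ : Function.Exact d₂ d₁) (_ : Function.Exact d₁ ε) (_ : Function.Surjective ε)
      (π : LinearMap.ker (d₁.lTensor X) →ₗ[R] ((Tor (ModuleCat R) 1).obj X).obj Y),
        Function.Surjective π ∧ ∀ x, π x = 0 ↔ (x : X ⊗[R] P₁) ∈
          LinearMap.range (d₂.lTensor X) := by
  let P := projectiveResolution Y
  let F := (MonoidalCategory.tensoringLeft (ModuleCat.{0} R)).obj X
  obtain ⟨π, h1, h2⟩ := homology_pres ((F.mapHomologicalComplex _).obj P.complex) 2 1 0
    (ChainComplex.prev ℕ 1) (ChainComplex.next_nat_succ 0)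
  have flat : ∀ n, Module.Flat R (P.complex.X n) := fun n => by
    have : Module.Projective R (P.complex.X n) :=
      (IsProjective.iff_projective _).2 (P.projective n)
    infer_instance
  let e0 := (HomologicalComplex.singleObjXSelf (ComplexShape.down ℕ) 0 Y).toLinearEquiv
  refine ⟨P.complex.X 0, P.complex.X 1, P.complex.X 2, (P.complex.d 1 0).hom,
    (P.complex.d 2 1).hom, e0.toLinearMap ∘ₗ (P.π.f 0).hom, flat 0, flat 1, ?_, ?_, ?_,
    (P.isoLeftDerivedObj F 1).toLinearEquiv.symm.toLinearMap ∘ₗ π, ?_, ?_⟩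
  · exact (ShortComplex.ShortExact.moduleCat_exact_iff_function_exact _).1 (P.exact_succ 0)
  · intro x
    refine Iff.trans ?_
      ((ShortComplex.ShortExact.moduleCat_exact_iff_function_exact _).1 P.exact₀ x)
    exact e0.map_eq_zero_iff
  · exact e0.surjective.comp ((ModuleCat.epi_iff_surjective (P.π.f 0)).1 inferInstance)
  · exact (P.isoLeftDerivedObj F 1).toLinearEquiv.symm.surjective.comp h1
  · intro x
    exact Iff.trans (P.isoLeftDerivedObj F 1).toLinearEquiv.symm.map_eq_zero_iff (h2 x)

lemma tor_one_equiv {R : Type} [CommRing R] {B Z : Type} [AddCommGroup B] [Module R B]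
    [AddCommGroup Z] [Module R Z] [Module.Flat R Z] (X Y : ModuleCat.{0} R)
    (j : B →ₗ[R] Z) (p : Z →ₗ[R] X) (hj : Function.Injective j) (hjp : Function.Exact j p)
    (hp : Function.Surjective p) :
    Nonempty (LinearMap.ker (j.rTensor Y) ≃ₗ[R] ((Tor (ModuleCat R) 1).obj X).obj Y) := by
  obtain ⟨P₀, P₁, P₂, d₁, d₂, ε, _, _, hd, hε, hεs, π, hπ, hπ0⟩ :=
    exists_projectiveResolution_tor_one X Y
  let E : Submodule R ((Z ⊗[R] P₁) × (B ⊗[R] P₀)) :=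
    LinearMap.ker (d₁.lTensor Z ∘ₗ LinearMap.fst R _ _ - j.rTensor P₀ ∘ₗ LinearMap.snd R _ _)
  have hE : ∀ z b, (z, b) ∈ E ↔ d₁.lTensor Z z = j.rTensor P₀ b := fun z b => sub_eq_zero
  have c1 : ∀ z : Z ⊗[R] P₁, d₁.lTensor X (p.rTensor _ z) = p.rTensor _ (d₁.lTensor Z z) :=
    fun z => by
      rw [← LinearMap.comp_apply, ← LinearMap.comp_apply, LinearMap.rTensor_comp_lTensor,
        LinearMap.lTensor_comp_rTensor]
  have c2 : ∀ z : Z ⊗[R] P₂, d₂.lTensor X (p.rTensor _ z) = p.rTensor _ (d₂.lTensor Z z) :=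
    fun z => by
      rw [← LinearMap.comp_apply, ← LinearMap.comp_apply, LinearMap.rTensor_comp_lTensor,
        LinearMap.lTensor_comp_rTensor]
  have c3 : ∀ b : B ⊗[R] P₁, d₁.lTensor Z (j.rTensor _ b) = j.rTensor _ (d₁.lTensor B b) :=
    fun z => by
      rw [← LinearMap.comp_apply, ← LinearMap.comp_apply, LinearMap.rTensor_comp_lTensor,
        LinearMap.lTensor_comp_rTensor]
  have c4 : ∀ b : B ⊗[R] P₀, ε.lTensor Z (j.rTensor _ b) = j.rTensor _ (ε.lTensor B b) :=
    fun z => by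
      rw [← LinearMap.comp_apply, ← LinearMap.comp_apply, LinearMap.rTensor_comp_lTensor,
        LinearMap.lTensor_comp_rTensor]
  have ex0 := rTensor_exact P₀ hjp hp
  have ex1 := rTensor_exact P₁ hjp hp
  have eZ := Module.Flat.lTensor_exact Z hd
  have eZ' := lTensor_exact Z hε hεs
  have eB' := lTensor_exact B hε hεs
  have inj0 : Function.Injective (j.rTensor P₀) :=
    Module.Flat.rTensor_preserves_injective_linearMap j hj
  let f₁ : E →ₗ[R] LinearMap.ker (d₁.lTensor X) :=
    LinearMap.codRestrict _ (p.rTensor P₁ ∘ₗ LinearMap.fst R _ _ ∘ₗ E.subtype) (fun w => by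
      change d₁.lTensor X (p.rTensor _ w.1.1) = 0
      rw [c1, (hE _ _).1 w.2]
      exact (ex0 _).2 ⟨_, rfl⟩)
  let f₂ : E →ₗ[R] LinearMap.ker (j.rTensor Y) :=
    LinearMap.codRestrict _ (ε.lTensor B ∘ₗ LinearMap.snd R _ _ ∘ₗ E.subtype) (fun w => by
      change j.rTensor Y (ε.lTensor B w.1.2) = 0
      rw [← c4, ← (hE _ _).1 w.2]
      exact (eZ' _).2 ⟨_, rfl⟩)
  have h₁ : Function.Surjective f₁ := by
    rintro ⟨u, hu⟩
    obtain ⟨z, rfl⟩ := LinearMap.rTensor_surjective P₁ hp u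
    obtain ⟨b, hb⟩ := (ex0 (d₁.lTensor Z z)).1 ((c1 z).symm.trans hu)
    exact ⟨⟨(z, b), (hE _ _).2 hb.symm⟩, rfl⟩
  have h₂ : Function.Surjective f₂ := by
    rintro ⟨y, hy⟩
    obtain ⟨b, rfl⟩ := LinearMap.lTensor_surjective B hεs y
    obtain ⟨z, hz⟩ := (eZ' (j.rTensor _ b)).1 ((c4 b).trans hy)
    exact ⟨⟨(z, b), (hE _ _).2 hz⟩, rfl⟩
  obtain ⟨e, -⟩ := exists_equiv_of_ker_eq f₂ (π ∘ₗ f₁) h₂ (hπ.comp h₁) (fun ⟨⟨z, b⟩, hw⟩ => by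
    have hw' := (hE _ _).1 hw
    rw [LinearMap.comp_apply, hπ0, Subtype.ext_iff]
    change ε.lTensor B b = 0 ↔ p.rTensor _ z ∈ _
    rw [eB' b]
    constructor
    · rintro ⟨b₁, rfl⟩
      obtain ⟨z₂, hz₂⟩ := (eZ (z - j.rTensor _ b₁)).1 (by rw [map_sub, c3, hw', sub_self])
      refine ⟨p.rTensor _ z₂, ?_⟩
      rw [c2, hz₂, map_sub, (ex1 (j.rTensor _ b₁)).2 ⟨_, rfl⟩, sub_zero]
    · rintro ⟨x₂, hx₂⟩
      obtain ⟨z₂, rfl⟩ := LinearMap.rTensor_surjective P₂ hp x₂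
      obtain ⟨b₁, hb₁⟩ := (ex1 (z - d₂.lTensor Z z₂)).1 (by rw [map_sub, ← c2, hx₂, sub_self])
      refine ⟨b₁, inj0 ?_⟩
      rw [← c3, hb₁, map_sub, (eZ (d₂.lTensor Z z₂)).2 ⟨_, rfl⟩, sub_zero, hw'])
  exact ⟨e⟩

end

section Total

variable {R : Type*} [CommRing R]

/-- The differential of the total complex of a double complex. -/
def totD {W : ℕ → ℕ → Type*} [∀ p q, AddCommGroup (W p q)] [∀ p q, Module R (W p q)]
    (d₁ : ∀ p q, W p q →ₗ[R] W (p + 1) q) (d₂ : ∀ p q, W p q →ₗ[R] W p (q + 1)) :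
    (∀ p q, W p q) →ₗ[R] ∀ p q, W p q :=
  shift (fun p => LinearMap.pi fun q => d₁ p q ∘ₗ LinearMap.proj q) +
    LinearMap.pi fun p => ((-1) ^ p : R) • shift (d₂ p) ∘ₗ LinearMap.proj p

section

variable {W : ℕ → ℕ → Type*} [∀ p q, AddCommGroup (W p q)] [∀ p q, Module R (W p q)]
    (d₁ : ∀ p q, W p q →ₗ[R] W (p + 1) q) (d₂ : ∀ p q, W p q →ₗ[R] W p (q + 1))

lemma totD_zero (w : ∀ p q, W p q) (q : ℕ) :
    totD d₁ d₂ w 0 q = shift (d₂ 0) (w 0) q := by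
  change 0 + ((-1) ^ 0 : R) • shift (d₂ 0) (w 0) q = _
  rw [pow_zero, one_smul, zero_add]

lemma totD_succ (w : ∀ p q, W p q) (p q : ℕ) :
    totD d₁ d₂ w (p + 1) q =
      d₁ p q (w p q) + ((-1) ^ (p + 1) : R) • shift (d₂ (p + 1)) (w (p + 1)) q := rfl

end

/-- The cocycles of total degree `n` of a double complex. -/
def totCycles {W : ℕ → ℕ → Type*} [∀ p q, AddCommGroup (W p q)] [∀ p q, Module R (W p q)]
    (d₁ : ∀ p q, W p q →ₗ[R] W (p + 1) q) (d₂ : ∀ p q, W p q →ₗ[R] W p (q + 1)) (n : ℕ) :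
    Submodule R (∀ p q, W p q) :=
  supported (fun p q => p + q = n) ⊓ LinearMap.ker (totD d₁ d₂)

section Split

variable {A C : ℕ → Type*} [∀ p, AddCommGroup (A p)] [∀ p, Module R (A p)]
  [∀ q, AddCommGroup (C q)] [∀ q, Module R (C q)]
  (a : ∀ p, A p →ₗ[R] A (p + 1)) (c : ∀ q, C q →ₗ[R] C (q + 1))
  (s : ∀ p, coboundaries a (p + 1) →ₗ[R] A p)

/-- The differential of a complex, as a map to the coboundaries. -/
def toCoboundaries (p : ℕ) : A p →ₗ[R] coboundaries a (p + 1) := (a p).rangeRestrict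

/-- The comparison of the product of mapping cones with the total complex, for a split complex
`A`. -/
noncomputable def splitMap : ((∀ p q, LinearMap.ker (a p) ⊗[R] C q) ×
    (∀ p q, coboundaries a p ⊗[R] C q)) →ₗ[R] ∀ p q, A p ⊗[R] C q :=
  LinearMap.pi fun p => LinearMap.pi fun q =>
    (LinearMap.ker (a p)).subtype.rTensor (C q) ∘ₗ evalAt p q ∘ₗ LinearMap.fst R _ _ +
    (s p).rTensor (C q) ∘ₗ
      evalAt (U := fun p q => coboundaries a p ⊗[R] C q) (p + 1) q ∘ₗ LinearMap.snd R _ _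

lemma splitMap_apply (x : (∀ p q, LinearMap.ker (a p) ⊗[R] C q) ×
    (∀ p q, coboundaries a p ⊗[R] C q)) (p q : ℕ) :
    splitMap a s x p q = (LinearMap.ker (a p)).subtype.rTensor (C q) (x.1 p q) +
      (s p).rTensor (C q) (x.2 (p + 1) q) := rfl

lemma coboundaries_zero_tensor (q : ℕ) (x : coboundaries a 0 ⊗[R] C q) : x = 0 := by
  have h : (LinearMap.id : coboundaries a 0 →ₗ[R] coboundaries a 0) = 0 := by
    ext x
    exact (Submodule.mem_bot R).1 x.2
  rw [← LinearMap.id_apply (R := R) x, ← LinearMap.rTensor_id, h, LinearMap.rTensor_zero]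
  rfl

variable {a s} (ha : ∀ p x, a (p + 1) (a p x) = 0) (hs : ∀ p x, a p (s p x) = x)

include hs in
lemma range_split (p q : ℕ) (b : coboundaries a (p + 1) ⊗[R] C q) :
    (toCoboundaries a p).rTensor (C q) ((s p).rTensor (C q) b) = b := by
  rw [← LinearMap.comp_apply, ← LinearMap.rTensor_comp]
  have : toCoboundaries a p ∘ₗ s p = LinearMap.id := by
    ext x
    exact hs p x
  rw [this, LinearMap.rTensor_id]
  rfl

lemma range_ker (p q : ℕ) (z : LinearMap.ker (a p) ⊗[R] C q) :
    (toCoboundaries a p).rTensor (C q) ((LinearMap.ker (a p)).subtype.rTensor (C q) z) = 0 := by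
  rw [← LinearMap.comp_apply, ← LinearMap.rTensor_comp]
  have : toCoboundaries a p ∘ₗ (LinearMap.ker (a p)).subtype = 0 := by
    ext x
    exact x.2
  rw [this, LinearMap.rTensor_zero]
  rfl

include hs in
lemma exists_split (p : ℕ) : ∃ π : A p →ₗ[R] LinearMap.ker (a p),
    π ∘ₗ (LinearMap.ker (a p)).subtype = LinearMap.id ∧
    (LinearMap.ker (a p)).subtype ∘ₗ π + s p ∘ₗ toCoboundaries a p = LinearMap.id := by
  refine ⟨LinearMap.codRestrict _ (LinearMap.id - s p ∘ₗ toCoboundaries a p) fun x => ?_, ?_, ?_⟩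
  · change a p (x - s p _) = 0
    rw [map_sub, hs]
    exact sub_self _
  · ext x
    change (x : A p) - s p (toCoboundaries a p x) = x
    have : toCoboundaries a p x = 0 := Subtype.ext x.2
    rw [this, map_zero, sub_zero]
  · ext x
    exact sub_add_cancel _ _

include hs in
lemma splitMap_injective (x : (∀ p q, LinearMap.ker (a p) ⊗[R] C q) ×
    (∀ p q, coboundaries a p ⊗[R] C q)) (p q : ℕ) (h : splitMap a s x p q = 0) :
    x.1 p q = 0 ∧ x.2 (p + 1) q = 0 := by
  rw [splitMap_apply] at h
  have h2 : x.2 (p + 1) q = 0 := by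
    have := congrArg ((toCoboundaries a p).rTensor (C q)) h
    rw [map_add, range_ker, zero_add, map_zero] at this
    exact (range_split hs p q _).symm.trans this
  refine ⟨?_, h2⟩
  rw [h2, map_zero, add_zero] at h
  obtain ⟨π, hπ, -⟩ := exists_split hs p
  have := congrArg (π.rTensor (C q)) h
  rwa [← LinearMap.comp_apply, ← LinearMap.rTensor_comp, hπ, LinearMap.rTensor_id, map_zero] at this

include hs in
lemma splitMap_eq_zero (x : (∀ p q, LinearMap.ker (a p) ⊗[R] C q) ×
    (∀ p q, coboundaries a p ⊗[R] C q)) (h : splitMap a s x = 0) : x = 0 := by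
  have h' := fun p q => splitMap_injective hs x p q (congrFun (congrFun h p) q)
  refine Prod.ext (funext₂ fun p q => (h' p q).1) (funext₂ fun p q => ?_)
  cases p with
  | zero => exact coboundaries_zero_tensor a q _
  | succ p => exact (h' p q).2

include hs in
lemma splitMap_surjective : Function.Surjective (splitMap (C := C) a s) := fun w => by
  choose π h1 h2 using exists_split hs
  refine ⟨(fun p q => (π p).rTensor (C q) (w p q), fun p => match p with
    | 0 => 0
    | p + 1 => fun q => (toCoboundaries a p).rTensor (C q) (w p q)), ?_⟩
  funext p q
  rw [splitMap_apply]
  have := LinearMap.congr_fun (congrArg (LinearMap.rTensor (C q)) (h2 p)) (w p q)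
  rwa [LinearMap.rTensor_add, LinearMap.rTensor_comp, LinearMap.rTensor_comp,
    LinearMap.rTensor_id] at this

include hs in
lemma splitMap_mem_supported_iff {P P' : ℕ → ℕ → Prop} (h : ∀ p q, P' (p + 1) q ↔ P p q)
    (x : (∀ p q, LinearMap.ker (a p) ⊗[R] C q) × (∀ p q, coboundaries a p ⊗[R] C q)) :
    splitMap a s x ∈ supported (R := R) P ↔
      x ∈ (supported (R := R) P).prod (supported (R := R) P') := by
  constructor
  · intro hx
    refine ⟨fun p q hp => (splitMap_injective hs x p q (hx p q hp)).1, fun p q hp => ?_⟩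
    cases p with
    | zero => exact coboundaries_zero_tensor a q _
    | succ p => exact (splitMap_injective hs x p q (hx p q fun h' => hp ((h p q).2 h'))).2
  · intro hx p q hp
    rw [splitMap_apply, hx.1 p q hp, hx.2 (p + 1) q fun h' => hp ((h p q).1 h')]
    simp

include hs in
lemma splitMap_coneD (x : (∀ p q, LinearMap.ker (a p) ⊗[R] C q) ×
    (∀ p q, coboundaries a p ⊗[R] C q)) :
    splitMap a s (coneD (fun p q => (c q).lTensor (LinearMap.ker (a p)))
      (fun p q => (c q).lTensor (coboundaries a p))
      (fun p q => (Submodule.inclusion (coboundaries_le_ker a ha p)).rTensor (C q)) x) =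
    totD (fun p q => (a p).rTensor (C q)) (fun p q => (c q).lTensor (A p)) (splitMap a s x) := by
  have key : ∀ p q, shift (fun q => (c q).lTensor (A p)) (splitMap a s x p) q =
      (LinearMap.ker (a p)).subtype.rTensor (C q)
        (shift (fun q => (c q).lTensor (LinearMap.ker (a p))) (x.1 p) q) +
      (s p).rTensor (C q)
        (shift (fun q => (c q).lTensor (coboundaries a (p + 1))) (x.2 (p + 1)) q) := by
    intro p q
    cases q with
    | zero => simp
    | succ q =>
      rw [shift_succ, shift_succ, shift_succ, splitMap_apply, map_add]
      simp only [← LinearMap.comp_apply, LinearMap.rTensor_comp_lTensor,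
        LinearMap.lTensor_comp_rTensor]
  have key2 : ∀ p q (b : coboundaries a p ⊗[R] C q), (LinearMap.ker (a p)).subtype.rTensor (C q)
      ((Submodule.inclusion (coboundaries_le_ker a ha p)).rTensor (C q) b) =
      (coboundaries a p).subtype.rTensor (C q) b := fun p q b => by
    rw [← LinearMap.comp_apply, ← LinearMap.rTensor_comp]
    rfl
  funext p q
  rw [splitMap_apply, coneD_fst, coneD_snd, map_add, key2, map_smul, map_smul, pow_succ,
    mul_neg_one, neg_neg]
  cases p with
  | zero =>
    rw [totD_zero, key, coboundaries_zero_tensor a q (x.2 0 q), map_zero, zero_add, pow_zero,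
      one_smul, one_smul]
  | succ p =>
    rw [totD_succ, key, smul_add, add_assoc]
    congr 1
    rw [splitMap_apply, map_add]
    have h1 : (a p).rTensor (C q) ((LinearMap.ker (a p)).subtype.rTensor (C q) (x.1 p q)) = 0 := by
      rw [← LinearMap.comp_apply, ← LinearMap.rTensor_comp]
      have : a p ∘ₗ (LinearMap.ker (a p)).subtype = 0 := by
        ext x
        exact x.2
      rw [this, LinearMap.rTensor_zero]
      rfl
    rw [h1, zero_add, ← LinearMap.comp_apply, ← LinearMap.rTensor_comp]
    have : a p ∘ₗ s p = (coboundaries a (p + 1)).subtype := by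
      ext x
      exact hs p x
    rw [this]

end Split

end Total

section Main

lemma exists_section {R : Type*} [CommRing R] [IsDedekindDomain R]
    {A A' : Type*} [AddCommGroup A] [Module R A] [AddCommGroup A'] [Module R A']
    [Module.Finite R A] [Module.Free R A'] (a : A →ₗ[R] A') :
    ∃ s : LinearMap.range a →ₗ[R] A, ∀ x, a (s x) = x := by
  have : Module.IsTorsionFree R (LinearMap.range a) := inferInstance
  have : Module.Flat R (LinearMap.range a) := inferInstance
  have : Module.FinitePresentation R (LinearMap.range a) :=
    Module.finitePresentation_of_finite R _
  have : Module.Projective R (LinearMap.range a) :=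
    Module.Flat.projective_of_finitePresentation
  obtain ⟨s, hs⟩ := Module.projective_lifting_property a.rangeRestrict LinearMap.id
    a.surjective_rangeRestrict
  exact ⟨s, fun x => congrArg Subtype.val (LinearMap.congr_fun hs x)⟩

/-- The Künneth exact sequence for the tensor product of a complex of finitely generated free
modules over a Dedekind domain with an arbitrary complex. -/
theorem tensor_kunneth {R : Type} [CommRing R] [IsDedekindDomain R]
    {A C HA HC : ℕ → Type} [∀ p, AddCommGroup (A p)] [∀ p, Module R (A p)]
    [∀ q, AddCommGroup (C q)] [∀ q, Module R (C q)]
    [∀ p, AddCommGroup (HA p)] [∀ p, Module R (HA p)]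
    [∀ q, AddCommGroup (HC q)] [∀ q, Module R (HC q)]
    [∀ p, Module.Finite R (A p)] [∀ p, Module.Free R (A p)]
    (a : ∀ p, A p →ₗ[R] A (p + 1)) (c : ∀ q, C q →ₗ[R] C (q + 1))
    (ha : ∀ p x, a (p + 1) (a p x) = 0) (hc : ∀ q x, c (q + 1) (c q x) = 0)
    (πA : ∀ p, LinearMap.ker (a p) →ₗ[R] HA p) (πA_surj : ∀ p, Function.Surjective (πA p))
    (πA_zero : ∀ p x, πA p x = 0 ↔ (x : A p) ∈ coboundaries a p)
    (πC : ∀ q, LinearMap.ker (c q) →ₗ[R] HC q) (πC_surj : ∀ q, Function.Surjective (πC q))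
    (πC_zero : ∀ q x, πC q x = 0 ↔ (x : C q) ∈ coboundaries c q)
    (n : ℕ) {H : Type} [AddCommGroup H] [Module R H]
    (κ : totCycles (fun p q => (a p).rTensor (C q)) (fun p q => (c q).lTensor (A p)) n →ₗ[R] H)
    (κ_surj : Function.Surjective κ)
    (κ_zero : ∀ x, κ x = 0 ↔ ∃ y ∈ supported (R := R) (fun p q => p + q + 1 = n),
      totD (fun p q => (a p).rTensor (C q)) (fun p q => (c q).lTensor (A p)) y = x) :
    ∃ (f : supported (R := R) (U := fun p q => HA p ⊗[R] HC q) (fun p q => p + q = n) →ₗ[R] H)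
      (g : H →ₗ[R] supported (R := R) (U := fun p q => ((Tor (ModuleCat R) 1).obj
        (ModuleCat.of R (HA p))).obj (ModuleCat.of R (HC q))) (fun p q => p + q = n + 1)),
      Function.Injective f ∧ Function.Surjective g ∧ Function.Exact f g := by
  have flatZ : ∀ p, Module.Flat R (LinearMap.ker (a p)) := fun p => inferInstance
  have flatB : ∀ p, Module.Flat R (coboundaries a p) := fun p => inferInstance
  choose s hs using fun p => exists_section (a p)
  change ∀ p, coboundaries a (p + 1) →ₗ[R] A p at s
  change ∀ p (x : coboundaries a (p + 1)), a p (s p x) = x at hs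
  let j : ∀ p, coboundaries a p →ₗ[R] LinearMap.ker (a p) := fun p =>
    Submodule.inclusion (coboundaries_le_ker a ha p)
  have j_inj : ∀ p, Function.Injective (j p) := fun p => Submodule.inclusion_injective _
  have jex : ∀ p, Function.Exact (j p) (πA p) := fun p x => by
    rw [πA_zero]
    exact ⟨fun h => ⟨⟨x, h⟩, rfl⟩, by rintro ⟨b, rfl⟩; exact b.2⟩
  have T := fun p q => tor_one_equiv (ModuleCat.of R (HA p)) (ModuleCat.of R (HC q)) (j p) (πA p)
    (j_inj p) (jex p) (πA_surj p)
  let τ := fun p q => (T p q).some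
  let dU := fun p q => (c q).lTensor (LinearMap.ker (a p))
  let dV := fun p q => (c q).lTensor (coboundaries a p)
  let jj := fun p q => (j p).rTensor (C q)
  have hj : ∀ p q x, dU p q (jj p q x) = jj p (q + 1) (dV p q x) := fun p q x => by
    simp only [dU, dV, jj, ← LinearMap.comp_apply, LinearMap.rTensor_comp_lTensor,
        LinearMap.lTensor_comp_rTensor]
  let κU : ∀ p q, LinearMap.ker (dU p q) →ₗ[R] LinearMap.ker (a p) ⊗[R] HC q := fun p q =>
    flatPres (LinearMap.ker (a p)) (c q) (πC q)
  let κV : ∀ p q, LinearMap.ker (dV p q) →ₗ[R] coboundaries a p ⊗[R] HC q := fun p q =>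
    flatPres (coboundaries a p) (c q) (πC q)
  have κU_surj : ∀ p q, Function.Surjective (κU p q) := fun p q =>
    flatPres_surjective _ _ _ (πC_surj q)
  have κV_surj : ∀ p q, Function.Surjective (κV p q) := fun p q =>
    flatPres_surjective _ _ _ (πC_surj q)
  have κU_zero : ∀ p q x, κU p q x = 0 ↔ (x : LinearMap.ker (a p) ⊗[R] C q) ∈
    coboundaries (dU p) q := fun p q x =>
    flatPres_coboundaries c hc _ q (πC q) (πC_surj q) (πC_zero q) x
  have κU_eq : ∀ p q (x y : LinearMap.ker (dU p q)), κU p q x = κU p q y ↔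
      (x : LinearMap.ker (a p) ⊗[R] C q) - y ∈ coboundaries (dU p) q := fun p q x y =>
    sub_eq_zero.symm.trans
      ((congrArg (· = 0) ((κU p q).map_sub x y).symm).to_iff.trans (κU_zero p q (x - y)))
  have κV_zero : ∀ p q x, κV p q x = 0 ↔ (x : coboundaries a p ⊗[R] C q) ∈
    coboundaries (dV p) q := fun p q x =>
    flatPres_coboundaries c hc _ q (πC q) (πC_surj q) (πC_zero q) x
  have nat : ∀ p q (x : LinearMap.ker (dV p q)) (y : LinearMap.ker (dU p q)),
      (y : LinearMap.ker (a p) ⊗[R] C q) = jj p q x →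
        κU p q y = (j p).rTensor (HC q) (κV p q x) := fun p q x y h =>
    flatPres_naturality (j p) (c q) (πC q) x y h
  have j_ker : ∀ p q (x : LinearMap.ker (dV p q)), jj p q x ∈ LinearMap.ker (dU p q) :=
      fun p q x => by
    rw [LinearMap.mem_ker, hj, x.2, map_zero]
  refine cone_kunneth dU dV jj n hj (fun p q => (πA p).rTensor (HC q) ∘ₗ κU p q)
    (fun p q => (LinearMap.rTensor_surjective _ (πA_surj p)).comp (κU_surj p q)) ?_
    (fun p q => (τ p q).toLinearMap ∘ₗ LinearMap.codRestrict _
      (κV p q ∘ₗ Submodule.inclusion inf_le_left) (fun x => ?_)) ?_ ?_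
    (κ ∘ₗ LinearMap.restrict (splitMap a s) ?_) ?_ ?_
  · intro p q x
    rw [LinearMap.comp_apply, rTensor_exact (HC q) (jex p) (πA_surj p)]
    constructor
    · rintro ⟨y, hy⟩
      obtain ⟨b, rfl⟩ := κV_surj p q y
      rw [← nat p q b ⟨jj p q b, j_ker p q b⟩ rfl] at hy
      refine ⟨b, b.2, ?_⟩
      exact (κU_eq p q x ⟨jj p q b, j_ker p q b⟩).1 hy.symm
    · rintro ⟨b, hb, hx⟩
      refine ⟨κV p q ⟨b, hb⟩, ?_⟩
      rw [← nat p q ⟨b, hb⟩ ⟨jj p q b, j_ker p q ⟨b, hb⟩⟩ rfl]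
      exact ((κU_eq p q x _).2 hx).symm
  · change (j p).rTensor (HC q) (κV p q ⟨x, x.2.1⟩) = 0
    rw [← nat p q ⟨x, x.2.1⟩ ⟨jj p q x, j_ker p q ⟨x, x.2.1⟩⟩ rfl, κU_zero]
    exact x.2.2
  · intro p q
    refine (τ p q).surjective.comp ?_
    rintro ⟨y, hy⟩
    obtain ⟨b, rfl⟩ := κV_surj p q y
    refine ⟨⟨b, b.2, ?_⟩, rfl⟩
    change jj p q b ∈ coboundaries (dU p) q
    rw [← κU_zero p q ⟨jj p q b, j_ker p q b⟩, nat p q b _ rfl]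
    exact hy
  · intro p q x
    refine Iff.trans (τ p q).map_eq_zero_iff ?_
    rw [Subtype.ext_iff]
    exact κV_zero p q ⟨x, x.2.1⟩
  · intro x hx
    refine ⟨?_, ?_⟩
    · exact (splitMap_mem_supported_iff hs (fun p q => by omega) x).2 hx.1
    · change totD _ _ _ = 0
      rw [← splitMap_coneD c ha hs, LinearMap.mem_ker.1 hx.2, map_zero]
  · refine κ_surj.comp ?_
    rintro ⟨w, hw⟩
    obtain ⟨x, rfl⟩ := splitMap_surjective hs w
    refine ⟨⟨x, (splitMap_mem_supported_iff hs (fun p q => by omega) x).1 hw.1,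
      splitMap_eq_zero hs _ ?_⟩, rfl⟩
    rw [splitMap_coneD c ha hs]
    exact hw.2
  · intro x
    refine (κ_zero _).trans ?_
    constructor
    · rintro ⟨w, hw, hwx⟩
      obtain ⟨y, rfl⟩ := splitMap_surjective hs w
      refine ⟨y, (splitMap_mem_supported_iff hs (fun p q => by omega) y).1 hw, ?_⟩
      rw [← sub_eq_zero]
      refine splitMap_eq_zero hs _ ?_
      rw [map_sub, splitMap_coneD c ha hs, hwx]
      exact sub_self _
    · rintro ⟨y, hy, hyx⟩
      refine ⟨splitMap a s y, (splitMap_mem_supported_iff hs (fun p q => by omega) y).2 hy, ?_⟩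
      rw [← splitMap_coneD c ha hs]
      exact congrArg (splitMap a s) hyx

end Main

section Free

variable {R : Type} [CommRing R] {G H : Type} [Group G] [Group H]

/-- A representation is free on a set if it has a basis indexed by the product of this set with
the group, which is permuted by left translation. -/
def IsFreeOn {V : Type} [AddCommGroup V] [Module R V] (ρ : Representation R G V) {ι : Type}
    (b : Module.Basis (ι × G) R V) : Prop :=
  ∀ g i h, ρ g (b (i, h)) = b (i, g * h)

lemma Rep.hom_ext_of_isFreeOn {P T : Rep.{0} R G} {ι : Type} {b : Module.Basis (ι × G) R P}
    (hb : IsFreeOn P.ρ b) {f g : P ⟶ T} (h : ∀ i, f.hom (b (i, 1)) = g.hom (b (i, 1))) :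
    f = g := by
  ext x
  refine LinearMap.congr_fun (f := f.hom.toLinearMap) (g := g.hom.toLinearMap)
    (b.ext fun ⟨i, γ⟩ => ?_) x
  change f.hom (b (i, γ)) = g.hom (b (i, γ))
  rw [← mul_one γ, ← hb, Rep.hom_comm_apply, Rep.hom_comm_apply, h]

lemma Rep.exists_hom_of_isFreeOn {P T : Rep.{0} R G} {ι : Type} {b : Module.Basis (ι × G) R P}
    (hb : IsFreeOn P.ρ b) (t : ι → T) : ∃ f : P ⟶ T, ∀ i, f.hom (b (i, 1)) = t i := by
  refine ⟨Rep.ofHom ⟨b.constr R fun x => T.ρ x.2 (t x.1), fun g => b.ext fun ⟨i, γ⟩ => ?_⟩,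
    fun i => ?_⟩
  · simp only [LinearMap.comp_apply]
    rw [hb, b.constr_basis, b.constr_basis, map_mul]
    rfl
  · exact (b.constr_basis _ _ _).trans (by simp)

/-- Evaluation of homomorphisms on a free generating set. -/
noncomputable def evalBasis {P : Rep.{0} R G} {ι : Type} (b : Module.Basis (ι × G) R P)
    (T : Rep.{0} R G) : (P ⟶ T) →ₗ[R] ι → T where
  toFun f i := f.hom (b (i, 1))
  map_add' _ _ := rfl
  map_smul' _ _ := rfl

lemma evalBasis_bijective {P : Rep.{0} R G} {ι : Type} {b : Module.Basis (ι × G) R P}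
    (hb : IsFreeOn P.ρ b) (T : Rep.{0} R G) : Function.Bijective (evalBasis b T) :=
  ⟨fun _ _ h => Rep.hom_ext_of_isFreeOn hb fun i => congrFun h i, fun t =>
    (Rep.exists_hom_of_isFreeOn hb t).imp fun _ h => funext h⟩

lemma Rep.projective_of_isFreeOn {P : Rep.{0} R G} {ι : Type} {b : Module.Basis (ι × G) R P}
    (hb : IsFreeOn P.ρ b) : Projective P where
  factors {E X} f e _ := by
    choose s hs using (Rep.epi_iff_surjective e).1 inferInstance
    obtain ⟨f', hf'⟩ := Rep.exists_hom_of_isFreeOn hb fun i => s (f.hom (b (i, 1)))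
    refine ⟨f', Rep.hom_ext_of_isFreeOn hb fun i => ?_⟩
    change e.hom (f'.hom (b (i, 1))) = _
    rw [hf']
    exact hs _

/-- The exterior tensor product of two representations. -/
noncomputable abbrev extRep (M : Rep.{0} R G) (N : Rep.{0} R H) : Rep.{0} R (G × H) :=
  Rep.of (extTprod M N)

lemma IsFreeOn.extTprod {P : Rep.{0} R G} {Q : Rep.{0} R H} {ι κ : Type}
    {b : Module.Basis (ι × G) R P} {c : Module.Basis (κ × H) R Q}
    (hb : IsFreeOn P.ρ b) (hc : IsFreeOn Q.ρ c) :
    IsFreeOn (extTprod P Q) ((b.tensorProduct c).reindex (Equiv.prodProdProdComm ι G κ H)) := by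
  rintro ⟨g, h⟩ ⟨i, k⟩ ⟨g', h'⟩
  simp only [Module.Basis.reindex_apply, Equiv.prodProdProdComm_symm,
    Equiv.prodProdProdComm_apply, Module.Basis.tensorProduct_apply]
  change TensorProduct.map (P.ρ g) (Q.ρ h) _ = _
  rw [TensorProduct.map_tmul, hb, hc]
  rfl

lemma exists_isFreeOn_of_basis (P : Rep.{0} R G) {ι : Type}
    (B : Module.Basis ι (MonoidAlgebra R G) P.ρ.asModule) :
    ∃ b : Module.Basis (ι × G) R P, IsFreeOn P.ρ b := by
  refine ⟨(((MonoidAlgebra.basis G R).smulTower B).reindex (Equiv.prodComm G ι)).map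
    P.ρ.asModuleEquiv, fun g i h => ?_⟩
  simp only [Module.Basis.map_apply, Module.Basis.reindex_apply, Equiv.prodComm_symm,
    Equiv.prodComm_apply, Prod.swap, Module.Basis.smulTower_apply, MonoidAlgebra.basis_apply,
    Representation.single_smul, one_smul]
  rw [map_mul]
  rfl

lemma piRightHom_bijective {κ M N : Type} [AddCommGroup M] [Module R M] [AddCommGroup N]
    [Module R N] [Module.Free R M] [Module.Finite R M] :
    Function.Bijective (TensorProduct.piRightHom R R M fun _ : κ => N) := by
  let b := Module.Free.chooseBasis R M
  have key : ∀ (x : M ⊗[R] (κ → N)) i k, TensorProduct.equivFinsuppOfBasisLeft b x i k =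
      TensorProduct.equivFinsuppOfBasisLeft b
        (TensorProduct.piRightHom R R M (fun _ : κ => N) x k) i := by
    intro x i k
    induction x with
    | zero => simp
    | add x y hx hy => simp [hx, hy]
    | tmul m y => simp
  refine ⟨(injective_iff_map_eq_zero _).2 fun x hx => ?_, fun w => ?_⟩
  · refine (TensorProduct.equivFinsuppOfBasisLeft b).map_eq_zero_iff.1 ?_
    ext i k
    rw [key, hx]
    simp
  · refine ⟨(TensorProduct.equivFinsuppOfBasisLeft b).symm (Finsupp.equivFunOnFinite.symm
      fun i k => TensorProduct.equivFinsuppOfBasisLeft b (w k) i), funext fun k => ?_⟩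
    refine (TensorProduct.equivFinsuppOfBasisLeft b).injective (Finsupp.ext fun i => ?_)
    rw [← key, LinearEquiv.apply_symm_apply]
    rfl

/-- The tensor product of two homomorphisms, as a homomorphism between exterior tensor products. -/
noncomputable def extMap {P M : Rep.{0} R G} {Q N : Rep.{0} R H} (f : P ⟶ M) (g : Q ⟶ N) :
    extRep P Q ⟶ extRep M N :=
  Rep.ofHom ⟨TensorProduct.map f.hom.toLinearMap g.hom.toLinearMap, fun x =>
    TensorProduct.ext' fun p q => by
      change f.hom (P.ρ x.1 p) ⊗ₜ[R] g.hom (Q.ρ x.2 q) =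
        M.ρ x.1 (f.hom p) ⊗ₜ[R] N.ρ x.2 (g.hom q)
      rw [Rep.hom_comm_apply, Rep.hom_comm_apply]⟩

/-- The comparison map from the tensor product of modules of homomorphisms to the
homomorphisms between exterior tensor products. -/
noncomputable def homTensorHom (P M : Rep.{0} R G) (Q N : Rep.{0} R H) :
    (P ⟶ M) ⊗[R] (Q ⟶ N) →ₗ[R] (extRep P Q ⟶ extRep M N) :=
  TensorProduct.lift <| LinearMap.mk₂ R extMap
    (fun _ _ _ => Rep.hom_ext <| Representation.IntertwiningMap.ext <|
      TensorProduct.map_add_left _ _ _)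
    (fun _ _ _ => Rep.hom_ext <| Representation.IntertwiningMap.ext <|
      TensorProduct.map_smul_left _ _ _)
    (fun _ _ _ => Rep.hom_ext <| Representation.IntertwiningMap.ext <|
      TensorProduct.map_add_right _ _ _)
    (fun _ _ _ => Rep.hom_ext <| Representation.IntertwiningMap.ext <|
      TensorProduct.map_smul_right _ _ _)

lemma homTensorHom_bijective {P M : Rep.{0} R G} {Q N : Rep.{0} R H} {ι κ : Type} [Finite ι]
    [Module.Free R M] [Module.Finite R M]
    {b : Module.Basis (ι × G) R P} {c : Module.Basis (κ × H) R Q}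
    (hb : IsFreeOn P.ρ b) (hc : IsFreeOn Q.ρ c) :
    Function.Bijective (homTensorHom P M Q N) := by
  classical
  have := Fintype.ofFinite ι
  let eP := LinearEquiv.ofBijective _ (evalBasis_bijective hb M)
  let eQ := LinearEquiv.ofBijective _ (evalBasis_bijective hc N)
  let ePQ := LinearEquiv.ofBijective _ (evalBasis_bijective (P := extRep P Q)
    (IsFreeOn.extTprod hb hc) (extRep M N))
  let e := TensorProduct.congr eP eQ ≪≫ₗ
    TensorProduct.piLeft (R := R) (M := fun _ : ι => M) (N := κ → N) ≪≫ₗ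
    LinearEquiv.piCongrRight (fun _ : ι => LinearEquiv.ofBijective _
      (piRightHom_bijective (R := R) (κ := κ) (M := M) (N := N))) ≪≫ₗ
    (LinearEquiv.curry R (M ⊗[R] N) ι κ).symm
  have h : ∀ x, ePQ (homTensorHom P M Q N x) = e x := by
    intro x
    induction x with
    | zero => simp
    | add x y hx hy => rw [map_add, map_add, map_add, hx, hy]
    | tmul f g =>
      funext ik
      change (extMap f g).hom (((b.tensorProduct c).reindex
        (Equiv.prodProdProdComm ι G κ H)) (ik, 1)) = _
      rw [Module.Basis.reindex_apply, Module.Basis.tensorProduct_apply]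
      simp [e]
      rfl
  have h' : ePQ ∘ homTensorHom P M Q N = e := funext h
  have h'' : Function.Bijective (ePQ ∘ homTensorHom P M Q N) := h' ▸ e.bijective
  exact (Function.Bijective.of_comp_iff' ePQ.bijective _).1 h''

end Free

section TotalChain

variable {R : Type*} [CommRing R] {W : ℕ → ℕ → Type*} [∀ p q, AddCommGroup (W p q)]
  [∀ p q, Module R (W p q)]
  (d₁ : ∀ p q, W (p + 1) q →ₗ[R] W p q) (d₂ : ∀ p q, W p (q + 1) →ₗ[R] W p q)

/-- The differential of the total complex of a homological double complex. -/
def totB : (∀ p q, W p q) →ₗ[R] ∀ p q, W p q :=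
  LinearMap.pi fun p => LinearMap.pi fun q =>
    d₁ p q ∘ₗ evalAt (p + 1) q + ((-1) ^ p : R) • d₂ p q ∘ₗ evalAt p (q + 1)

lemma totB_apply (x : ∀ p q, W p q) (p q : ℕ) :
    totB d₁ d₂ x p q = d₁ p q (x (p + 1) q) + ((-1) ^ p : R) • d₂ p q (x p (q + 1)) := rfl

lemma totB_mem_supported {n : ℕ} {x : ∀ p q, W p q}
    (hx : x ∈ supported (R := R) (fun p q => p + q = n + 1)) :
    totB d₁ d₂ x ∈ supported (R := R) (fun p q => p + q = n) := fun p q h => by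
  rw [totB_apply, hx _ _ (by omega), hx _ _ (by omega)]
  simp

variable {d₁ d₂}

section

variable (h₁ : ∀ p q x, d₁ p q (d₁ (p + 1) q x) = 0) (h₂ : ∀ p q x, d₂ p q (d₂ p (q + 1) x) = 0)
  (h₁₂ : ∀ p q x, d₁ p q (d₂ (p + 1) q x) = d₂ p q (d₁ p (q + 1) x))

include h₁ h₂ h₁₂ in
lemma totB_totB (x : ∀ p q, W p q) : totB d₁ d₂ (totB d₁ d₂ x) = 0 := by
  funext p q
  simp only [totB_apply, map_add, map_smul, h₁, h₂, h₁₂, Pi.zero_apply, pow_succ]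
  simp

variable {E : ℕ → Type*} [∀ p, AddCommGroup (E p)] [∀ p, Module R (E p)]
  (dE : ∀ p, E (p + 1) →ₗ[R] E p) (e : ∀ p, W p 0 →ₗ[R] E p)
  (e_surj : ∀ p, Function.Surjective (e p)) (he : ∀ p x, e p (d₁ p 0 x) = dE p (e (p + 1) x))
  (he₂ : ∀ p x, e p (d₂ p 0 x) = 0)
  (ex₀ : ∀ p x, e p x = 0 → ∃ y, d₂ p 0 y = x)
  (ex : ∀ p q x, d₂ p q x = 0 → ∃ y, d₂ p (q + 1) y = x)

include h₁ h₂ h₁₂ he₂ ex₀ ex in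
/-- A cycle in the total complex of a homological double complex with exact columns is a
boundary if its components in the columns of index at least `m` vanish, and so does its
augmentation. -/
lemma exists_totB_eq_of_vanishing (n m : ℕ) (x : ∀ p q, W p q)
    (hx : x ∈ supported (R := R) (fun p q => p + q = n)) (hD : totB d₁ d₂ x = 0)
    (hex : e n (x n 0) = 0) (hm : ∀ p q, m ≤ p → x p q = 0) :
    ∃ y ∈ supported (R := R) (fun p q => p + q = n + 1), totB d₁ d₂ y = x := by
  induction m generalizing x with
  | zero => exact ⟨0, Submodule.zero_mem _, by
      rw [map_zero]; exact (funext₂ fun p q => hm p q (Nat.zero_le _)).symm⟩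
  | succ m ih =>
    by_cases hmn : n < m
    · exact ih x hx hD hex fun p q hp => hx p q (by omega)
    obtain ⟨q, rfl⟩ := Nat.exists_eq_add_of_le (not_lt.1 hmn)
    obtain ⟨y, hy⟩ : ∃ y, d₂ m q y = x m q := by
      cases q with
      | zero => exact ex₀ m _ hex
      | succ q =>
        refine ex m q _ ?_
        have := congrFun (congrFun hD m) q
        rw [totB_apply, hm (m + 1) q le_rfl, map_zero, zero_add] at this
        have h := congrArg (((-1) ^ m : R) • ·) this
        simpa [smul_smul, ← mul_pow] using h
    let z : ∀ p q, W p q := Pi.single m (Pi.single (q + 1) (((-1) ^ m : R) • y))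
    have hz : z ∈ supported (R := R) (fun p q' => p + q' = m + q + 1) := fun p q' h => by
      by_cases hp : p = m
      · subst hp
        simp only [z, Pi.single_eq_same]
        exact Pi.single_eq_of_ne (by omega) _
      · simp only [z]
        rw [Pi.single_eq_of_ne hp]
        rfl
    have hzp : ∀ p q', p ≠ m → z p q' = 0 := fun p q' h => by
      simp only [z]
      rw [Pi.single_eq_of_ne h]
      rfl
    have hzm : totB d₁ d₂ z m q = x m q := by
      rw [totB_apply, hzp _ _ (by omega)]
      simp [z, smul_smul, ← mul_pow, hy]
    have hez : e (m + q) ((x - totB d₁ d₂ z) (m + q) 0) = 0 := by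
      change e (m + q) (x (m + q) 0 - totB d₁ d₂ z (m + q) 0) = 0
      rw [map_sub, hex, totB_apply, hzp _ _ (by omega), map_add, map_smul, he₂]
      simp
    have hvan : ∀ p q', m ≤ p → (x - totB d₁ d₂ z) p q' = 0 := by
      intro p q' hp
      obtain rfl | hp := hp.eq_or_lt
      · by_cases hq : q' = q
        · subst hq
          change x m q' - totB d₁ d₂ z m q' = 0
          rw [hzm, sub_self]
        · exact (Submodule.sub_mem _ hx (totB_mem_supported d₁ d₂ hz)) _ _ (by omega)
      · change x p q' - totB d₁ d₂ z p q' = 0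
        rw [hm _ _ hp, totB_apply, hzp _ _ (by omega), hzp _ _ (by omega)]
        simp
    obtain ⟨w, hw, hw'⟩ := ih (x - totB d₁ d₂ z)
      (Submodule.sub_mem _ hx (totB_mem_supported d₁ d₂ hz))
      (by rw [map_sub, hD, totB_totB h₁ h₂ h₁₂, sub_zero]) hez hvan
    exact ⟨w + z, Submodule.add_mem _ hw hz, by rw [map_add, hw', sub_add_cancel]⟩

include h₁ h₂ h₁₂ ex₀ ex e_surj he he₂ in
lemma exists_totB_eq (n : ℕ) (x : ∀ p q, W p q)
    (hx : x ∈ supported (R := R) (fun p q => p + q = n)) (hD : totB d₁ d₂ x = 0)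
    (hex : e n (x n 0) ∈ LinearMap.range (dE n)) :
    ∃ y ∈ supported (R := R) (fun p q => p + q = n + 1), totB d₁ d₂ y = x := by
  obtain ⟨v, hv⟩ := hex
  obtain ⟨y, rfl⟩ := e_surj _ v
  let z : ∀ p q, W p q := Pi.single (n + 1) (Pi.single 0 y)
  have hz : z ∈ supported (R := R) (fun p q => p + q = n + 1) := fun p q h => by
    by_cases hp : p = n + 1
    · subst hp
      simp only [z, Pi.single_eq_same]
      exact Pi.single_eq_of_ne (by omega) _
    · simp only [z]
      rw [Pi.single_eq_of_ne hp]
      rfl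
  obtain ⟨w, hw, hw'⟩ := exists_totB_eq_of_vanishing h₁ h₂ h₁₂ e he₂ ex₀ ex n (n + 1)
    (x - totB d₁ d₂ z) (Submodule.sub_mem _ hx (totB_mem_supported d₁ d₂ hz))
    (by rw [map_sub, hD, totB_totB h₁ h₂ h₁₂, sub_zero]) (by
      change e n (x n 0 - totB d₁ d₂ z n 0) = 0
      rw [map_sub, ← hv, totB_apply, map_add, map_smul, he₂, he]
      simp [z])
    (fun p q hp => (Submodule.sub_mem _ hx (totB_mem_supported d₁ d₂ hz)) _ _ (by omega))
  exact ⟨w + z, Submodule.add_mem _ hw hz, by rw [map_add, hw', sub_add_cancel]⟩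

end
end TotalChain

section SupportedEquiv

variable {R : Type*} [CommRing R] {U : ℕ → ℕ → Type*} [∀ p q, AddCommGroup (U p q)]
  [∀ p q, Module R (U p q)]

/-- Families supported in total degree `n` are families indexed by `0, …, n`. -/
noncomputable def supportedEquiv (n : ℕ) : supported (R := R) (U := U) (fun p q => p + q = n) ≃ₗ[R]
    ∀ i : Fin (n + 1), U i (n - i) :=
  LinearEquiv.ofBijective
    ((LinearMap.pi fun i : Fin (n + 1) => evalAt (i : ℕ) (n - i)) ∘ₗ Submodule.subtype _) <| by
  refine ⟨(injective_iff_map_eq_zero _).2 fun x hx => Subtype.ext <| funext₂ fun p q => ?_,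
    fun w => ?_⟩
  · by_cases h : p + q = n
    · obtain rfl : q = n - p := by omega
      exact congrFun hx ⟨p, by omega⟩
    · exact x.2 p q h
  · refine ⟨⟨fun p => if hp : p < n + 1 then Pi.single (n - p) (w ⟨p, hp⟩) else 0,
      fun p q h => ?_⟩, funext fun i => ?_⟩
    · by_cases hp : p < n + 1
      · simp only [hp, dif_pos]
        exact Pi.single_eq_of_ne (by omega) _
      · simp [hp]
    · change (if hp : (i : ℕ) < n + 1 then Pi.single (n - i) (w ⟨i, hp⟩) else 0 :
        ∀ q, U i q) (n - i) = w i
      rw [dif_pos i.2]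
      exact Pi.single_eq_same _ _

end SupportedEquiv

section TotalRep

variable {R : Type} [CommRing R] {G H : Type} [Group G] [Group H]

/-- The family of exterior tensor products of the terms of two complexes of representations. -/
abbrev TensorFam (P : ChainComplex (Rep.{0} R G) ℕ) (Q : ChainComplex (Rep.{0} R H) ℕ)
    (p q : ℕ) : Type := (P.X p) ⊗[R] (Q.X q)

variable (P : ChainComplex (Rep.{0} R G) ℕ) (Q : ChainComplex (Rep.{0} R H) ℕ)

/-- The horizontal differential of the tensor product of two complexes of representations. -/
noncomputable def tensorD₁ (p q : ℕ) : TensorFam P Q (p + 1) q →ₗ[R] TensorFam P Q p q :=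
  (P.d (p + 1) p).hom.toLinearMap.rTensor (Q.X q)

/-- The vertical differential of the tensor product of two complexes of representations. -/
noncomputable def tensorD₂ (p q : ℕ) : TensorFam P Q p (q + 1) →ₗ[R] TensorFam P Q p q :=
  (Q.d (q + 1) q).hom.toLinearMap.lTensor (P.X p)

/-- The action of `G × H` on the terms of the tensor product of two complexes of
representations. -/
noncomputable def tensorRep : Representation R (G × H) (∀ p q, TensorFam P Q p q) where
  toFun g := LinearMap.pi fun p => LinearMap.pi fun q =>
    extTprod (P.X p) (Q.X q) g ∘ₗ evalAt p q
  map_one' := LinearMap.ext fun x => funext₂ fun p q => by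
    change extTprod (P.X p) (Q.X q) 1 (x p q) = x p q
    rw [map_one]
    rfl
  map_mul' g h := LinearMap.ext fun x => funext₂ fun p q => by
    change extTprod (P.X p) (Q.X q) (g * h) (x p q) = _
    rw [map_mul]
    rfl

lemma tensorRep_apply (g : G × H) (x : ∀ p q, TensorFam P Q p q) (p q : ℕ) :
    tensorRep P Q g x p q = extTprod (P.X p) (Q.X q) g (x p q) := rfl

lemma tensorD₁_extTprod (g : G × H) (p q : ℕ) (x : TensorFam P Q (p + 1) q) :
    tensorD₁ P Q p q (extTprod (P.X (p + 1)) (Q.X q) g x) =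
      extTprod (P.X p) (Q.X q) g (tensorD₁ P Q p q x) := by
  induction x using TensorProduct.induction_on with
  | zero => simp
  | add x y hx hy => simp only [map_add, hx, hy]
  | tmul x y =>
    change (P.d (p + 1) p).hom ((P.X (p + 1)).ρ g.1 x) ⊗ₜ[R] _ = _
    rw [Rep.hom_comm_apply]
    rfl

lemma tensorD₂_extTprod (g : G × H) (p q : ℕ) (x : TensorFam P Q p (q + 1)) :
    tensorD₂ P Q p q (extTprod (P.X p) (Q.X (q + 1)) g x) =
      extTprod (P.X p) (Q.X q) g (tensorD₂ P Q p q x) := by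
  induction x using TensorProduct.induction_on with
  | zero => simp
  | add x y hx hy => simp only [map_add, hx, hy]
  | tmul x y =>
    change _ ⊗ₜ[R] (Q.d (q + 1) q).hom ((Q.X (q + 1)).ρ g.2 y) = _
    rw [Rep.hom_comm_apply]
    rfl

lemma totB_tensorRep (g : G × H) (x : ∀ p q, TensorFam P Q p q) :
    totB (tensorD₁ P Q) (tensorD₂ P Q) (tensorRep P Q g x) =
      tensorRep P Q g (totB (tensorD₁ P Q) (tensorD₂ P Q) x) := by
  funext p q
  rw [totB_apply, tensorRep_apply, tensorRep_apply, tensorRep_apply, totB_apply, map_add,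
    map_smul, tensorD₁_extTprod, tensorD₂_extTprod]

/-- The term of degree `n` of the exterior tensor product of two complexes of representations. -/
noncomputable abbrev totRep (n : ℕ) : Rep.{0} R (G × H) :=
  Rep.of (X := supported (R := R) (U := TensorFam P Q) (fun p q => p + q = n))
    { toFun g := (tensorRep P Q g).restrict fun x hx p q h => by
        rw [tensorRep_apply, hx p q h, map_zero]
      map_one' := LinearMap.ext fun x => Subtype.ext <| by
        change tensorRep P Q 1 x = x
        rw [map_one]
        rfl
      map_mul' g h := LinearMap.ext fun x => Subtype.ext <| by
        change tensorRep P Q (g * h) x = _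
        rw [map_mul]
        rfl }

/-- The differential of the exterior tensor product of two complexes of representations. -/
noncomputable def totRepD (n : ℕ) : totRep P Q (n + 1) ⟶ totRep P Q n :=
  Rep.ofHom ⟨(totB (tensorD₁ P Q) (tensorD₂ P Q)).restrict fun _ hx =>
    totB_mem_supported _ _ hx, fun g => LinearMap.ext fun x => Subtype.ext <|
      totB_tensorRep P Q g x⟩

lemma Rep.d_d_apply (K : ChainComplex (Rep.{0} R G) ℕ) (i j k : ℕ) (x : K.X i) :
    (K.d j k).hom ((K.d i j).hom x) = 0 := by
  change (K.d i j ≫ K.d j k).hom x = 0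
  rw [K.d_comp_d]
  rfl

lemma tensorD₁_tensorD₁ (p q : ℕ) (x : TensorFam P Q (p + 2) q) :
    tensorD₁ P Q p q (tensorD₁ P Q (p + 1) q x) = 0 := by
  induction x using TensorProduct.induction_on with
  | zero => simp
  | add x y hx hy => rw [map_add, map_add, hx, hy, add_zero]
  | tmul x y =>
    change (P.d (p + 1) p).hom ((P.d (p + 2) (p + 1)).hom x) ⊗ₜ[R] y = 0
    rw [Rep.d_d_apply, zero_tmul]

lemma tensorD₂_tensorD₂ (p q : ℕ) (x : TensorFam P Q p (q + 2)) :
    tensorD₂ P Q p q (tensorD₂ P Q p (q + 1) x) = 0 := by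
  induction x using TensorProduct.induction_on with
  | zero => simp
  | add x y hx hy => rw [map_add, map_add, hx, hy, add_zero]
  | tmul x y =>
    change x ⊗ₜ[R] (Q.d (q + 1) q).hom ((Q.d (q + 2) (q + 1)).hom y) = 0
    rw [Rep.d_d_apply, tmul_zero]

lemma tensorD₁_tensorD₂ (p q : ℕ) (x : TensorFam P Q (p + 1) (q + 1)) :
    tensorD₁ P Q p q (tensorD₂ P Q (p + 1) q x) = tensorD₂ P Q p q (tensorD₁ P Q p (q + 1) x) := by
  induction x using TensorProduct.induction_on with
  | zero => simp
  | add x y hx hy => simp only [map_add, hx, hy]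
  | tmul x y => rfl

/-- The exterior tensor product of two complexes of representations. -/
noncomputable def totComplex : ChainComplex (Rep.{0} R (G × H)) ℕ :=
  ChainComplex.of (totRep P Q) (totRepD P Q) fun n => by
    ext x p q
    exact congrFun (congrFun (totB_totB (tensorD₁_tensorD₁ P Q) (tensorD₂_tensorD₂ P Q)
      (tensorD₁_tensorD₂ P Q) _) p) q

lemma totComplex_d (n : ℕ) : (totComplex P Q).d (n + 1) n = totRepD P Q n :=
  ChainComplex.of_d _ _ _

variable {P Q}

lemma totRep_projective {ιP ιQ : ℕ → Type} {b : ∀ p, Module.Basis (ιP p × G) R (P.X p)}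
    {c : ∀ q, Module.Basis (ιQ q × H) R (Q.X q)} (hb : ∀ p, IsFreeOn (P.X p).ρ (b p))
    (hc : ∀ q, IsFreeOn (Q.X q).ρ (c q)) (n : ℕ) : Projective (totRep P Q n) := by
  let bc := fun i : Fin (n + 1) => ((b i).tensorProduct (c (n - i))).reindex
    (Equiv.prodProdProdComm (ιP i) G (ιQ (n - i)) H)
  let B := ((Pi.basis bc).map
      (supportedEquiv (R := R) (U := TensorFam P Q) n).symm).reindex
      (Equiv.sigmaProdDistrib (fun i : Fin (n + 1) => ιP i × ιQ (n - i)) (G × H)).symm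
  have hB : ∀ i j h, supportedEquiv n (B (⟨i, j⟩, h)) = Pi.single i (bc i (j, h)) := by
    intro i j h
    simp only [B, Module.Basis.reindex_apply, Module.Basis.map_apply,
      LinearEquiv.apply_symm_apply, Equiv.symm_symm]
    exact Pi.basis_apply _ _
  refine Rep.projective_of_isFreeOn (P := totRep P Q n) (b := B) ?_
  rintro g ⟨i, j⟩ h
  refine (supportedEquiv n).injective (funext fun k => ?_)
  change extTprod (P.X k) (Q.X (n - k)) g (supportedEquiv n (B (⟨i, j⟩, h)) k) =
    supportedEquiv n (B (⟨i, j⟩, g * h)) k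
  rw [hB, hB]
  by_cases hk : k = i
  · subst hk
    rw [Pi.single_eq_same, Pi.single_eq_same]
    exact (hb k).extTprod (hc (n - k)) g j h
  · rw [Pi.single_eq_of_ne hk, Pi.single_eq_of_ne hk, map_zero]

end TotalRep

section Augmentation

variable {R : Type} [CommRing R] {G : Type} [Group G]

lemma Rep.exact_iff (S : ShortComplex (Rep.{0} R G)) :
    S.Exact ↔ ∀ x : S.X₂, S.g.hom x = 0 → ∃ y : S.X₁, S.f.hom y = x := by
  rw [← S.exact_map_iff_of_faithful (forget₂ (Rep.{0} R G) (ModuleCat R)),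
    ShortComplex.moduleCat_exact_iff]
  rfl

/-- The augmentation of a projective resolution. -/
noncomputable def augmentation {T : Rep.{0} R G} (P : ProjectiveResolution T) :
    P.complex.X 0 ⟶ T :=
  (ChainComplex.toSingle₀Equiv _ _ P.π).1

variable {T : Rep.{0} R G} (P : ProjectiveResolution T)

lemma augmentation_surjective : Function.Surjective (augmentation P).hom :=
  (Rep.epi_iff_surjective (P.π.f 0)).1 inferInstance

lemma augmentation_d (x : P.complex.X 1) :
    (augmentation P).hom ((P.complex.d 1 0).hom x) = 0 := by
  change (P.complex.d 1 0 ≫ P.π.f 0).hom x = 0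
  rw [P.complex_d_comp_π_f_zero]
  rfl

lemma exists_d_eq_of_augmentation_eq_zero (x : P.complex.X 0)
    (hx : (augmentation P).hom x = 0) : ∃ y, (P.complex.d 1 0).hom y = x :=
  (Rep.exact_iff _).1 P.exact₀ x hx

lemma exists_d_eq_of_d_eq_zero (n : ℕ) (x : P.complex.X (n + 1))
    (hx : (P.complex.d (n + 1) n).hom x = 0) : ∃ y, (P.complex.d (n + 2) (n + 1)).hom y = x :=
  (Rep.exact_iff _).1 (P.exact_succ n) x hx

/-- A complex of projective representations which is exact except in degree zero and whose
zeroth homology is identified by an augmentation is a projective resolution. -/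
noncomputable def projectiveResolutionOfExact (K : ChainComplex (Rep.{0} R G) ℕ)
    [∀ n, Projective (K.X n)] (ε : K.X 0 ⟶ T) (w : K.d 1 0 ≫ ε = 0)
    (hε : Function.Surjective ε.hom)
    (h₀ : ∀ x, ε.hom x = 0 → ∃ y, (K.d 1 0).hom y = x)
    (h : ∀ n x, (K.d (n + 1) n).hom x = 0 → ∃ y, (K.d (n + 2) (n + 1)).hom y = x) :
    ProjectiveResolution T where
  complex := K
  π := (ChainComplex.toSingle₀Equiv _ _).symm ⟨ε, w⟩
  quasiIso := ⟨fun n => by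
    cases n with
    | zero =>
      rw [ChainComplex.quasiIsoAt₀_iff, ShortComplex.quasiIso_iff_of_zeros' _
        (K.shape _ _ (by simp)) rfl rfl]
      exact ⟨(Rep.exact_iff _).2 h₀, (Rep.epi_iff_surjective _).2 hε⟩
    | succ n =>
      rw [quasiIsoAt_iff_exactAt' (hL := ChainComplex.exactAt_succ_single_obj ..),
          HomologicalComplex.exactAt_iff' _ (n + 2) (n + 1) n (by simp) (by simp)]
      exact (Rep.exact_iff _).2 (h n)⟩

end Augmentation

section TensorResolution

variable {R : Type} [CommRing R] {G H : Type} [Group G] [Group H]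
  (P : ProjectiveResolution (Rep.trivial R G R)) (Q : ProjectiveResolution (Rep.trivial R H R))

/-- The augmentation of the columns of the tensor product of two resolutions. -/
noncomputable def columnAug (p : ℕ) :
    TensorFam P.complex Q.complex p 0 →ₗ[R] P.complex.X p :=
  (TensorProduct.rid R (P.complex.X p)).toLinearMap ∘ₗ
    (LinearMap.lTensor (P.complex.X p) (augmentation Q).hom.toLinearMap :
      (P.complex.X p) ⊗[R] (Q.complex.X 0) →ₗ[R] (P.complex.X p) ⊗[R] R)

lemma columnAug_tmul (p : ℕ) (x : P.complex.X p) (y : Q.complex.X 0) :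
    columnAug P Q p (x ⊗ₜ y) = ((augmentation Q).hom y : R) • x := rfl

lemma columnAug_surjective (p : ℕ) : Function.Surjective (columnAug P Q p) :=
  (TensorProduct.rid R _).surjective.comp
    (LinearMap.lTensor_surjective _ (augmentation_surjective Q))

lemma columnAug_tensorD₁ (p : ℕ) (x : TensorFam P.complex Q.complex (p + 1) 0) :
    columnAug P Q p (tensorD₁ P.complex Q.complex p 0 x) =
      (P.complex.d (p + 1) p).hom (columnAug P Q (p + 1) x) := by
  induction x using TensorProduct.induction_on with
  | zero => simp
  | add x y hx hy => simp only [map_add, hx, hy]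
  | tmul x y =>
    rw [columnAug_tmul]
    exact (map_smul (P.complex.d (p + 1) p).hom.toLinearMap _ _).symm

lemma columnAug_tensorD₂ (p : ℕ) (x : TensorFam P.complex Q.complex p 1) :
    columnAug P Q p (tensorD₂ P.complex Q.complex p 0 x) = 0 := by
  induction x using TensorProduct.induction_on with
  | zero => simp
  | add x y hx hy => rw [map_add, map_add, hx, hy, add_zero]
  | tmul x y =>
    change ((augmentation Q).hom ((Q.complex.d 1 0).hom y) : R) • x = 0
    rw [augmentation_d]
    exact zero_smul R x

lemma columnAug_extTprod (p : ℕ) (g : G × H) (x : TensorFam P.complex Q.complex p 0) :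
    columnAug P Q p (extTprod _ _ g x) = (P.complex.X p).ρ g.1 (columnAug P Q p x) := by
  induction x using TensorProduct.induction_on with
  | zero => simp
  | add x y hx hy => simp only [map_add, hx, hy]
  | tmul x y =>
    rw [columnAug_tmul, map_smul]
    change ((augmentation Q).hom ((Q.complex.X 0).ρ g.2 y) : R) • (P.complex.X p).ρ g.1 x = _
    rw [Rep.hom_comm_apply]
    rfl


/-- The augmentation of the tensor product of two resolutions. -/
noncomputable def totAug : totRep P.complex Q.complex 0 ⟶ Rep.trivial R (G × H) R :=
  Rep.ofHom ⟨(augmentation P).hom.toLinearMap ∘ₗ columnAug P Q 0 ∘ₗ evalAt 0 0 ∘ₗ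
    Submodule.subtype _, fun g => LinearMap.ext fun x => by
      change (augmentation P).hom (columnAug P Q 0 (extTprod _ _ g (x.1 0 0))) = _
      rw [columnAug_extTprod, Rep.hom_comm_apply]
      rfl⟩

variable [∀ p, Module.Flat R (P.complex.X p)]

lemma exists_tensorD₂_eq_of_columnAug_eq_zero (p : ℕ) (x : TensorFam P.complex Q.complex p 0)
    (hx : columnAug P Q p x = 0) : ∃ y, tensorD₂ P.complex Q.complex p 0 y = x := by
  have h : Function.Exact (Q.complex.d 1 0).hom.toLinearMap (augmentation Q).hom.toLinearMap :=
    fun y => ⟨exists_d_eq_of_augmentation_eq_zero Q y, by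
      rintro ⟨y, rfl⟩
      exact augmentation_d Q y⟩
  exact (Module.Flat.lTensor_exact (P.complex.X p) h x).1
    ((TensorProduct.rid R _).map_eq_zero_iff.1 hx)

lemma exists_tensorD₂_eq_of_tensorD₂_eq_zero (p q : ℕ)
    (x : TensorFam P.complex Q.complex p (q + 1))
    (hx : tensorD₂ P.complex Q.complex p q x = 0) :
    ∃ y, tensorD₂ P.complex Q.complex p (q + 1) y = x := by
  have h : Function.Exact (Q.complex.d (q + 2) (q + 1)).hom.toLinearMap
      (Q.complex.d (q + 1) q).hom.toLinearMap :=
    fun y => ⟨exists_d_eq_of_d_eq_zero Q q y, by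
      rintro ⟨y, rfl⟩
      exact Rep.d_d_apply _ _ _ _ _⟩
  exact (Module.Flat.lTensor_exact (P.complex.X p) h x).1 hx

/-- The exterior tensor product of two projective resolutions of the trivial representation is a
projective resolution of the trivial representation. -/
noncomputable def tensorResolution
    [∀ n, Projective (totRep P.complex Q.complex n)] :
    ProjectiveResolution (Rep.trivial R (G × H) R) :=
  have : ∀ n, Projective ((totComplex P.complex Q.complex).X n) := fun n =>
    inferInstanceAs (Projective (totRep P.complex Q.complex n))
  projectiveResolutionOfExact (totComplex P.complex Q.complex) (totAug P Q)
    (by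
      rw [totComplex_d]
      ext x
      change (augmentation P).hom (columnAug P Q 0
        (totB (tensorD₁ P.complex Q.complex) (tensorD₂ P.complex Q.complex) x.1 0 0)) = 0
      rw [totB_apply, map_add, map_smul, columnAug_tensorD₂, columnAug_tensorD₁, smul_zero,
        add_zero, augmentation_d])
    (fun r => by
      obtain ⟨x, rfl⟩ := augmentation_surjective P r
      obtain ⟨y, rfl⟩ := columnAug_surjective P Q 0 x
      refine ⟨⟨Pi.single 0 (Pi.single 0 y), fun p q h => ?_⟩, ?_⟩
      · by_cases hp : p = 0
        · subst hp
          rw [Pi.single_eq_same]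
          exact Pi.single_eq_of_ne (by omega) _
        · rw [Pi.single_eq_of_ne hp]
          rfl
      · rfl)
    (fun x hx => by
      obtain ⟨z, hz⟩ := exists_d_eq_of_augmentation_eq_zero P _ hx
      obtain ⟨y, hy, hyx⟩ := exists_totB_eq (tensorD₁_tensorD₁ _ _) (tensorD₂_tensorD₂ _ _)
        (tensorD₁_tensorD₂ _ _) (fun p => (P.complex.d (p + 1) p).hom.toLinearMap)
        (columnAug P Q) (columnAug_surjective P Q) (columnAug_tensorD₁ P Q)
        (columnAug_tensorD₂ P Q) (exists_tensorD₂_eq_of_columnAug_eq_zero P Q)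
        (exists_tensorD₂_eq_of_tensorD₂_eq_zero P Q) 0 x.1 x.2
        (by
          funext p q
          rw [totB_apply, x.2 _ _ (by omega), x.2 _ _ (by omega)]
          simp) ⟨z, hz⟩
      exact ⟨⟨y, hy⟩, Subtype.ext hyx⟩)
    (fun n x hx => by
      rw [totComplex_d] at hx
      rw [totComplex_d]
      obtain ⟨y, hy, hyx⟩ := exists_totB_eq (tensorD₁_tensorD₁ _ _) (tensorD₂_tensorD₂ _ _)
        (tensorD₁_tensorD₂ _ _) (fun p => (P.complex.d (p + 1) p).hom.toLinearMap)
        (columnAug P Q) (columnAug_surjective P Q) (columnAug_tensorD₁ P Q)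
        (columnAug_tensorD₂ P Q) (exists_tensorD₂_eq_of_columnAug_eq_zero P Q)
        (exists_tensorD₂_eq_of_tensorD₂_eq_zero P Q) (n + 1) x.1 x.2
        (congrArg Subtype.val hx)
        (exists_d_eq_of_d_eq_zero P n _ <| by
          have h := congrArg (columnAug P Q n)
            (congrFun (congrFun (congrArg Subtype.val hx) n) 0)
          change columnAug P Q n (totB (tensorD₁ P.complex Q.complex)
            (tensorD₂ P.complex Q.complex) x.1 n 0) = columnAug P Q n 0 at h
          rwa [totB_apply, map_add, map_smul, columnAug_tensorD₂, columnAug_tensorD₁, smul_zero,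
            add_zero, map_zero] at h)
      exact ⟨⟨y, hy⟩, Subtype.ext hyx⟩)

end TensorResolution

section HomComparison

variable {R : Type} [CommRing R] {G H : Type} [Group G] [Group H]

/-- Evaluation of homomorphisms of representations at an element. -/
noncomputable def homEval {S T : Rep.{0} R G} (x : S) : (S ⟶ T) →ₗ[R] T where
  toFun f := f.hom x
  map_add' _ _ := rfl
  map_smul' _ _ := rfl

/-- The differential of the complex of homomorphisms into a representation. -/
noncomputable def precompD (P : ChainComplex (Rep.{0} R G) ℕ) (M : Rep.{0} R G) (p : ℕ) :
    (P.X p ⟶ M) →ₗ[R] (P.X (p + 1) ⟶ M) :=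
  Linear.leftComp R M (P.d (p + 1) p)

lemma precompD_apply (P : ChainComplex (Rep.{0} R G) ℕ) (M : Rep.{0} R G) (p : ℕ)
    (f : P.X p ⟶ M) : precompD P M p f = P.d (p + 1) p ≫ f := rfl

lemma precompD_precompD (P : ChainComplex (Rep.{0} R G) ℕ) (M : Rep.{0} R G) (p : ℕ)
    (f : P.X p ⟶ M) : precompD P M (p + 1) (precompD P M p f) = 0 := by
  rw [precompD_apply, precompD_apply, P.d_comp_d_assoc, Limits.zero_comp]

/-- Group cohomology is the cohomology of the complex of homomorphisms from a projective
resolution. -/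
lemma exists_groupCohomology_pres (P : ProjectiveResolution (Rep.trivial R G R))
    (M : Rep.{0} R G) (n : ℕ) :
    ∃ π : LinearMap.ker (precompD P.complex M n) →ₗ[R] groupCohomology M n,
      Function.Surjective π ∧
        ∀ x, π x = 0 ↔ (x : P.complex.X n ⟶ M) ∈ coboundaries (precompD P.complex M) n := by
  obtain ⟨π, h1, h2⟩ :=
    cochainComplex_homology_pres_coboundaries (P.complex.linearYonedaObj R M) n
  let e := (groupCohomologyIso M n P).toLinearEquiv
  exact ⟨e.symm.toLinearMap ∘ₗ π, e.symm.surjective.comp h1, fun x =>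
    e.symm.map_eq_zero_iff.trans (h2 x)⟩

variable (P : ChainComplex (Rep.{0} R G) ℕ) (Q : ChainComplex (Rep.{0} R H) ℕ)

/-- The projections from the terms of the tensor product of two complexes. -/
noncomputable def totProj (n p q : ℕ) : totRep P Q n ⟶ extRep (P.X p) (Q.X q) :=
  Rep.ofHom ⟨evalAt p q ∘ₗ Submodule.subtype _, fun _ => rfl⟩

/-- The inclusions into the terms of the tensor product of two complexes, extended by zero. -/
noncomputable def totIncl (n p q : ℕ) : extRep (P.X p) (Q.X q) ⟶ totRep P Q n :=
  Rep.ofHom ⟨(LinearMap.pi fun p' => LinearMap.pi fun q' =>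
    if p' + q' = n then (LinearMap.proj q' ∘ₗ LinearMap.proj p' :
      (∀ p q, TensorFam P Q p q) →ₗ[R] _) ∘ₗ LinearMap.single R _ p ∘ₗ
        LinearMap.single R (TensorFam P Q p) q else 0).codRestrict _ fun x p' q' h => by
    rw [LinearMap.pi_apply, LinearMap.pi_apply, if_neg h]
    rfl, fun g => LinearMap.ext fun x => Subtype.ext <| funext₂ fun p' q' => by
    change (if p' + q' = n then _ else 0 : _ →ₗ[R] TensorFam P Q p' q') _ =
      extTprod (P.X p') (Q.X q') g ((if p' + q' = n then _ else 0 : _ →ₗ[R] _) x)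
    split_ifs
    · change (Pi.single p (Pi.single q (extTprod (P.X p) (Q.X q) g x)) :
        ∀ p q, TensorFam P Q p q) p' q' = extTprod (P.X p') (Q.X q') g
          ((Pi.single p (Pi.single q x) : ∀ p q, TensorFam P Q p q) p' q')
      by_cases hp : p' = p
      · subst hp
        by_cases hq : q' = q
        · subst hq
          simp only [Pi.single_eq_same]
        · simp only [Pi.single_eq_same, Pi.single_eq_of_ne hq, map_zero]
      · simp only [Pi.single_eq_of_ne hp, Pi.zero_apply, map_zero]
    · exact (map_zero _).symm⟩

lemma totIncl_apply (n p q p' q' : ℕ) (h : p' + q' = n) (x : TensorFam P Q p q) :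
    ((totIncl P Q n p q).hom x).1 p' q' =
      (Pi.single p (Pi.single q x) : ∀ p q, TensorFam P Q p q) p' q' := by
  change (if p' + q' = n then _ else 0 : _ →ₗ[R] _) x = _
  rw [if_pos h]
  rfl

lemma totIncl_apply_same (n p q : ℕ) (h : p + q = n) (x : TensorFam P Q p q) :
    ((totIncl P Q n p q).hom x).1 p q = x := by
  rw [totIncl_apply _ _ _ _ _ _ _ h]
  simp only [Pi.single_eq_same]

lemma totIncl_apply_of_ne (n p q p' q' : ℕ) (x : TensorFam P Q p q) (h : (p', q') ≠ (p, q)) :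
    ((totIncl P Q n p q).hom x).1 p' q' = 0 := by
  by_cases hn : p' + q' = n
  · rw [totIncl_apply _ _ _ _ _ _ _ hn]
    by_cases hp : p' = p
    · subst hp
      rw [Pi.single_eq_same]
      exact Pi.single_eq_of_ne (fun hq => h (by rw [hq])) _
    · simp only [Pi.single_eq_of_ne hp, Pi.zero_apply]
  · exact ((totIncl P Q n p q).hom x).2 p' q' hn

lemma sum_totIncl (n : ℕ) (x : totRep P Q n) :
    ∑ z ∈ Finset.HasAntidiagonal.antidiagonal n,
      (totIncl P Q n z.1 z.2).hom (x.1 z.1 z.2) = x := by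
  refine Subtype.ext (funext₂ fun p q => ?_)
  have key : (∑ z ∈ Finset.HasAntidiagonal.antidiagonal n,
      (totIncl P Q n z.1 z.2).hom (x.1 z.1 z.2)).1 p q =
      ∑ z ∈ Finset.HasAntidiagonal.antidiagonal n,
        ((totIncl P Q n z.1 z.2).hom (x.1 z.1 z.2)).1 p q :=
    map_sum (totProj P Q n p q).hom.toLinearMap _ _
  rw [key]
  by_cases h : p + q = n
  · rw [Finset.sum_eq_single_of_mem (p, q) (Finset.HasAntidiagonal.mem_antidiagonal.2 h)
      fun z _ hz => totIncl_apply_of_ne _ _ _ _ _ _ _ _ hz.symm]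
    exact totIncl_apply_same _ _ _ _ _ h _
  · rw [x.2 p q h]
    exact Finset.sum_eq_zero fun z hz => totIncl_apply_of_ne _ _ _ _ _ _ _ _ fun h' =>
      h ((congrArg (fun z => z.1 + z.2) h').trans (Finset.HasAntidiagonal.mem_antidiagonal.1 hz))

variable (M : Rep.{0} R G) (N : Rep.{0} R H)

/-- The comparison map from families of tensors of homomorphisms to homomorphisms out of the
tensor product of two complexes. -/
noncomputable def totHom (n : ℕ) :
    (∀ p q, (P.X p ⟶ M) ⊗[R] (Q.X q ⟶ N)) →ₗ[R] (totRep P Q n ⟶ extRep M N) :=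
  ∑ z ∈ Finset.HasAntidiagonal.antidiagonal n, Linear.leftComp R _ (totProj P Q n z.1 z.2) ∘ₗ
    homTensorHom (P.X z.1) M (Q.X z.2) N ∘ₗ evalAt z.1 z.2

lemma totHom_apply (n : ℕ) (w : ∀ p q, (P.X p ⟶ M) ⊗[R] (Q.X q ⟶ N)) (x : totRep P Q n) :
    (totHom P Q M N n w).hom x =
      ∑ z ∈ Finset.HasAntidiagonal.antidiagonal n,
        (homTensorHom _ M _ N (w z.1 z.2)).hom (x.1 z.1 z.2) := by
  rw [totHom, LinearMap.sum_apply]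
  exact map_sum (homEval x) _ _

lemma homTensorHom_rTensor (p q : ℕ) (w : (P.X p ⟶ M) ⊗[R] (Q.X q ⟶ N))
    (x : TensorFam P Q (p + 1) q) :
    (homTensorHom _ M _ N ((precompD P M p).rTensor _ w)).hom x =
      (homTensorHom _ M _ N w).hom (tensorD₁ P Q p q x) := by
  have key : homTensorHom _ M _ N ∘ₗ (precompD P M p).rTensor (Q.X q ⟶ N) =
      Linear.leftComp R _ (extMap (P.d (p + 1) p) (𝟙 (Q.X q))) ∘ₗ homTensorHom _ M _ N :=
    TensorProduct.ext' fun f g => Rep.hom_ext <| Representation.IntertwiningMap.ext <|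
      TensorProduct.ext' fun x y => rfl
  exact congrArg (fun f => f.hom x) (LinearMap.congr_fun key w)

lemma homTensorHom_lTensor (p q : ℕ) (w : (P.X p ⟶ M) ⊗[R] (Q.X q ⟶ N))
    (x : TensorFam P Q p (q + 1)) :
    (homTensorHom _ M _ N ((precompD Q N q).lTensor _ w)).hom x =
      (homTensorHom _ M _ N w).hom (tensorD₂ P Q p q x) := by
  have key : homTensorHom _ M _ N ∘ₗ (precompD Q N q).lTensor (P.X p ⟶ M) =
      Linear.leftComp R _ (extMap (𝟙 (P.X p)) (Q.d (q + 1) q)) ∘ₗ homTensorHom _ M _ N :=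
    TensorProduct.ext' fun f g => Rep.hom_ext <| Representation.IntertwiningMap.ext <|
      TensorProduct.ext' fun x y => rfl
  exact congrArg (fun f => f.hom x) (LinearMap.congr_fun key w)

lemma totHom_totD (n : ℕ) (w : ∀ p q, (P.X p ⟶ M) ⊗[R] (Q.X q ⟶ N)) :
    totHom P Q M N (n + 1) (totD (fun p q => (precompD P M p).rTensor (Q.X q ⟶ N))
      (fun p q => (precompD Q N q).lTensor (P.X p ⟶ M)) w) =
      totRepD P Q n ≫ totHom P Q M N n w := by
  refine Rep.hom_ext <| Representation.IntertwiningMap.ext <| LinearMap.ext fun x => ?_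
  change (totHom P Q M N (n + 1) _).hom x = (totHom P Q M N n w).hom ((totRepD P Q n).hom x)
  have h₁ : ∀ p q, (homTensorHom _ M _ N (totD (fun p q => (precompD P M p).rTensor (Q.X q ⟶ N))
      (fun p q => (precompD Q N q).lTensor (P.X p ⟶ M)) w p q)).hom (x.1 p q) =
      (homTensorHom _ M _ N (shift (fun p => LinearMap.pi fun q =>
        (precompD P M p).rTensor (Q.X q ⟶ N) ∘ₗ LinearMap.proj q) w p q)).hom (x.1 p q) +
      ((-1) ^ p : R) • (homTensorHom _ M _ N
        (shift (fun q => (precompD Q N q).lTensor (P.X p ⟶ M)) (w p) q)).hom (x.1 p q) :=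
    fun p q => by
      let e := homEval (S := extRep (P.X p) (Q.X q)) (T := extRep M N) (x.1 p q) ∘ₗ
        homTensorHom (P.X p) M (Q.X q) N
      exact (map_add e _ _).trans (congrArg₂ (· + ·) rfl (map_smul e _ _))
  have h₂ : ∀ p q, (homTensorHom _ M _ N (w p q)).hom (((totRepD P Q n).hom x).1 p q) =
      (homTensorHom _ M _ N (w p q)).hom (tensorD₁ P Q p q (x.1 (p + 1) q)) +
      ((-1) ^ p : R) • (homTensorHom _ M _ N (w p q)).hom (tensorD₂ P Q p q (x.1 p (q + 1))) :=
    fun p q => by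
      let e := (homTensorHom _ M _ N (w p q)).hom.toLinearMap
      exact (map_add e _ _).trans (congrArg₂ (· + ·) rfl (map_smul e _ _))
  rw [totHom_apply, totHom_apply, Finset.sum_congr rfl fun z _ => h₁ z.1 z.2,
    Finset.sum_congr (s₁ := Finset.HasAntidiagonal.antidiagonal n) rfl fun z _ => h₂ z.1 z.2,
    Finset.sum_add_distrib,
    Finset.sum_add_distrib, Finset.Nat.sum_antidiagonal_succ,
    Finset.Nat.sum_antidiagonal_succ']
  have h₃ : ∀ q, shift (fun p => LinearMap.pi fun q =>
        (precompD P M p).rTensor (Q.X q ⟶ N) ∘ₗ LinearMap.proj q) w 0 q = 0 := fun q => rfl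
  have h₄ : ∀ p, shift (fun q => (precompD Q N q).lTensor (P.X p ⟶ M)) (w p) 0 = 0 := fun q => rfl
  rw [h₃, h₄, map_zero, map_zero]
  exact congrArg₂ (· + ·)
    ((zero_add _).trans (Finset.sum_congr rfl fun z _ => homTensorHom_rTensor P Q M N _ _ _ _))
    ((congrArg (· + _) (smul_zero ((-1) ^ (n + 1) : R))).trans <| (zero_add _).trans <|
      Finset.sum_congr rfl fun z _ => congrArg _ (homTensorHom_lTensor P Q M N _ _ _ _))

variable {P Q} {ιP ιQ : ℕ → Type} [∀ p, Finite (ιP p)] {b : ∀ p, Module.Basis (ιP p × G) R (P.X p)}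
    {c : ∀ q, Module.Basis (ιQ q × H) R (Q.X q)} (hb : ∀ p, IsFreeOn (P.X p).ρ (b p))
    (hc : ∀ q, IsFreeOn (Q.X q).ρ (c q)) [Module.Free R M] [Module.Finite R M]

include hb hc in
lemma eq_zero_of_totHom_eq_zero (n : ℕ) (w : ∀ p q, (P.X p ⟶ M) ⊗[R] (Q.X q ⟶ N))
    (hw : w ∈ supported (R := R) (fun p q => p + q = n)) (h : totHom P Q M N n w = 0) : w = 0 := by
  funext p q
  by_cases hn : p + q = n
  · refine (injective_iff_map_eq_zero _).1 (homTensorHom_bijective (hb p) (hc q)).1 _ <|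
      Rep.hom_ext <| Representation.IntertwiningMap.ext <| LinearMap.ext fun x => ?_
    have key := totHom_apply P Q M N n w ((totIncl P Q n p q).hom x)
    rw [h, Finset.sum_eq_single_of_mem (p, q) (Finset.HasAntidiagonal.mem_antidiagonal.2 hn)
      fun z _ hz => by rw [totIncl_apply_of_ne _ _ _ _ _ _ _ _ hz, map_zero],
      totIncl_apply_same _ _ _ _ _ hn] at key
    exact key.symm
  · exact hw p q hn

include hb hc in
lemma exists_totHom_eq (n : ℕ) (f : totRep P Q n ⟶ extRep M N) :
    ∃ w ∈ supported (R := R) (fun p q => p + q = n), totHom P Q M N n w = f := by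
  choose u hu using fun p q =>
    (homTensorHom_bijective (M := M) (N := N) (hb p) (hc q)).2 (totIncl P Q n p q ≫ f)
  refine ⟨fun p q => if p + q = n then u p q else 0, fun p q h => if_neg h, ?_⟩
  refine Rep.hom_ext <| Representation.IntertwiningMap.ext <| LinearMap.ext fun x => ?_
  refine (totHom_apply P Q M N n _ x).trans ?_
  have key : ∀ z ∈ Finset.HasAntidiagonal.antidiagonal n,
      (homTensorHom _ M _ N (if z.1 + z.2 = n then u z.1 z.2 else 0)).hom (x.1 z.1 z.2) =
        f.hom ((totIncl P Q n z.1 z.2).hom (x.1 z.1 z.2)) := fun z hz => by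
    rw [if_pos (Finset.HasAntidiagonal.mem_antidiagonal.1 hz), hu]
    rfl
  rw [Finset.sum_congr rfl key]
  exact (map_sum f.hom.toLinearMap _ _).symm.trans (congrArg f.hom (sum_totIncl P Q n x))

end HomComparison

section Assembly

variable {R : Type} [CommRing R] {G H : Type} [Group G] [Group H]

lemma totD_mem_supported {W : ℕ → ℕ → Type*} [∀ p q, AddCommGroup (W p q)]
    [∀ p q, Module R (W p q)] (d₁ : ∀ p q, W p q →ₗ[R] W (p + 1) q)
    (d₂ : ∀ p q, W p q →ₗ[R] W p (q + 1)) {n : ℕ} {w : ∀ p q, W p q}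
    (hw : w ∈ supported (R := R) (fun p q => p + q = n)) :
    totD d₁ d₂ w ∈ supported (R := R) (fun p q => p + q = n + 1) := by
  have h : ∀ p q, p + q ≠ n + 1 → shift (d₂ p) (w p) q = 0
    | _, 0, _ => rfl
    | p, q + 1, h => (congrArg (d₂ p q) (hw p q (by omega))).trans (map_zero _)
  intro p q hpq
  cases p with
  | zero => rw [totD_zero, h _ _ hpq]
  | succ p => rw [totD_succ, h _ _ hpq, hw p q (by omega), map_zero, smul_zero, add_zero]

/-- A projective resolution of the trivial representation by free modules of finite rank over the
group algebra. -/
lemma exists_finite_isFreeOn [Nontrivial R] (hres : HasFinFreeResolution R G) :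
    ∃ (P : ProjectiveResolution (Rep.trivial R G R)) (ι : ℕ → Type) (_ : ∀ p, Finite (ι p))
      (b : ∀ p, Module.Basis (ι p × G) R (P.complex.X p)),
      ∀ p, IsFreeOn (P.complex.X p).ρ (b p) := by
  obtain ⟨P, hP⟩ := hres
  have : ∀ p, Module.Free (MonoidAlgebra R G) (P.complex.X p).ρ.asModule := fun p => (hP p).1
  have : ∀ p, Module.Finite (MonoidAlgebra R G) (P.complex.X p).ρ.asModule := fun p => (hP p).2
  choose b hb using fun p => exists_isFreeOn_of_basis (P.complex.X p)
    (Module.Free.chooseBasis (MonoidAlgebra R G) (P.complex.X p).ρ.asModule)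
  exact ⟨P, _, fun p => inferInstance, b, hb⟩

variable (R H) in
/-- A projective resolution of the trivial representation by free modules over the group
algebra. -/
lemma exists_isFreeOn :
    ∃ (Q : ProjectiveResolution (Rep.trivial R H R)) (κ : ℕ → Type)
      (c : ∀ q, Module.Basis (κ q × H) R (Q.complex.X q)),
      ∀ q, IsFreeOn (Q.complex.X q).ρ (c q) := by
  choose c hc using fun q => exists_isFreeOn_of_basis ((Rep.barResolution R H).complex.X q)
    (Representation.freeAsModuleBasis R H (Fin q → H))
  exact ⟨_, _, c, hc⟩

variable (P : ProjectiveResolution (Rep.trivial R G R))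
    (Q : ProjectiveResolution (Rep.trivial R H R)) (M : Rep.{0} R G) (N : Rep.{0} R H)
    {ιP ιQ : ℕ → Type} [∀ p, Finite (ιP p)]
    {b : ∀ p, Module.Basis (ιP p × G) R (P.complex.X p)}
    {c : ∀ q, Module.Basis (ιQ q × H) R (Q.complex.X q)}
    (hb : ∀ p, IsFreeOn (P.complex.X p).ρ (b p))
    (hc : ∀ q, IsFreeOn (Q.complex.X q).ρ (c q)) [Module.Free R M] [Module.Finite R M]

include hb hc in
lemma exists_tensor_presentation (n : ℕ) :
    ∃ κ : totCycles (fun p q => (precompD P.complex M p).rTensor (Q.complex.X q ⟶ N))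
        (fun p q => (precompD Q.complex N q).lTensor (P.complex.X p ⟶ M)) n →ₗ[R]
        groupCohomology (Rep.of (extTprod M N)) n,
      Function.Surjective κ ∧ ∀ x, κ x = 0 ↔ ∃ y ∈ supported (R := R) (fun p q => p + q + 1 = n),
        totD (fun p q => (precompD P.complex M p).rTensor (Q.complex.X q ⟶ N))
          (fun p q => (precompD Q.complex N q).lTensor (P.complex.X p ⟶ M)) y = x := by
  have := fun n => totRep_projective hb hc n
  have : ∀ p, Module.Free R (P.complex.X p) := fun p => Module.Free.of_basis (b p)
  obtain ⟨π, hπ, hπ₀⟩ := exists_groupCohomology_pres (tensorResolution P Q) (extRep M N) n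
  have hd : ∀ n w, precompD (tensorResolution P Q).complex (extRep M N) n
      (totHom P.complex Q.complex M N n w) = totHom P.complex Q.complex M N (n + 1) (totD
        (fun p q => (precompD P.complex M p).rTensor (Q.complex.X q ⟶ N))
        (fun p q => (precompD Q.complex N q).lTensor (P.complex.X p ⟶ M)) w) := fun n w => by
    rw [totHom_totD, ← totComplex_d]
    rfl
  have hinj : ∀ n w w', w ∈ supported (R := R) (fun p q => p + q = n) →
      w' ∈ supported (R := R) (fun p q => p + q = n) →
      totHom P.complex Q.complex M N n w = totHom P.complex Q.complex M N n w' → w = w' :=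
    fun n w w' hw hw' h => sub_eq_zero.1 <|
      eq_zero_of_totHom_eq_zero M N hb hc n _ (Submodule.sub_mem _ hw hw') <| by
        rw [map_sub, h, sub_self]
  refine ⟨π ∘ₗ (totHom P.complex Q.complex M N n ∘ₗ Submodule.subtype _).codRestrict _
    fun w => ?_, hπ.comp fun z => ?_, fun w => (hπ₀ _).trans ?_⟩
  · refine (hd n w).trans ?_
    rw [LinearMap.mem_ker.1 w.2.2]
    exact map_zero _
  · obtain ⟨w, hw, hwz⟩ := exists_totHom_eq M N hb hc n z.1
    refine ⟨⟨w, hw, eq_zero_of_totHom_eq_zero M N hb hc (n + 1) _ (totD_mem_supported _ _ hw) ?_⟩,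
      Subtype.ext hwz⟩
    rw [← hd, hwz]
    exact z.2
  · change totHom P.complex Q.complex M N n w.1 ∈
      coboundaries (precompD (tensorResolution P Q).complex (extRep M N)) n ↔ _
    cases n with
    | zero =>
      refine ⟨fun h => ⟨0, Submodule.zero_mem _, ?_⟩, ?_⟩
      · rw [map_zero]
        exact (eq_zero_of_totHom_eq_zero M N hb hc 0 _ w.2.1 h).symm
      · rintro ⟨y, hy, hyw⟩
        obtain rfl : y = 0 := funext₂ fun p q => hy p q (by omega)
        rw [← hyw, map_zero, map_zero]
        exact Submodule.zero_mem _
    | succ n =>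
      refine ⟨?_, ?_⟩
      · rintro ⟨f, hf⟩
        obtain ⟨y, hy, rfl⟩ := exists_totHom_eq M N hb hc n f
        refine ⟨y, fun p q h => hy p q (by omega), ?_⟩
        refine hinj (n + 1) _ _ (totD_mem_supported _ _ hy) w.2.1 ?_
        rw [← hd]
        exact hf
      · rintro ⟨y, hy, hyw⟩
        exact ⟨totHom P.complex Q.complex M N n y, (hd n y).trans (by rw [hyw])⟩

/-- Families supported in total degree `n` form the direct sum of their terms. -/
noncomputable def supportedEquivDirectSum {U : ℕ → ℕ → Type*} [∀ p q, AddCommGroup (U p q)]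
    [∀ p q, Module R (U p q)] (n : ℕ) :
    supported (R := R) (U := U) (fun p q => p + q = n) ≃ₗ[R] ⨁ i : Fin (n + 1), U i (n - i) :=
  supportedEquiv n ≪≫ₗ (DirectSum.linearEquivFunOnFintype R (Fin (n + 1)) fun i => U i (n - i)).symm

end Assembly

end Kunneth

open Kunneth

/-- the Künneth short exact sequence
`0 → ⊕_{p+q=n} Hᵖ(G,M) ⊗ H^q(H,N) → Hⁿ(G×H, M⊗N) → ⊕_{p+q=n+1} Tor₁(Hᵖ(G,M), H^q(H,N)) → 0`
for a Dedekind domain `R`, `M` a `R[G]`-module finitely generated free over `R`,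
and `N` any `R[H]`-module, assuming the trivial module has a resolution by finitely
generated free `R[G]`-modules. -/
theorem groupCohomology_kunneth
    {R : Type} [CommRing R] [IsDomain R] [IsDedekindDomain R]
    {G H : Type} [Group G] [Group H]
    (hres : HasFinFreeResolution R G)
    (M : Rep R G) [Module.Free R M] [Module.Finite R M]
    (N : Rep R H) (n : ℕ) :
    ∃ (f : (⨁ i : Fin (n + 1),
            (groupCohomology M (i : ℕ) ⊗[R] groupCohomology N (n - (i : ℕ)))) →ₗ[R]
           groupCohomology (Rep.of (extTprod M N)) n)
      (g : groupCohomology (Rep.of (extTprod M N)) n →ₗ[R]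
           (⨁ i : Fin (n + 2),
            ((Tor (ModuleCat R) 1).obj
                (ModuleCat.of R (groupCohomology M (i : ℕ)))).obj
              (ModuleCat.of R (groupCohomology N (n + 1 - (i : ℕ)))))),
      Function.Injective f ∧ Function.Surjective g ∧ Function.Exact f g := by
  obtain ⟨P, ιP, _, b, hb⟩ := exists_finite_isFreeOn hres
  obtain ⟨Q, ιQ, c, hc⟩ := exists_isFreeOn R H
  choose πA hA hA₀ using exists_groupCohomology_pres P M
  choose πC hC hC₀ using exists_groupCohomology_pres Q N
  obtain ⟨κ, hκ, hκ₀⟩ := exists_tensor_presentation P Q M N hb hc n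
  let e := fun p => LinearEquiv.ofBijective _ (evalBasis_bijective (hb p) M)
  have : ∀ p, Module.Free R (P.complex.X p ⟶ M) := fun p => Module.Free.of_equiv (e p).symm
  have : ∀ p, Module.Finite R (P.complex.X p ⟶ M) := fun p => Module.Finite.equiv (e p).symm
  obtain ⟨f, g, hf, hg, hfg⟩ := tensor_kunneth (precompD P.complex M) (precompD Q.complex N)
    (precompD_precompD P.complex M) (precompD_precompD Q.complex N) πA hA hA₀ πC hC hC₀ n κ hκ hκ₀
  let e₁ := supportedEquivDirectSum (R := R)
    (U := fun p q => groupCohomology M p ⊗[R] groupCohomology N q) n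
  let e₂ := supportedEquivDirectSum (R := R)
    (U := fun p q => ((Tor (ModuleCat R) 1).obj (ModuleCat.of R (groupCohomology M p))).obj
      (ModuleCat.of R (groupCohomology N q))) (n + 1)
  refine ⟨f ∘ₗ e₁.symm.toLinearMap, e₂.toLinearMap ∘ₗ g, hf.comp e₁.symm.injective,
    e₂.surjective.comp hg, fun x => ?_⟩
  refine e₂.map_eq_zero_iff.trans ((hfg x).trans ⟨?_, ?_⟩)
  · rintro ⟨y, rfl⟩
    exact ⟨e₁ y, congrArg f (e₁.symm_apply_apply y)⟩
  · rintro ⟨y, rfl⟩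
    exact ⟨_, rfl⟩
end

section
/- Let $F$ be a number field with ring of integers $\mathcal{O}$, let $F^{\mathrm{Hil}}$ be the Hilbert class field of $F$ with ring of integers $\mathcal{O}^{\mathrm{Hil}}$, let $N \geq 1$ and $d_F$ the discriminant, and set $A = \mathbb{Z}[1/(N d_F)]$ and $R = \mathcal{O}^{\mathrm{Hil}}[1/(N d_F)]$. For a fractional ideal $\mathfrak{b}$ of $\mathcal{O}$, the $\mathrm{Gal}(F^{\mathrm{Hil}}/\mathbb{Q})$-invariants of the $R$-ideal $\prod_\sigma \sigma(\mathfrak{b}) R$ (product over all embeddings $\sigma : F \to \overline{\mathbb{Q}}$) equal $\mathrm{Norm}(\mathfrak{b}) \cdot A$, where $\mathrm{Norm}(\mathfrak{b}) = \prod_{\mathfrak{p}} |\kappa(\mathfrak{p})|^{v_\mathfrak{p}(\mathfrak{b})}$ is the absolute ideal norm. -/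
open NumberField

/-- The localization `ℤ[1/m]`, realized as a subalgebra of `ℚ`. -/
noncomputable def locA (m : ℕ) : Subalgebra ℤ ℚ := Algebra.adjoin ℤ {((m : ℚ))⁻¹}

section

open scoped Pointwise nonZeroDivisors

/-- The norm from a number field to `ℚ` is the product over the embeddings into any normal
extension of `ℚ` that receives at least one embedding. -/
lemma norm_eq_prod_algHom_of_normal {F K : Type*} [Field F] [NumberField F] [Field K]
    [NumberField K] [Normal ℚ K] (τ : F →ₐ[ℚ] K) (x : F) :
    algebraMap ℚ K (Algebra.norm ℚ x) = ∏ σ : F →ₐ[ℚ] K, σ x := by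
  have hs : ∀ y : F, ((minpoly ℚ y).map (algebraMap ℚ K)).Splits := fun y => by
    rw [← minpoly.algHom_eq τ τ.injective y]
    exact Normal.splits inferInstance (τ y)
  apply (algebraMap K (AlgebraicClosure K)).injective
  rw [← IsScalarTower.algebraMap_apply,
    Algebra.norm_eq_prod_embeddings ℚ (AlgebraicClosure K) x, map_prod]
  exact (Fintype.prod_equiv
    (Algebra.IsAlgebraic.algHomEquivAlgHomOfSplits (AlgebraicClosure K) K hs) _ _
    fun σ => rfl).symm

/-- Extending scalars along an embedding `σ` commutes with taking spans. -/
lemma span_image_coe_span {F K : Type*} [Field F] [NumberField F] [Field K] [NumberField K]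
    (σ : F →ₐ[ℚ] K) (S : Set F) :
    Submodule.span (𝓞 K) (σ '' (Submodule.span (𝓞 F) S : Set F)) =
      Submodule.span (𝓞 K) (σ '' S) := by
  refine le_antisymm (Submodule.span_le.2 ?_)
    (Submodule.span_mono (Set.image_mono Submodule.subset_span))
  rintro _ ⟨x, hx, rfl⟩
  rw [SetLike.mem_coe] at hx ⊢
  induction hx using Submodule.span_induction with
  | mem x h => exact Submodule.subset_span ⟨x, h, rfl⟩
  | zero => rw [map_zero]; exact Submodule.zero_mem _
  | add x y _ _ hx hy => rw [map_add]; exact Submodule.add_mem _ hx hy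
  | smul r x _ hx =>
    have hr : σ (r • x) = RingOfIntegers.mapRingHom (σ : F →+* K) r • σ x := by
      rw [Algebra.smul_def, map_mul, Algebra.smul_def]; rfl
    rw [hr]
    exact Submodule.smul_mem _ _ hx

/-- Extending scalars along an embedding `σ` commutes with taking powers. -/
lemma span_image_coe_pow {F K : Type*} [Field F] [NumberField F] [Field K] [NumberField K]
    (σ : F →ₐ[ℚ] K) (I : Submodule (𝓞 F) F) (n : ℕ) :
    Submodule.span (𝓞 K) (σ '' ((I ^ n : Submodule (𝓞 F) F) : Set F)) =
      Submodule.span (𝓞 K) (σ '' (I : Set F)) ^ n := by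
  rw [Submodule.span_pow, ← Set.image_pow σ, ← span_image_coe_span σ ((I : Set F) ^ n),
    ← Submodule.span_pow, Submodule.span_eq]

/-- A power of a nonzero fractional ideal is principal. -/
lemma exists_pow_eq_spanSingleton {F : Type*} [Field F] [NumberField F]
    {b : FractionalIdeal (𝓞 F)⁰ F} (hb : b ≠ 0) :
    ∃ h : ℕ, h ≠ 0 ∧ ∃ γ : F, b ^ h = FractionalIdeal.spanSingleton (𝓞 F)⁰ γ := by
  refine ⟨Fintype.card (ClassGroup (𝓞 F)), Fintype.card_ne_zero, ?_⟩
  rw [← FractionalIdeal.isPrincipal_iff]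
  have h1 := pow_card_eq_one (x := ClassGroup.mk F (Units.mk0 b hb))
  rw [← map_pow, ClassGroup.mk_eq_one_iff] at h1
  simpa using h1

/-- Elements some positive power of which generate the same `𝓞 K`-submodule generate the same
`𝓞 K`-submodule. -/
lemma span_singleton_le_of_pow_le {K : Type*} [Field K] [NumberField K] {x y : K} {h : ℕ}
    (h0 : h ≠ 0)
    (hxy : Submodule.span (𝓞 K) {x} ^ h ≤ Submodule.span (𝓞 K) {y} ^ h) :
    Submodule.span (𝓞 K) {x} ≤ Submodule.span (𝓞 K) {y} := by
  rw [Submodule.span_pow, Submodule.span_pow, Set.singleton_pow, Set.singleton_pow,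
    Submodule.span_singleton_le_iff_mem, Submodule.mem_span_singleton] at hxy
  rw [Submodule.span_singleton_le_iff_mem, Submodule.mem_span_singleton]
  obtain ⟨u, hu⟩ := hxy
  rw [Algebra.smul_def] at hu
  by_cases hy : y = 0
  · subst hy
    have hx : x = 0 := by
      rw [zero_pow h0, mul_zero] at hu
      exact pow_eq_zero_iff h0 |>.1 hu.symm
    exact ⟨0, by simp [hx]⟩
  have hint : IsIntegral ℤ (x / y) := by
    apply IsIntegral.of_pow (Nat.pos_of_ne_zero h0)
    rw [div_pow, ← hu, mul_div_cancel_right₀ _ (pow_ne_zero h hy)]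
    exact RingOfIntegers.isIntegral_coe u
  refine ⟨⟨x / y, hint⟩, ?_⟩
  exact div_mul_cancel₀ x hy

lemma span_singleton_eq_of_pow_eq {K : Type*} [Field K] [NumberField K] {x y : K} {h : ℕ}
    (h0 : h ≠ 0)
    (hxy : Submodule.span (𝓞 K) {x} ^ h = Submodule.span (𝓞 K) {y} ^ h) :
    Submodule.span (𝓞 K) {x} = Submodule.span (𝓞 K) {y} :=
  le_antisymm (span_singleton_le_of_pow_le h0 hxy.le) (span_singleton_le_of_pow_le h0 hxy.ge)

/-- The product of the conjugates of a fractional ideal is generated by its absolute norm, as soon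
as it is principal. -/
lemma prod_span_image_eq_span_absNorm {F K : Type*} [Field F] [NumberField F] [Field K]
    [NumberField K] [Normal ℚ K] (τ : F →ₐ[ℚ] K) {b : FractionalIdeal (𝓞 F)⁰ F} (hb : b ≠ 0)
    {β : K} (hβ : ∏ σ : F →ₐ[ℚ] K,
      Submodule.span (𝓞 K) (σ '' ((b : Submodule (𝓞 F) F) : Set F)) =
        Submodule.span (𝓞 K) {β}) :
    ∏ σ : F →ₐ[ℚ] K, Submodule.span (𝓞 K) (σ '' ((b : Submodule (𝓞 F) F) : Set F)) =
      Submodule.span (𝓞 K) {algebraMap ℚ K (FractionalIdeal.absNorm b)} := by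
  obtain ⟨h, h0, γ, hγ⟩ := exists_pow_eq_spanSingleton hb
  rw [hβ]
  apply span_singleton_eq_of_pow_eq h0
  have hpow : ∀ σ : F →ₐ[ℚ] K,
      Submodule.span (𝓞 K) (σ '' ((b : Submodule (𝓞 F) F) : Set F)) ^ h =
        Submodule.span (𝓞 K) {σ γ} := by
    intro σ
    rw [← span_image_coe_pow, ← FractionalIdeal.coe_pow, hγ, FractionalIdeal.coe_spanSingleton,
      span_image_coe_span, Set.image_singleton]
  rw [← hβ, ← Finset.prod_pow, Finset.prod_congr rfl fun σ _ => hpow σ,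
    Submodule.prod_span_singleton, ← norm_eq_prod_algHom_of_normal τ, Submodule.span_pow,
    Set.singleton_pow, ← map_pow, ← map_pow, hγ, FractionalIdeal.absNorm_span_singleton]
  rcases abs_choice (Algebra.norm ℚ γ) with h | h <;> rw [h]
  rw [map_neg, ← Set.neg_singleton, Submodule.span_neg]

lemma span_mul_span_range_le {A K : Type*} [CommRing A] [Field K] [Algebra A K] {S T : Set K}
    (h : Submodule.span (𝓞 K) S ≤ Submodule.span (𝓞 K) T) :
    Submodule.span A S * Submodule.span A (Set.range (algebraMap (𝓞 K) K)) ≤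
      Submodule.span A T * Submodule.span A (Set.range (algebraMap (𝓞 K) K)) := by
  have key : ∀ s ∈ Submodule.span (𝓞 K) T, ∀ o : 𝓞 K, s * algebraMap (𝓞 K) K o ∈
      Submodule.span A T * Submodule.span A (Set.range (algebraMap (𝓞 K) K)) := by
    intro s hs
    induction hs using Submodule.span_induction with
    | mem x hx =>
      exact fun o => Submodule.mul_mem_mul (Submodule.subset_span hx)
        (Submodule.subset_span ⟨o, rfl⟩)
    | zero => intro o; rw [zero_mul]; exact Submodule.zero_mem _
    | add x y _ _ hx hy => intro o; rw [add_mul]; exact Submodule.add_mem _ (hx o) (hy o)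
    | smul r x _ hx =>
      intro o
      rw [Algebra.smul_def, mul_comm (algebraMap (𝓞 K) K r) x, mul_assoc, ← map_mul]
      exact hx _
  rw [Submodule.span_mul_span, Submodule.span_le]
  rintro _ ⟨s, hs, _, ⟨o, rfl⟩, rfl⟩
  exact key s (h (Submodule.subset_span hs)) o

/-- The `A`-submodule generated by `S · 𝓞 K` depends only on the
`𝓞 K`-submodule generated by `S`. -/
lemma span_mul_span_range_congr {A K : Type*} [CommRing A] [Field K] [Algebra A K] {S T : Set K}
    (h : Submodule.span (𝓞 K) S = Submodule.span (𝓞 K) T) :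
    Submodule.span A S * Submodule.span A (Set.range (algebraMap (𝓞 K) K)) =
      Submodule.span A T * Submodule.span A (Set.range (algebraMap (𝓞 K) K)) :=
  le_antisymm (span_mul_span_range_le h.le) (span_mul_span_range_le h.ge)

lemma inv_mem_locA (m : ℕ) : (m : ℚ)⁻¹ ∈ locA m := Algebra.subset_adjoin rfl

lemma exists_pow_mul_eq_intCast {m : ℕ} (hm : m ≠ 0) {a : ℚ} (ha : a ∈ locA m) :
    ∃ (k : ℕ) (z : ℤ), (m : ℚ) ^ k * a = z := by
  have hm' : (m : ℚ) ≠ 0 := Nat.cast_ne_zero.2 hm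
  induction ha using Algebra.adjoin_induction with
  | mem x hx =>
    rw [Set.mem_singleton_iff] at hx
    exact ⟨1, 1, by rw [hx]; simp [hm']⟩
  | algebraMap z => exact ⟨0, z, by simp⟩
  | add x y _ _ hx hy =>
    obtain ⟨k, z, hz⟩ := hx
    obtain ⟨l, w, hw⟩ := hy
    refine ⟨k + l, m ^ l * z + m ^ k * w, ?_⟩
    push_cast
    rw [← hz, ← hw]
    ring
  | mul x y _ _ hx hy =>
    obtain ⟨k, z, hz⟩ := hx
    obtain ⟨l, w, hw⟩ := hy
    refine ⟨k + l, z * w, ?_⟩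
    push_cast
    rw [← hz, ← hw]
    ring

lemma exists_isIntegral_pow_mul {K : Type*} [Field K] [NumberField K] {m : ℕ} (hm : m ≠ 0) {x : K}
    (hx : x ∈ Submodule.span (locA m) (Set.range (algebraMap (𝓞 K) K))) :
    ∃ k : ℕ, IsIntegral ℤ ((m : K) ^ k * x) := by
  have hint : ∀ k : ℕ, IsIntegral ℤ ((m : K) ^ k) := fun k => by
    simpa using (isIntegral_algebraMap (R := ℤ) (A := K) (x := (m : ℤ) ^ k))
  induction hx using Submodule.span_induction with
  | mem x hx =>
    obtain ⟨o, rfl⟩ := hx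
    exact ⟨0, by simpa using RingOfIntegers.isIntegral_coe o⟩
  | zero => exact ⟨0, by simpa using isIntegral_zero⟩
  | add x y _ _ hx hy =>
    obtain ⟨k, hk⟩ := hx
    obtain ⟨l, hl⟩ := hy
    refine ⟨k + l, ?_⟩
    have : (m : K) ^ (k + l) * (x + y) = m ^ l * (m ^ k * x) + m ^ k * (m ^ l * y) := by ring
    rw [this]
    exact ((hint l).mul hk).add ((hint k).mul hl)
  | smul a x _ hx =>
    obtain ⟨k, hk⟩ := hx
    obtain ⟨l, z, hz⟩ := exists_pow_mul_eq_intCast hm a.2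
    refine ⟨l + k, ?_⟩
    have hz' : (m : K) ^ l * algebraMap ℚ K a = z := by
      simpa using congrArg (algebraMap ℚ K) hz
    have : (m : K) ^ (l + k) * (a • x) = z * (m ^ k * x) := by
      rw [← hz', Subalgebra.smul_def, Algebra.smul_def]; ring
    rw [this]
    exact (isIntegral_algebraMap (R := ℤ) (x := z)).mul hk

/-- The rational elements of `𝓞 K[1/m]` are those of `ℤ[1/m]`. -/
lemma algebraMap_mem_span_range_iff {K : Type*} [Field K] [NumberField K] {m : ℕ} (hm : m ≠ 0)
    (a : ℚ) :
    algebraMap ℚ K a ∈ Submodule.span (locA m) (Set.range (algebraMap (𝓞 K) K)) ↔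
      a ∈ locA m := by
  constructor
  · intro h
    obtain ⟨k, hk⟩ := exists_isIntegral_pow_mul hm h
    have hk' : IsIntegral ℤ (algebraMap ℚ K ((m : ℚ) ^ k * a)) := by simpa using hk
    rw [isIntegral_algebraMap_iff (algebraMap ℚ K).injective,
      IsIntegrallyClosed.isIntegral_iff] at hk'
    obtain ⟨z, hz⟩ := hk'
    have hm' : (m : ℚ) ^ k ≠ 0 := pow_ne_zero _ (Nat.cast_ne_zero.2 hm)
    have : a = algebraMap ℤ ℚ z * ((m : ℚ)⁻¹) ^ k := by
      rw [hz, inv_pow]; field_simp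
    rw [this]
    exact mul_mem (Subalgebra.algebraMap_mem _ z) (pow_mem (inv_mem_locA m) k)
  · intro h
    have : algebraMap ℚ K a = (⟨a, h⟩ : locA m) • (1 : K) := by
      rw [Subalgebra.smul_def, Algebra.smul_def, mul_one]
    rw [this]
    exact Submodule.smul_mem _ _ (Submodule.subset_span ⟨1, map_one _⟩)

end

/-- let `F` be a number field, `K` its Hilbert class field (a Galois
extension of `ℚ` containing `F` in which every ideal of `𝒪_F` becomes principal),
`N ≥ 1`, `A = ℤ[1/(N d_F)]` and `R = 𝒪_K[1/(N d_F)]` (so that, as an `A`-module,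
`R` is the `A`-span of `𝒪_K` in `K`).  For a fractional ideal `𝔟` of `F`, the
`Gal(K/ℚ)`-invariants of the `R`-ideal `∏_σ σ(𝔟)R` (product over all embeddings
`σ : F → K`) equal `Norm(𝔟)·A`, where `Norm(𝔟) = ∏_𝔭 |κ(𝔭)|^{v_𝔭(𝔟)}` is the
absolute ideal norm. -/
theorem galois_invariants_ideal_product
    (F K : Type) [Field F] [NumberField F] [Field K] [NumberField K]
    [IsGalois ℚ K] (τ : F →ₐ[ℚ] K)
    (N : ℕ) (hN : 0 < N)
    (b : FractionalIdeal (nonZeroDivisors (𝓞 F)) F) (hb : b ≠ 0)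
    -- in the Hilbert class field every (conjugate of a) fractional ideal of `F`
    -- becomes principal:
    (hprincipal : ∀ σ : F →ₐ[ℚ] K, ∃ α : K,
      Submodule.span (𝓞 K) (⇑σ '' ((b : Submodule (𝓞 F) F) : Set F)) =
        Submodule.span (𝓞 K) {α}) :
    letI m : ℕ := N * (NumberField.discr F).natAbs
    letI R : Submodule (locA m) K :=
      Submodule.span (locA m) (Set.range (algebraMap (𝓞 K) K))
    letI M : Submodule (locA m) K :=
      (∏ σ : F →ₐ[ℚ] K,
        Submodule.span (locA m) (⇑σ '' ((b : Submodule (𝓞 F) F) : Set F))) * R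
    {x : K | x ∈ M ∧ ∀ g : K ≃ₐ[ℚ] K, g x = x} =
      (fun a : ℚ => algebraMap ℚ K ((FractionalIdeal.absNorm b) * a)) ''
        ((locA m : Subalgebra ℤ ℚ) : Set ℚ) := by
  have hm : N * (NumberField.discr F).natAbs ≠ 0 :=
    mul_ne_zero hN.ne' (Int.natAbs_ne_zero.2 (NumberField.discr_ne_zero F))
  generalize N * (NumberField.discr F).natAbs = m at hm ⊢
  choose α hα using hprincipal
  have hβ : ∏ σ : F →ₐ[ℚ] K, Submodule.span (𝓞 K) (σ '' ((b : Submodule (𝓞 F) F) : Set F)) =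
      Submodule.span (𝓞 K) {∏ σ : F →ₐ[ℚ] K, α σ} := by
    rw [Finset.prod_congr rfl fun σ _ => hα σ, Submodule.prod_span_singleton]
  have hJ := prod_span_image_eq_span_absNorm τ hb hβ
  rw [Submodule.prod_span] at hJ
  have hn : algebraMap ℚ K (FractionalIdeal.absNorm b) ≠ 0 := by
    rw [Ne, map_eq_zero, FractionalIdeal.absNorm_eq_zero_iff]
    exact hb
  simp only [Submodule.prod_span]
  rw [span_mul_span_range_congr hJ]
  ext x
  simp only [Set.mem_ofPred_eq, Set.mem_image, SetLike.mem_coe, Submodule.mem_span_singleton_mul]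
  constructor
  · rintro ⟨⟨r, hr, rfl⟩, hfix⟩
    obtain ⟨q, hq⟩ := (IsGalois.mem_range_algebraMap_iff_fixed (F := ℚ) _).2 hfix
    have hrq : r = algebraMap ℚ K (q / FractionalIdeal.absNorm b) := by
      rw [map_div₀, hq, mul_div_cancel_left₀ _ hn]
    rw [hrq, algebraMap_mem_span_range_iff hm] at hr
    exact ⟨_, hr, by rw [hrq, map_mul]⟩
  · rintro ⟨a, ha, rfl⟩
    exact ⟨⟨algebraMap ℚ K a, (algebraMap_mem_span_range_iff hm a).2 ha, (map_mul _ _ _).symm⟩,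
      fun g => g.commutes _⟩
end

section
/- Let $X$ be a topological manifold admitting a finite good cover and $\mathcal{V}$ a locally constant sheaf of $A$-modules on $X$ with finitely generated stalks, for $A$ a noetherian ring. Then $H^p(X, \mathcal{V})$ is a finitely generated $A$-module for all $p$. -/
open CategoryTheory TopCat TopologicalSpace Limits Opposite

/-- `X` admits a finite good cover: a finite open cover by sets homeomorphic to
`ℝⁿ`, all of whose nonempty finite intersections are homeomorphic to `ℝⁿ` or empty. -/
def HasFiniteGoodCover (X : TopCat) (n : ℕ) : Prop :=
  ∃ (ι : Type) (_ : Finite ι) (U : ι → Opens X),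
    (⨆ i, U i = ⊤) ∧
    ∀ s : Finset ι, s.Nonempty →
      (s.inf U = ⊥ ∨ Nonempty ((s.inf U : Opens X) ≃ₜ EuclideanSpace ℝ (Fin n)))

/-- A locally constant sheaf of `A`-modules with finitely generated stalks. -/
def IsLocallyConstantFG {X : TopCat} {A : Type} [CommRing A]
    (F : X.Presheaf (ModuleCat.{0} A)) : Prop :=
  (∀ x : X, Module.Finite A (F.stalk x)) ∧
  ∀ x : X, ∃ U : Opens X, x ∈ U ∧ ∀ y (hy : y ∈ U), IsIso (F.germ U y hy)

instance (X : TopCat) (A : Type) [CommRing A] :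
    (sheafToPresheaf (Opens.grothendieckTopology X) (ModuleCat.{0} A)).Additive :=
  { map_add := rfl }

/-- The global sections functor on sheaves of `A`-modules. -/
noncomputable def globalSections (X : TopCat) (A : Type) [CommRing A] :
    Sheaf (Opens.grothendieckTopology X) (ModuleCat.{0} A) ⥤ ModuleCat.{0} A :=
  sheafToPresheaf _ _ ⋙ (evaluation ((Opens X)ᵒᵖ) (ModuleCat.{0} A)).obj (op ⊤)

instance (X : TopCat) (A : Type) [CommRing A] : (globalSections X A).Additive := by
  unfold globalSections; infer_instance

/-- Sheaf cohomology `H^p(X, -)` as the right derived functor of global sections. -/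
noncomputable def sheafCoh (X : TopCat) (A : Type) [CommRing A]
    [EnoughInjectives (Sheaf (Opens.grothendieckTopology X) (ModuleCat.{0} A))]
    (p : ℕ) :
    Sheaf (Opens.grothendieckTopology X) (ModuleCat.{0} A) ⥤ ModuleCat.{0} A :=
  (globalSections X A).rightDerived p


section BoxInduction

variable {n : ℕ}

/-- A property of small boxes which passes from the two halves of a box, cut with overlap along a
coordinate hyperplane, to the whole box holds for all boxes. -/
theorem box_induction (P : (Fin n → ℝ) → (Fin n → ℝ) → Prop)
    (small : ∀ x : Fin n → ℝ, ∃ ε > 0, ∀ a b : Fin n → ℝ, (∀ i, a i < b i) →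
      (∀ i, x i - ε < a i) → (∀ i, b i < x i + ε) → P a b)
    (split : ∀ (a b : Fin n → ℝ) (i : Fin n) (c d : ℝ), (∀ j, a j < b j) → a i < c → c < d →
      d < b i → P a (Function.update b i d) → P (Function.update a i c) b → P a b)
    (a b : Fin n → ℝ) (hab : ∀ i, a i < b i) : P a b := by
  choose ε hε hP using small
  obtain ⟨δ, hδ, hleb⟩ := lebesgue_number_lemma_of_metric (s := Set.Icc a b)
    (c := fun x : Fin n → ℝ ↦ Metric.ball x (ε x)) isCompact_Icc (fun _ ↦ Metric.isOpen_ball)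
    (fun x _ ↦ Set.mem_iUnion.2 ⟨x, Metric.mem_ball_self (hε x)⟩)
  have base : ∀ a' b' : Fin n → ℝ, (∀ i, a i ≤ a' i) → (∀ i, b' i ≤ b i) → (∀ i, a' i < b' i) →
      (∀ i, b' i - a' i ≤ δ / 2) → P a' b' := by
    intro a' b' ha hb h hs
    obtain ⟨x, hx⟩ := hleb a' ⟨ha, fun i ↦ (h i).le.trans (hb i)⟩
    have h1 : a' ∈ Metric.ball x (ε x) := hx (Metric.mem_ball_self hδ)
    have h2 : b' ∈ Metric.ball x (ε x) := by
      apply hx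
      rw [Metric.mem_ball, dist_pi_lt_iff hδ]
      intro i
      rw [Real.dist_eq, abs_lt]
      constructor <;> linarith [h i, hs i]
    rw [Metric.mem_ball, dist_pi_lt_iff (hε x)] at h1 h2
    refine hP x a' b' h (fun i ↦ ?_) (fun i ↦ ?_)
    · have := h1 i
      rw [Real.dist_eq, abs_lt] at this
      linarith
    · have := h2 i
      rw [Real.dist_eq, abs_lt] at this
      linarith
  have key : ∀ N : ℕ, ∀ a' b' : Fin n → ℝ, (∀ i, a i ≤ a' i) → (∀ i, b' i ≤ b i) →
      (∀ i, a' i < b' i) → (∀ i, b' i - a' i ≤ (3 / 2) ^ N * (δ / 2)) → P a' b' := by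
    intro N
    induction N with
    | zero => simpa using base
    | succ N ih =>
      have aux : ∀ S : Finset (Fin n), ∀ a' b' : Fin n → ℝ, (∀ i, a i ≤ a' i) →
          (∀ i, b' i ≤ b i) → (∀ i, a' i < b' i) →
          (∀ i, b' i - a' i ≤ (3 / 2) ^ (N + 1) * (δ / 2)) →
          (∀ i ∉ S, b' i - a' i ≤ (3 / 2) ^ N * (δ / 2)) → P a' b' := by
        intro S
        induction S using Finset.induction_on with
        | empty => exact fun a' b' ha hb h _ h2 ↦ ih a' b' ha hb h (fun i ↦ h2 i (by simp))
        | insert j S hj ihS =>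
          intro a' b' ha hb h h1 h2
          have hj' := h j
          have hj1 := h1 j
          rw [pow_succ] at hj1
          apply split a' b' j (a' j + (b' j - a' j) / 3) (a' j + 2 * (b' j - a' j) / 3) h
            (by linarith) (by linarith) (by linarith)
          · apply ihS
            · exact ha
            · intro i
              by_cases hi : i = j
              · subst hi; simp; linarith [hb i]
              · simpa [hi] using hb i
            · intro i
              by_cases hi : i = j
              · subst hi; simp; linarith [hb i]
              · simpa [hi] using h i
            · intro i
              by_cases hi : i = j
              · subst hi; simp; linarith [hb i, h1 i]
              · simpa [hi] using h1 i
            · intro i hiS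
              by_cases hi : i = j
              · subst hi; simp; linarith [hb i]
              · simpa [hi] using h2 i (by simp [hi, hiS])
          · apply ihS
            · intro i
              by_cases hi : i = j
              · subst hi; simp; linarith [ha i]
              · simpa [hi] using ha i
            · exact hb
            · intro i
              by_cases hi : i = j
              · subst hi; simp; linarith [hb i]
              · simpa [hi] using h i
            · intro i
              by_cases hi : i = j
              · subst hi; simp; linarith [hb i, h1 i]
              · simpa [hi] using h1 i
            · intro i hiS
              by_cases hi : i = j
              · subst hi; simp; linarith [hb i]
              · simpa [hi] using h2 i (by simp [hi, hiS])
      exact fun a' b' ha hb h h1 ↦ aux Finset.univ a' b' ha hb h h1 (by simp)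
  obtain ⟨M, hM⟩ := (Set.finite_range fun i ↦ b i - a i).bddAbove
  obtain ⟨N, hN⟩ := pow_unbounded_of_one_lt (M / (δ / 2)) (by norm_num : (1 : ℝ) < 3 / 2)
  refine key N a b (fun _ ↦ le_rfl) (fun _ ↦ le_rfl) hab fun i ↦ ?_
  rw [div_lt_iff₀ (by positivity)] at hN
  exact (hM ⟨i, rfl⟩).trans hN.le

end BoxInduction

section Boxes

variable {X : Type} [TopologicalSpace X] {n : ℕ} {f : (Fin n → ℝ) → X}

/-- The image of an open box under an open embedding of `ℝⁿ`. -/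
def boxOpens (hf : Topology.IsOpenEmbedding f) (a b : Fin n → ℝ) : Opens X :=
  ⟨f '' Set.univ.pi fun i ↦ Set.Ioo (a i) (b i),
    hf.isOpenMap _ (isOpen_set_pi Set.finite_univ fun _ _ ↦ isOpen_Ioo)⟩

/-- The image of an open embedding. -/
def rangeOpens (hf : Topology.IsOpenEmbedding f) : Opens X := ⟨Set.range f, hf.isOpen_range⟩

variable (hf : Topology.IsOpenEmbedding f)

theorem apply_mem_boxOpens {a b x : Fin n → ℝ} :
    f x ∈ boxOpens hf a b ↔ ∀ i, a i < x i ∧ x i < b i := by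
  change f x ∈ f '' _ ↔ _
  rw [hf.injective.mem_set_image]
  simp

theorem boxOpens_le_range (a b : Fin n → ℝ) : boxOpens hf a b ≤ rangeOpens hf :=
  Set.image_subset_range _ _

theorem boxOpens_mono {a b a' b' : Fin n → ℝ} (ha : ∀ i, a' i ≤ a i) (hb : ∀ i, b i ≤ b' i) :
    boxOpens hf a b ≤ boxOpens hf a' b' := by
  rintro _ ⟨x, hx, rfl⟩
  refine (apply_mem_boxOpens hf).2 fun i ↦ ?_
  obtain ⟨h1, h2⟩ := hx i trivial
  exact ⟨(ha i).trans_lt h1, h2.trans_le (hb i)⟩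

theorem boxOpens_isPreconnected (a b : Fin n → ℝ) : IsPreconnected (boxOpens hf a b : Set X) :=
  (isPreconnected_univ_pi fun _ ↦ isPreconnected_Ioo).image _ hf.continuous.continuousOn

theorem boxOpens_nonempty {a b : Fin n → ℝ} (h : ∀ i, a i < b i) : ∃ x, x ∈ boxOpens hf a b :=
  ⟨f fun i ↦ (a i + b i) / 2, (apply_mem_boxOpens hf).2 fun i ↦
    ⟨by linarith [h i], by linarith [h i]⟩⟩

theorem boxOpens_le_sup {a b : Fin n → ℝ} {i : Fin n} {c d : ℝ} (hcd : c < d) :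
    boxOpens hf a b ≤
      boxOpens hf a (Function.update b i d) ⊔ boxOpens hf (Function.update a i c) b := by
  rintro _ ⟨x, hx, rfl⟩
  have hx' : ∀ j, a j < x j ∧ x j < b j := fun j ↦ hx j trivial
  rcases lt_or_ge (x i) d with h | h
  · refine Or.inl ((apply_mem_boxOpens hf).2 fun j ↦ ?_)
    by_cases hj : j = i
    · subst hj; simpa using ⟨(hx' j).1, h⟩
    · simpa [hj] using hx' j
  · refine Or.inr ((apply_mem_boxOpens hf).2 fun j ↦ ?_)
    by_cases hj : j = i
    · subst hj; simpa using ⟨hcd.trans_le h, (hx' j).2⟩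
    · simpa [hj] using hx' j

theorem boxOpens_inf {a b : Fin n → ℝ} {i : Fin n} {c d : ℝ} (hac : a i < c) (hdb : d < b i) :
    boxOpens hf a (Function.update b i d) ⊓ boxOpens hf (Function.update a i c) b =
      boxOpens hf (Function.update a i c) (Function.update b i d) := by
  apply le_antisymm
  · rintro _ ⟨⟨x, hx, rfl⟩, hx2⟩
    have h2 := (apply_mem_boxOpens hf).1 hx2
    exact (apply_mem_boxOpens hf).2 fun j ↦ ⟨(h2 j).1, (hx j trivial).2⟩
  · refine le_inf (boxOpens_mono hf (fun j ↦ ?_) fun _ ↦ le_rfl)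
      (boxOpens_mono hf (fun _ ↦ le_rfl) fun j ↦ ?_)
    · by_cases hj : j = i
      · subst hj; simpa using hac.le
      · simp [hj]
    · by_cases hj : j = i
      · subst hj; simpa using hdb.le
      · simp [hj]

theorem update_lt_update {a b : Fin n → ℝ} (hab : ∀ j, a j < b j) (i : Fin n) {c d : ℝ}
    (hcd : c < d) (j : Fin n) : Function.update a i c j < Function.update b i d j := by
  by_cases hj : j = i
  · subst hj; simpa using hcd
  · simpa [hj] using hab j

theorem exists_boxOpens_le (x : Fin n → ℝ) {W : Opens X} (hW : f x ∈ W) :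
    ∃ ε > 0, ∀ a b : Fin n → ℝ, (∀ i, x i - ε < a i) → (∀ i, b i < x i + ε) →
      boxOpens hf a b ≤ W := by
  obtain ⟨ε, hε, h⟩ := Metric.isOpen_iff.1 (W.isOpen.preimage hf.continuous) x hW
  refine ⟨ε, hε, fun a b ha hb ↦ ?_⟩
  rintro _ ⟨y, hy, rfl⟩
  refine h ?_
  rw [Metric.mem_ball, dist_pi_lt_iff hε]
  intro i
  rw [Real.dist_eq, abs_lt]
  obtain ⟨h1, h2⟩ := hy i trivial
  constructor <;> linarith [ha i, hb i]

/-- The exhaustion of the image of `ℝⁿ` by the images of the cubes `(-m-1, m+1)ⁿ`. -/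
def cubeOpens (m : ℕ) : Opens X := boxOpens hf (fun _ ↦ -(m + 1 : ℝ)) (fun _ ↦ (m + 1 : ℝ))

theorem cubeOpens_mono : Monotone (cubeOpens hf) := by
  intro m k h
  have : (m : ℝ) ≤ k := by exact_mod_cast h
  exact boxOpens_mono hf (fun _ ↦ by linarith) (fun _ ↦ by linarith)

theorem rangeOpens_le_iSup_cubeOpens : rangeOpens hf ≤ ⨆ m, cubeOpens hf m := by
  rintro _ ⟨x, rfl⟩
  obtain ⟨m, hm⟩ := exists_nat_gt ‖x‖
  refine Opens.mem_iSup.2 ⟨m, (apply_mem_boxOpens hf).2 fun i ↦ ?_⟩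
  have := (norm_le_pi_norm x i).trans_lt hm
  rw [Real.norm_eq_abs, abs_lt] at this
  constructor <;> linarith

theorem exists_isOpenEmbedding_range_eq_box {a b : Fin n → ℝ} (hab : ∀ i, a i < b i) :
    ∃ g : (Fin n → ℝ) → X, ∃ hg : Topology.IsOpenEmbedding g,
      rangeOpens hg = boxOpens hf a b := by
  let e := OpenPartialHomeomorph.pi fun i ↦
    OpenPartialHomeomorph.univBall (E := ℝ) ((a i + b i) / 2 : ℝ) ((b i - a i) / 2)
  have he : e.source = Set.univ := by simp [e]
  have ht : e.target = Set.univ.pi fun i ↦ Set.Ioo (a i) (b i) := by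
    change (Set.univ.pi fun i ↦ (OpenPartialHomeomorph.univBall (E := ℝ)
      ((a i + b i) / 2 : ℝ) ((b i - a i) / 2)).target) = _
    congr 1
    funext i
    rw [OpenPartialHomeomorph.univBall_target _ (by linarith [hab i]), Real.ball_eq_Ioo]
    congr 1 <;> ring
  refine ⟨f ∘ e, hf.comp (e.isOpenEmbedding he), Opens.ext ?_⟩
  change Set.range (f ∘ e) = f '' _
  rw [Set.range_comp, ← ht, ← e.image_source_eq_target, he, Set.image_univ]

theorem cubeOpens_isPreconnected (m : ℕ) : IsPreconnected (cubeOpens hf m : Set X) :=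
  boxOpens_isPreconnected hf _ _

theorem rangeOpens_isPreconnected : IsPreconnected (rangeOpens hf : Set X) :=
  isPreconnected_range hf.continuous

end Boxes

/-- A cochain complex of flasque sheaves of `A`-modules on `X`, exact in positive degrees,
described by its modules of sections. -/
structure FlasqueComplex (X : Type) [TopologicalSpace X] (A : Type) [CommRing A] where
  /-- The sections of the degree `q` term over an open set. -/
  sec : ℕ → Opens X → ModuleCat.{0} A
  /-- The restriction maps. -/
  res (q : ℕ) {V W : Opens X} (h : W ≤ V) : sec q V →ₗ[A] sec q W
  res_res (q : ℕ) {V W T : Opens X} (h : W ≤ V) (h' : T ≤ W) (s : sec q V) :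
    res q h' (res q h s) = res q (h'.trans h) s
  res_self (q : ℕ) {V : Opens X} (s : sec q V) : res q le_rfl s = s
  /-- The differentials. -/
  d (q : ℕ) (W : Opens X) : sec q W →ₗ[A] sec (q + 1) W
  d_res (q : ℕ) {V W : Opens X} (h : W ≤ V) (s : sec q V) : d q W (res q h s) = res _ h (d q V s)
  d_d (q : ℕ) (W : Opens X) (s : sec q W) : d (q + 1) W (d q W s) = 0
  glue (q : ℕ) {ι : Type} (U : ι → Opens X) (W : Opens X) (hU : ∀ i, U i ≤ W) (hW : W ≤ ⨆ i, U i)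
    (s : ∀ i, sec q (U i))
    (hs : ∀ i j, res q (inf_le_left : U i ⊓ U j ≤ U i) (s i) =
      res q (inf_le_right : U i ⊓ U j ≤ U j) (s j)) :
    ∃ t : sec q W, ∀ i, res q (hU i) t = s i
  eq_of_locally_eq (q : ℕ) {ι : Type} (U : ι → Opens X) (W : Opens X) (hU : ∀ i, U i ≤ W)
    (hW : W ≤ ⨆ i, U i) (s t : sec q W) (h : ∀ i, res q (hU i) s = res q (hU i) t) : s = t
  flasque (q : ℕ) {V W : Opens X} (h : W ≤ V) : Function.Surjective (res q h)
  exact (q : ℕ) {W : Opens X} (s : sec (q + 1) W) (hs : d (q + 1) W s = 0) (x : X) (hx : x ∈ W) :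
    ∃ (V : Opens X) (h : V ≤ W), x ∈ V ∧ ∃ t : sec q V, d q V t = res _ h s

namespace FlasqueComplex

variable {X : Type} [TopologicalSpace X] {A : Type} [CommRing A] (K : FlasqueComplex X A)

theorem eq_zero_of_locally_eq_zero (q : ℕ) {W : Opens X} (s : K.sec q W)
    (h : ∀ x ∈ W, ∃ (V : Opens X) (hV : V ≤ W), x ∈ V ∧ K.res q hV s = 0) : s = 0 := by
  choose V hV hx hs using h
  refine K.eq_of_locally_eq q (fun x : {x // x ∈ W} ↦ V x.1 x.2) W (fun x ↦ hV _ _)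
    (fun x hx' ↦ Opens.mem_iSup.2 ⟨⟨x, hx'⟩, hx x hx'⟩) s 0 fun x ↦ ?_
  rw [hs, map_zero]

theorem glue_pair (q : ℕ) {V₁ V₂ W : Opens X} (h₁ : V₁ ≤ W) (h₂ : V₂ ≤ W) (hW : W ≤ V₁ ⊔ V₂)
    (s₁ : K.sec q V₁) (s₂ : K.sec q V₂)
    (h : K.res q (inf_le_left : V₁ ⊓ V₂ ≤ V₁) s₁ = K.res q inf_le_right s₂) :
    ∃ t : K.sec q W, K.res q h₁ t = s₁ ∧ K.res q h₂ t = s₂ := by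
  have h' : K.res q (inf_le_left : V₂ ⊓ V₁ ≤ V₂) s₂ = K.res q inf_le_right s₁ := by
    have := congrArg (K.res q (inf_comm V₂ V₁).le) h
    simpa only [K.res_res] using this.symm
  obtain ⟨t, ht⟩ := K.glue q (fun b : Bool ↦ cond b V₁ V₂) W (by rintro (_ | _) <;> assumption)
    (hW.trans (sup_le (le_iSup (fun b : Bool ↦ cond b V₁ V₂) true)
      (le_iSup (fun b : Bool ↦ cond b V₁ V₂) false)))
    (fun b ↦ Bool.rec (motive := fun b ↦ K.sec q (cond b V₁ V₂)) s₂ s₁ b)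
    (by rintro (_ | _) (_ | _) <;> first | rfl | assumption)
  exact ⟨t, ht true, ht false⟩

theorem eq_of_eq_pair (q : ℕ) {V₁ V₂ W : Opens X} (h₁ : V₁ ≤ W) (h₂ : V₂ ≤ W) (hW : W ≤ V₁ ⊔ V₂)
    (s t : K.sec q W) (e₁ : K.res q h₁ s = K.res q h₁ t) (e₂ : K.res q h₂ s = K.res q h₂ t) :
    s = t := by
  refine K.eq_of_locally_eq q (fun b : Bool ↦ cond b V₁ V₂) W
    (by rintro (_ | _) <;> assumption)
    (hW.trans (sup_le (le_iSup (fun b : Bool ↦ cond b V₁ V₂) true)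
      (le_iSup (fun b : Bool ↦ cond b V₁ V₂) false))) s t ?_
  rintro (_ | _) <;> assumption

section LocallyConstant

/-- The kernel of the first differential is locally constant with finitely generated stalks. -/
def IsLocallyConstant : Prop :=
  ∀ x : X, ∃ N : Opens X, x ∈ N ∧
    (∀ y ∈ N, ∀ t : K.sec 0 N, K.d 0 N t = 0 →
      (∃ (V : Opens X) (h : V ≤ N), y ∈ V ∧ K.res 0 h t = 0) → t = 0) ∧
    (∀ y ∈ N, ∀ (V : Opens X) (s : K.sec 0 V), y ∈ V → K.d 0 V s = 0 →
      ∃ t : K.sec 0 N, K.d 0 N t = 0 ∧ ∃ (W : Opens X) (h : W ≤ V) (h' : W ≤ N), y ∈ W ∧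
        K.res 0 h' t = K.res 0 h s) ∧
    (LinearMap.ker (K.d 0 N)).FG

variable {K}

theorem IsLocallyConstant.eq_zero (hK : K.IsLocallyConstant) {W : Opens X}
    (hW : IsPreconnected (W : Set X)) (s : K.sec 0 W) (hs : K.d 0 W s = 0) {x : X} {V : Opens X} (hV : V ≤ W) (hx : x ∈ V) (h0 : K.res 0 hV s = 0) :
    s = 0 := by
  let Z : Set X := {y | ∃ (V : Opens X) (hV : V ≤ W), y ∈ V ∧ K.res 0 hV s = 0}
  let Z' : Set X := {y | ∃ V : Opens X, V ≤ W ∧ y ∈ V ∧ Disjoint (V : Set X) Z}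
  have hZ : IsOpen Z := isOpen_iff_forall_mem_open.2 fun y ⟨V, hV, hy, e⟩ ↦
    ⟨V, fun z hz ↦ ⟨V, hV, hz, e⟩, V.isOpen, hy⟩
  have hZ' : IsOpen Z' := isOpen_iff_forall_mem_open.2 fun y ⟨V, hV, hy, e⟩ ↦
    ⟨V, fun z hz ↦ ⟨V, hV, hz, e⟩, V.isOpen, hy⟩
  have hd : Disjoint Z Z' := Set.disjoint_left.2 fun y hy ⟨V, hV, hyV, e⟩ ↦
    Set.disjoint_left.1 e hyV hy
  have hcov : (W : Set X) ⊆ Z ∪ Z' := by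
    intro y hy
    obtain ⟨N, hyN, hinj, hsurj, -⟩ := hK y
    obtain ⟨t, ht, T, hTW, hTN, hyT, e⟩ := hsurj y hyN W s hy hs
    by_cases h : Disjoint (T : Set X) Z
    · exact Or.inr ⟨T, hTW, hyT, h⟩
    · obtain ⟨z, hzT, V', hV', hz, e'⟩ := Set.not_disjoint_iff.1 h
      have : t = 0 := by
        refine hinj z (hTN hzT) t ht ⟨T ⊓ V', inf_le_left.trans hTN, ⟨hzT, hz⟩, ?_⟩
        rw [← K.res_res 0 hTN inf_le_left, e, K.res_res, ← K.res_res 0 hV' inf_le_right, e',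
          map_zero]
      refine Or.inl ⟨T, hTW, hyT, ?_⟩
      rw [← e, this, map_zero]
  have := hW.subset_left_of_subset_union hZ hZ' hd hcov ⟨x, hV hx, V, hV, hx, h0⟩
  exact K.eq_zero_of_locally_eq_zero 0 s fun y hy ↦ this hy

theorem IsLocallyConstant.eq_of_eq (hK : K.IsLocallyConstant) {W : Opens X}
    (hW : IsPreconnected (W : Set X))
    (s t : K.sec 0 W) (hs : K.d 0 W s = 0) (ht : K.d 0 W t = 0) {x : X} {V : Opens X} (hV : V ≤ W)
    (hx : x ∈ V) (h0 : K.res 0 hV s = K.res 0 hV t) : s = t :=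
  sub_eq_zero.1 <| hK.eq_zero hW (s - t) (by rw [map_sub, hs, ht, sub_zero]) hV hx
    (by rw [map_sub, h0, sub_self])

variable {n : ℕ} {f : (Fin n → ℝ) → X} (hf : Topology.IsOpenEmbedding f)

theorem IsLocallyConstant.exists_extension_box (hK : K.IsLocallyConstant) {a b : Fin n → ℝ}
    (hab : ∀ i, a i < b i) :
    ∀ x ∈ boxOpens hf a b, ∀ (V : Opens X) (s : K.sec 0 V), x ∈ V → K.d 0 V s = 0 →
      ∃ t : K.sec 0 (boxOpens hf a b), K.d 0 _ t = 0 ∧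
        ∃ (W : Opens X) (h : W ≤ V) (h' : W ≤ boxOpens hf a b), x ∈ W ∧
          K.res 0 h' t = K.res 0 h s := by
  revert hab
  revert a b
  apply box_induction
  · intro y
    obtain ⟨N, hyN, -, hsurj, -⟩ := hK (f y)
    obtain ⟨ε, hε, hbox⟩ := exists_boxOpens_le hf y hyN
    refine ⟨ε, hε, fun a b _ ha hb x hx V s hxV hs ↦ ?_⟩
    have hle := hbox a b ha hb
    obtain ⟨t, ht, W, hWV, hWN, hxW, e⟩ := hsurj x (hle hx) V s hxV hs
    refine ⟨K.res 0 hle t, by rw [K.d_res, ht, map_zero], W ⊓ boxOpens hf a b,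
      inf_le_left.trans hWV, inf_le_right, ⟨hxW, hx⟩, ?_⟩
    rw [K.res_res, ← K.res_res 0 hWN inf_le_left, e, K.res_res]
  · intro a b i c d hab hac hcd hdb h₁ h₂ x hx V s hxV hs
    set B₁ := boxOpens hf a (Function.update b i d)
    set B₂ := boxOpens hf (Function.update a i c) b
    have hinf : B₁ ⊓ B₂ = _ := boxOpens_inf hf hac hdb
    have hconn : IsPreconnected ((B₁ ⊓ B₂ : Opens X) : Set X) :=
      hinf ▸ boxOpens_isPreconnected hf _ _
    obtain ⟨y, hy⟩ : ∃ y, y ∈ B₁ ⊓ B₂ :=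
      hinf ▸ boxOpens_nonempty hf (update_lt_update hab i hcd)
    have hle : boxOpens hf a b ≤ B₁ ⊔ B₂ := boxOpens_le_sup hf hcd
    have hle₁ : B₁ ≤ boxOpens hf a b := boxOpens_mono hf (fun _ ↦ le_rfl) fun j ↦ by
      by_cases hj : j = i
      · subst hj; simpa using hdb.le
      · simp [hj]
    have hle₂ : B₂ ≤ boxOpens hf a b := boxOpens_mono hf (fun j ↦ by
      by_cases hj : j = i
      · subst hj; simpa using hac.le
      · simp [hj]) fun _ ↦ le_rfl
    have key : ∀ (t₁ : K.sec 0 B₁) (t₂ : K.sec 0 B₂), K.d 0 _ t₁ = 0 → K.d 0 _ t₂ = 0 →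
        (∃ (W : Opens X) (hW₁ : W ≤ B₁) (hW₂ : W ≤ B₂), y ∈ W ∧
          K.res 0 hW₁ t₁ = K.res 0 hW₂ t₂) →
        ∃ t : K.sec 0 (boxOpens hf a b), K.d 0 _ t = 0 ∧ K.res 0 hle₁ t = t₁ ∧
          K.res 0 hle₂ t = t₂ := by
      rintro t₁ t₂ ht₁ ht₂ ⟨W, hW₁, hW₂, hyW, e⟩
      obtain ⟨t, e₁, e₂⟩ := K.glue_pair 0 hle₁ hle₂ hle t₁ t₂
        (hK.eq_of_eq hconn _ _ (by rw [K.d_res, ht₁, map_zero]) (by rw [K.d_res, ht₂, map_zero])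
          (le_inf hW₁ hW₂) hyW (by rw [K.res_res, K.res_res, e]))
      refine ⟨t, K.eq_of_eq_pair _ hle₁ hle₂ hle _ _ ?_ ?_, e₁, e₂⟩
      · rw [← K.d_res, e₁, ht₁, map_zero]
      · rw [← K.d_res, e₂, ht₂, map_zero]
    rcases hle hx with hx₁ | hx₂
    · obtain ⟨t₁, ht₁, W, hWV, hWB, hxW, e⟩ := h₁ x hx₁ V s hxV hs
      obtain ⟨t₂, ht₂, W', hWV', hWB', hyW', e'⟩ := h₂ y hy.2 B₁ t₁ hy.1 ht₁
      obtain ⟨t, ht, et₁, -⟩ := key t₁ t₂ ht₁ ht₂ ⟨W', hWV', hWB', hyW', e'.symm⟩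
      refine ⟨t, ht, W, hWV, hWB.trans hle₁, hxW, ?_⟩
      rw [← e, ← et₁, K.res_res]
    · obtain ⟨t₂, ht₂, W, hWV, hWB, hxW, e⟩ := h₂ x hx₂ V s hxV hs
      obtain ⟨t₁, ht₁, W', hWV', hWB', hyW', e'⟩ := h₁ y hy.1 B₂ t₂ hy.2 ht₂
      obtain ⟨t, ht, -, et₂⟩ := key t₁ t₂ ht₁ ht₂ ⟨W', hWB', hWV', hyW', e'⟩
      refine ⟨t, ht, W, hWV, hWB.trans hle₂, hxW, ?_⟩
      rw [← e, ← et₂, K.res_res]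

theorem IsLocallyConstant.exists_extension (hK : K.IsLocallyConstant) {x : X} (hx : x ∈ rangeOpens hf) (V : Opens X)
    (s : K.sec 0 V) (hxV : x ∈ V) (hs : K.d 0 V s = 0) :
    ∃ t : K.sec 0 (rangeOpens hf), K.d 0 _ t = 0 ∧
      ∃ (W : Opens X) (h : W ≤ V) (h' : W ≤ rangeOpens hf), x ∈ W ∧
        K.res 0 h' t = K.res 0 h s := by
  obtain ⟨k, hk⟩ := Opens.mem_iSup.1 (rangeOpens_le_iSup_cubeOpens hf hx)
  have hxm : ∀ m, x ∈ cubeOpens hf (k + m) := fun m ↦ cubeOpens_mono hf (Nat.le_add_right k m) hk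
  have hcov : rangeOpens hf ≤ ⨆ m, cubeOpens hf (k + m) :=
    (rangeOpens_le_iSup_cubeOpens hf).trans <| iSup_le fun m ↦
      (cubeOpens_mono hf (Nat.le_add_left m k)).trans (le_iSup (fun m ↦ cubeOpens hf (k + m)) m)
  have hle : ∀ m, cubeOpens hf (k + m) ≤ rangeOpens hf := fun m ↦ boxOpens_le_range hf _ _
  have hcube : ∀ m : ℕ, ∀ _ : Fin n, -(m + 1 : ℝ) < m + 1 := fun m _ ↦ by
    have : (0 : ℝ) ≤ m := m.cast_nonneg
    linarith
  have hex : ∀ m, ∃ t : K.sec 0 (cubeOpens hf (k + m)), K.d 0 _ t = 0 ∧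
      ∃ (W : Opens X) (h : W ≤ V) (h' : W ≤ cubeOpens hf (k + m)), x ∈ W ∧
        K.res 0 h' t = K.res 0 h s :=
    fun m ↦ hK.exists_extension_box hf (hcube (k + m)) x (hxm m) V s hxV hs
  choose t ht W hWV hWB hxW e using hex
  obtain ⟨T, hT⟩ := K.glue 0 (fun m ↦ cubeOpens hf (k + m)) (rangeOpens hf) hle hcov t (by
    intro i j
    have hconn : IsPreconnected ((cubeOpens hf (k + i) ⊓ cubeOpens hf (k + j) : Opens X) :
        Set X) := by
      rcases le_total i j with h | h
      · rw [inf_eq_left.2 (cubeOpens_mono hf (by lia))]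
        exact cubeOpens_isPreconnected hf _
      · rw [inf_eq_right.2 (cubeOpens_mono hf (by lia))]
        exact cubeOpens_isPreconnected hf _
    refine hK.eq_of_eq hconn _ _ (by rw [K.d_res, ht, map_zero]) (by rw [K.d_res, ht, map_zero])
      (V := W i ⊓ W j) (inf_le_inf (hWB i) (hWB j)) ⟨hxW i, hxW j⟩ ?_
    rw [K.res_res, K.res_res, ← K.res_res 0 (hWB i) inf_le_left, e i,
      ← K.res_res 0 (hWB j) inf_le_right, e j, K.res_res, K.res_res])
  refine ⟨T, ?_, W 0, hWV 0, (hWB 0).trans (hle 0), hxW 0, ?_⟩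
  · refine K.eq_of_locally_eq _ (fun m ↦ cubeOpens hf (k + m)) (rangeOpens hf) hle hcov _ _
      fun m ↦ ?_
    rw [← K.d_res, hT, ht, map_zero]
  · rw [← e 0, ← hT 0, K.res_res]

theorem IsLocallyConstant.ker_d_fg [IsNoetherianRing A] (hK : K.IsLocallyConstant) :
    (LinearMap.ker (K.d 0 (rangeOpens hf))).FG := by
  obtain ⟨N, hN, -, hsurj, hfg⟩ := hK (f 0)
  obtain ⟨ε, hε, hbox⟩ := exists_boxOpens_le hf 0 hN
  set B := boxOpens hf (fun _ ↦ -(ε / 2)) (fun _ ↦ ε / 2)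
  have hBN : B ≤ N := hbox _ _ (fun _ ↦ by simp; linarith) (fun _ ↦ by simp; linarith)
  have hBR : B ≤ rangeOpens hf := boxOpens_le_range hf _ _
  have hB : IsPreconnected (B : Set X) := boxOpens_isPreconnected hf _ _
  have h0 : f 0 ∈ B := (apply_mem_boxOpens hf).2 fun _ ↦ by simp; linarith
  have hinj : LinearMap.ker (K.d 0 (rangeOpens hf)) ⊓ LinearMap.ker (K.res 0 hBR) = ⊥ := by
    rw [eq_bot_iff]
    rintro s ⟨hs, hs0⟩
    exact hK.eq_zero (rangeOpens_isPreconnected hf) s hs hBR h0 hs0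
  refine Submodule.fg_of_fg_map_of_fg_inf_ker (K.res 0 hBR) ?_ (hinj ▸ Submodule.fg_bot)
  refine Submodule.FG.of_le (hfg.map (K.res 0 hBN)) ?_
  rintro _ ⟨s, hs, rfl⟩
  obtain ⟨t, ht, W, hW, hWN, h0W, e⟩ := hsurj (f 0) hN _ s (hBR h0) hs
  refine ⟨t, ht, hK.eq_of_eq hB _ _ ?_ ?_ (V := W ⊓ B) inf_le_right ⟨h0W, h0⟩ ?_⟩
  · rw [K.d_res, ht, map_zero]
  · rw [K.d_res, LinearMap.mem_ker.1 hs, map_zero]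
  · rw [K.res_res, K.res_res, ← K.res_res 0 hWN inf_le_left, e, K.res_res]

end LocallyConstant

section Vanishing

variable {n : ℕ}

/-- If `q`-cocycles extend from boxes to the whole chart, then all `(q + 1)`-cocycles on the chart
are coboundaries. -/
theorem exists_primitive_of_extension {f : (Fin n → ℝ) → X} (hf : Topology.IsOpenEmbedding f)
    (q : ℕ)
    (hext : ∀ a b : Fin n → ℝ, (∀ i, a i < b i) → ∀ u : K.sec q (boxOpens hf a b), K.d q _ u = 0 →
      ∃ u' : K.sec q (rangeOpens hf), K.d q _ u' = 0 ∧ K.res q (boxOpens_le_range hf a b) u' = u)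
    (z : K.sec (q + 1) (rangeOpens hf)) (hz : K.d _ _ z = 0) : ∃ t, K.d q _ t = z := by
  have hbox : ∀ a b : Fin n → ℝ, (∀ i, a i < b i) →
      ∃ t, K.d q _ t = K.res _ (boxOpens_le_range hf a b) z := by
    apply box_induction
    · intro x
      obtain ⟨V, hV, hxV, t, ht⟩ := K.exact q z hz (f x) ⟨x, rfl⟩
      obtain ⟨ε, hε, hbox⟩ := exists_boxOpens_le hf x hxV
      refine ⟨ε, hε, fun a b _ ha hb ↦ ⟨K.res q (hbox a b ha hb) t, ?_⟩⟩
      rw [K.d_res, ht, K.res_res]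
    · intro a b i c d hab hac hcd hdb h₁ h₂
      set B₁ := boxOpens hf a (Function.update b i d)
      set B₂ := boxOpens hf (Function.update a i c) b
      obtain ⟨t₁, ht₁⟩ := h₁
      obtain ⟨t₂, ht₂⟩ := h₂
      have hinf : B₁ ⊓ B₂ = _ := boxOpens_inf hf hac hdb
      have hle : boxOpens hf a b ≤ B₁ ⊔ B₂ := boxOpens_le_sup hf hcd
      have hle₁ : B₁ ≤ boxOpens hf a b := boxOpens_mono hf (fun _ ↦ le_rfl) fun j ↦ by
        by_cases hj : j = i
        · subst hj; simpa using hdb.le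
        · simp [hj]
      have hle₂ : B₂ ≤ boxOpens hf a b := boxOpens_mono hf (fun j ↦ by
        by_cases hj : j = i
        · subst hj; simpa using hac.le
        · simp [hj]) fun _ ↦ le_rfl
      obtain ⟨u', hu', eu⟩ := hext _ _ (update_lt_update hab i hcd)
        (K.res q hinf.ge (K.res q inf_le_left t₁ - K.res q inf_le_right t₂)) (by
          rw [K.d_res, map_sub, K.d_res, K.d_res, ht₁, ht₂, K.res_res, K.res_res, sub_self,
            map_zero])
      have eu' := congrArg (K.res q hinf.le) eu
      rw [K.res_res, K.res_res, K.res_self] at eu'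
      obtain ⟨t, et₁, et₂⟩ := K.glue_pair q hle₁ hle₂ hle t₁
        (t₂ + K.res q (boxOpens_le_range hf _ _) u') (by
          rw [map_add, K.res_res, eu', add_sub_cancel])
      refine ⟨t, K.eq_of_eq_pair _ hle₁ hle₂ hle _ _ ?_ ?_⟩
      · rw [← K.d_res, et₁, ht₁, K.res_res]
      · rw [← K.d_res, et₂, map_add, ht₂, K.d_res, hu', map_zero, add_zero, K.res_res]
  have hcube : ∀ m : ℕ, ∀ _ : Fin n, -(m + 1 : ℝ) < m + 1 := fun m _ ↦ by
    have : (0 : ℝ) ≤ m := m.cast_nonneg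
    linarith
  have hle : ∀ m, cubeOpens hf m ≤ rangeOpens hf := fun m ↦ boxOpens_le_range hf _ _
  have hsucc : ∀ m, cubeOpens hf m ≤ cubeOpens hf (m + 1) :=
    fun m ↦ cubeOpens_mono hf m.le_succ
  have hbox' : ∀ m, ∃ t : K.sec q (cubeOpens hf m), K.d q _ t = K.res _ (hle m) z :=
    fun m ↦ hbox _ _ (hcube m)
  have hext' : ∀ m (u : K.sec q (cubeOpens hf m)), K.d q _ u = 0 →
      ∃ u', K.d q (rangeOpens hf) u' = 0 ∧ K.res q (hle m) u' = u :=
    fun m ↦ hext _ _ (hcube m)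
  let T : ℕ → Type := fun m ↦ {t : K.sec q (cubeOpens hf m) // K.d q _ t = K.res _ (hle m) z}
  have step : ∀ m (t : T m), ∃ t' : T (m + 1), K.res q (hsucc m) t'.1 = t.1 := by
    rintro m ⟨t, ht⟩
    obtain ⟨t', ht'⟩ := hbox' (m + 1)
    obtain ⟨u', hu', eu⟩ := hext' m (t - K.res q (hsucc m) t') (by
      rw [map_sub, ht, K.d_res, ht', K.res_res, sub_self])
    refine ⟨⟨t' + K.res q (hle (m + 1)) u', ?_⟩, ?_⟩
    · rw [map_add, K.d_res, hu', map_zero, add_zero, ht']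
    · change K.res q (hsucc m) (t' + _) = t
      rw [map_add, K.res_res, eu, add_sub_cancel]
  choose next hnext using step
  have t₀ : T 0 := ⟨_, (hbox' 0).choose_spec⟩
  let t : ∀ m, T m := fun m ↦ Nat.rec (motive := T) t₀ next m
  have ht : ∀ m, K.res q (hsucc m) (t (m + 1)).1 = (t m).1 := fun m ↦ hnext m (t m)
  have hcompat : ∀ m j, K.res q (cubeOpens_mono hf (Nat.le_add_right m j)) (t (m + j)).1 =
      (t m).1 := by
    intro m j
    induction j with
    | zero => exact K.res_self q _
    | succ j ih =>
      rw [← ih, ← ht (m + j), K.res_res]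
      rfl
  have hcompat' : ∀ {i j} (h : i ≤ j), K.res q (cubeOpens_mono hf h) (t j).1 = (t i).1 := by
    intro i j h
    obtain ⟨j, rfl⟩ := Nat.exists_eq_add_of_le h
    exact hcompat i j
  obtain ⟨s, hs⟩ := K.glue q (cubeOpens hf) (rangeOpens hf) hle (rangeOpens_le_iSup_cubeOpens hf)
    (fun m ↦ (t m).1) (by
      intro i j
      rcases le_total i j with h | h
      · rw [← hcompat' h, K.res_res]
      · rw [← hcompat' h, K.res_res])
  refine ⟨s, K.eq_of_locally_eq _ (cubeOpens hf) (rangeOpens hf) hle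
    (rangeOpens_le_iSup_cubeOpens hf) _ _ fun m ↦ ?_⟩
  rw [← K.d_res, hs, (t m).2]

/-- Positive degree cocycles on a chart are coboundaries. -/
theorem exists_primitive (hK : K.IsLocallyConstant) (q : ℕ) {f : (Fin n → ℝ) → X}
    (hf : Topology.IsOpenEmbedding f) (z : K.sec (q + 1) (rangeOpens hf)) (hz : K.d _ _ z = 0) :
    ∃ t, K.d q _ t = z := by
  induction q generalizing f with
  | zero =>
    refine K.exists_primitive_of_extension hf 0 (fun a b hab u hu ↦ ?_) z hz
    obtain ⟨x, hx⟩ := boxOpens_nonempty hf hab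
    obtain ⟨t, ht, W, hW, hW', hxW, e⟩ :=
      hK.exists_extension hf (boxOpens_le_range hf a b hx) _ u hx hu
    refine ⟨t, ht, hK.eq_of_eq (boxOpens_isPreconnected hf a b) _ _
      (by rw [K.d_res, ht, map_zero]) hu hW hxW ?_⟩
    rw [K.res_res, e]
  | succ q ih =>
    refine K.exists_primitive_of_extension hf (q + 1) (fun a b hab u hu ↦ ?_) z hz
    obtain ⟨g, hg, hgb⟩ := exists_isOpenEmbedding_range_eq_box hf hab
    obtain ⟨t, ht⟩ := ih hg (K.res _ hgb.le u) (by rw [K.d_res, hu, map_zero])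
    obtain ⟨t', ht'⟩ := K.flasque q (hgb.le.trans (boxOpens_le_range hf a b)) t
    refine ⟨K.d q _ t', K.d_d _ _ _, ?_⟩
    have := congrArg (K.res (q + 1) hgb.ge) ht
    rw [K.res_res, K.res_self, ← ht', K.d_res, K.res_res] at this
    exact this

end Vanishing

end FlasqueComplex

theorem Submodule.fg_of_correspondence {A L M N : Type*} [Ring A] [IsNoetherianRing A]
    [AddCommGroup L] [AddCommGroup M] [AddCommGroup N] [Module A L] [Module A M] [Module A N]
    (α : L →ₗ[A] M) (β : L →ₗ[A] N) {S : Submodule A M} {T : Submodule A N} (hT : T.FG)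
    (hβ : ∀ l, β l ∈ T) (hker : ∀ l, β l = 0 → α l = 0) (hS : ∀ x ∈ S, ∃ l, α l = x) : S.FG := by
  have hR : (LinearMap.range (β.prod α)).FG := by
    refine Submodule.fg_of_fg_map_of_fg_inf_ker (LinearMap.fst A N M) (hT.of_le ?_) ?_
    · rintro _ ⟨_, ⟨l, rfl⟩, rfl⟩
      exact hβ l
    · convert Submodule.fg_bot
      rw [eq_bot_iff]
      rintro _ ⟨⟨l, rfl⟩, hl⟩
      have : β l = 0 := hl
      simp [this, hker l this]
  refine (hR.map (LinearMap.snd A N M)).of_le fun x hx ↦ ?_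
  obtain ⟨l, rfl⟩ := hS x hx
  exact ⟨_, ⟨l, rfl⟩, rfl⟩

namespace FlasqueComplex

section FiniteCohomology

variable {X : Type} [TopologicalSpace X] {A : Type} [CommRing A] (K : FlasqueComplex X A)

/-- The coboundaries over an open set. -/
def coboundaries : ∀ (p : ℕ) (W : Opens X), Submodule A (K.sec p W)
  | 0, _ => ⊥
  | p + 1, W => LinearMap.range (K.d p W)

/-- The cohomology over an open set, as a submodule of the sections modulo coboundaries. -/
def cohomology (p : ℕ) (W : Opens X) : Submodule A (K.sec p W ⧸ K.coboundaries p W) :=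
  (LinearMap.ker (K.d p W)).map (K.coboundaries p W).mkQ

variable {K}

theorem d_eq_zero_of_mem_coboundaries {p : ℕ} {W : Opens X} {s : K.sec p W}
    (hs : s ∈ K.coboundaries p W) : K.d p W s = 0 := by
  cases p with
  | zero => rw [(Submodule.mem_bot A).1 hs, map_zero]
  | succ p =>
    obtain ⟨t, rfl⟩ := hs
    exact K.d_d p W t

theorem res_mem_coboundaries {p : ℕ} {V W : Opens X} (h : W ≤ V) {s : K.sec p V}
    (hs : s ∈ K.coboundaries p V) : K.res p h s ∈ K.coboundaries p W := by
  cases p with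
  | zero =>
    rw [(Submodule.mem_bot A).1 hs, map_zero]
    exact zero_mem _
  | succ p =>
    obtain ⟨t, rfl⟩ := hs
    exact ⟨K.res p h t, K.d_res p h t⟩

theorem exists_mem_coboundaries_res_eq {p : ℕ} {V W : Opens X} (h : W ≤ V) {s : K.sec p W}
    (hs : s ∈ K.coboundaries p W) : ∃ e ∈ K.coboundaries p V, K.res p h e = s := by
  cases p with
  | zero => exact ⟨0, zero_mem _, by rw [(Submodule.mem_bot A).1 hs, map_zero]⟩
  | succ p =>
    obtain ⟨t, rfl⟩ := hs
    obtain ⟨t, rfl⟩ := K.flasque p h t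
    exact ⟨K.d p V t, ⟨t, rfl⟩, (K.d_res p h t).symm⟩

theorem mkQ_mem_cohomology {p : ℕ} {W : Opens X} {s : K.sec p W} (hs : K.d p W s = 0) :
    (K.coboundaries p W).mkQ s ∈ K.cohomology p W := ⟨s, hs, rfl⟩

variable (K) in
/-- The restriction maps on sections modulo coboundaries. -/
def quotRes (p : ℕ) {V W : Opens X} (h : W ≤ V) :
    (K.sec p V ⧸ K.coboundaries p V) →ₗ[A] (K.sec p W ⧸ K.coboundaries p W) :=
  Submodule.mapQ _ _ (K.res p h) fun _ ↦ res_mem_coboundaries h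

theorem quotRes_mkQ_eq_zero {p : ℕ} {V W : Opens X} (h : W ≤ V) {s : K.sec p V} :
    K.quotRes p h ((K.coboundaries p V).mkQ s) = 0 ↔ K.res p h s ∈ K.coboundaries p W := by
  rw [quotRes, Submodule.mkQ_apply, Submodule.mapQ_apply, Submodule.Quotient.mk_eq_zero]

theorem map_quotRes_cohomology_le (p : ℕ) {V W : Opens X} (h : W ≤ V) :
    (K.cohomology p V).map (K.quotRes p h) ≤ K.cohomology p W := by
  rintro _ ⟨_, ⟨s, hs, rfl⟩, rfl⟩
  exact ⟨K.res p h s, (K.d_res p h s).trans (by rw [LinearMap.mem_ker.1 hs, map_zero]), rfl⟩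

theorem cohomology_inf_ker_quotRes_fg [IsNoetherianRing A] {V₁ V₂ : Opens X}
    (h : ∀ p, (K.cohomology p (V₁ ⊓ V₂)).FG) (p : ℕ) :
    (K.cohomology p (V₁ ⊔ V₂) ⊓ LinearMap.ker ((K.quotRes p (le_sup_left : V₁ ≤ V₁ ⊔ V₂)).prod
      (K.quotRes p (le_sup_right : V₂ ≤ V₁ ⊔ V₂)))).FG := by
  cases p with
  | zero =>
    convert Submodule.fg_bot
    rw [eq_bot_iff]
    rintro _ ⟨⟨s, -, rfl⟩, hs⟩
    obtain ⟨h₁, h₂⟩ := Prod.mk_eq_zero.1 (LinearMap.mem_ker.1 hs)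
    rw [quotRes_mkQ_eq_zero] at h₁ h₂
    have : s = 0 := K.eq_of_eq_pair 0 le_sup_left le_sup_right le_rfl s 0
      (by rw [map_zero]; exact h₁) (by rw [map_zero]; exact h₂)
    rw [this, map_zero]
    exact zero_mem _
  | succ p =>
    let L : Submodule A (K.sec p V₁ × K.sec p V₂ × K.sec (p + 1) (V₁ ⊔ V₂)) :=
      LinearMap.eqLocus (K.d p V₁ ∘ₗ LinearMap.fst A _ _)
        (K.res (p + 1) le_sup_left ∘ₗ LinearMap.snd A _ _ ∘ₗ LinearMap.snd A _ _) ⊓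
      LinearMap.eqLocus (K.d p V₂ ∘ₗ LinearMap.fst A _ _ ∘ₗ LinearMap.snd A _ _)
        (K.res (p + 1) le_sup_right ∘ₗ LinearMap.snd A _ _ ∘ₗ LinearMap.snd A _ _)
    let α : L →ₗ[A] (K.sec (p + 1) (V₁ ⊔ V₂) ⧸ K.coboundaries (p + 1) (V₁ ⊔ V₂)) :=
      (K.coboundaries _ _).mkQ ∘ₗ LinearMap.snd A _ _ ∘ₗ LinearMap.snd A _ _ ∘ₗ L.subtype
    let β : L →ₗ[A] (K.sec p (V₁ ⊓ V₂) ⧸ K.coboundaries p (V₁ ⊓ V₂)) :=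
      (K.coboundaries _ _).mkQ ∘ₗ (K.res p inf_le_left ∘ₗ LinearMap.fst A _ _ -
        K.res p inf_le_right ∘ₗ LinearMap.fst A _ _ ∘ₗ LinearMap.snd A _ _) ∘ₗ L.subtype
    refine Submodule.fg_of_correspondence α β (h p) ?_ ?_ ?_
    · rintro ⟨⟨a, b, z⟩, ha, hb⟩
      replace ha : K.d p V₁ a = K.res (p + 1) le_sup_left z := ha
      replace hb : K.d p V₂ b = K.res (p + 1) le_sup_right z := hb
      refine mkQ_mem_cohomology (s := K.res p inf_le_left a - K.res p inf_le_right b) ?_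
      rw [map_sub, K.d_res, K.d_res, ha, hb, K.res_res, K.res_res, sub_self]
    · rintro ⟨⟨a, b, z⟩, ha, hb⟩ h0
      replace ha : K.d p V₁ a = K.res (p + 1) le_sup_left z := ha
      replace hb : K.d p V₂ b = K.res (p + 1) le_sup_right z := hb
      replace h0 : K.res p (inf_le_left : V₁ ⊓ V₂ ≤ V₁) a - K.res p inf_le_right b ∈
        K.coboundaries p (V₁ ⊓ V₂) := (Submodule.Quotient.mk_eq_zero _).1 h0
      obtain ⟨e, he, h0⟩ := exists_mem_coboundaries_res_eq inf_le_left h0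
      obtain ⟨c, hc₁, hc₂⟩ := K.glue_pair p le_sup_left le_sup_right le_rfl (a - e) b
        (by rw [map_sub, h0, sub_sub_cancel])
      refine (Submodule.Quotient.mk_eq_zero _).2 ⟨c, ?_⟩
      refine K.eq_of_eq_pair _ le_sup_left le_sup_right le_rfl _ _ ?_ ?_
      · rw [← K.d_res, hc₁, map_sub, d_eq_zero_of_mem_coboundaries he, sub_zero, ha]
        rfl
      · rw [← K.d_res, hc₂, hb]
        rfl
    · rintro _ ⟨⟨z, hz, rfl⟩, h0⟩
      obtain ⟨h₁, h₂⟩ := Prod.mk_eq_zero.1 (LinearMap.mem_ker.1 h0)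
      rw [quotRes_mkQ_eq_zero] at h₁ h₂
      obtain ⟨a, ha⟩ := h₁
      obtain ⟨b, hb⟩ := h₂
      exact ⟨⟨⟨a, b, z⟩, ha, hb⟩, rfl⟩

/-- Finite generation of cohomology via the Mayer-Vietoris sequence. -/
theorem cohomology_sup_fg [IsNoetherianRing A] {V₁ V₂ : Opens X}
    (h₁ : ∀ p, (K.cohomology p V₁).FG) (h₂ : ∀ p, (K.cohomology p V₂).FG)
    (h : ∀ p, (K.cohomology p (V₁ ⊓ V₂)).FG) (p : ℕ) : (K.cohomology p (V₁ ⊔ V₂)).FG := by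
  refine Submodule.fg_of_fg_map_of_fg_inf_ker _ (((h₁ p).prod (h₂ p)).of_le ?_)
    (cohomology_inf_ker_quotRes_fg h p)
  rintro _ ⟨x, hx, rfl⟩
  exact ⟨map_quotRes_cohomology_le p _ ⟨x, hx, rfl⟩, map_quotRes_cohomology_le p _ ⟨x, hx, rfl⟩⟩

theorem cohomology_bot_fg (p : ℕ) : (K.cohomology p ⊥).FG := by
  have : K.cohomology p ⊥ = ⊥ := by
    rw [eq_bot_iff]
    rintro _ ⟨s, -, rfl⟩
    rw [K.eq_of_locally_eq p (fun i : Empty ↦ i.elim) ⊥ (fun i ↦ i.elim) bot_le s 0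
      (fun i ↦ i.elim), map_zero]
    exact zero_mem _
  exact this ▸ Submodule.fg_bot

theorem IsLocallyConstant.cohomology_rangeOpens_fg [IsNoetherianRing A] (hK : K.IsLocallyConstant)
    {n : ℕ} {f : (Fin n → ℝ) → X} (hf : Topology.IsOpenEmbedding f) (p : ℕ) :
    (K.cohomology p (rangeOpens hf)).FG := by
  cases p with
  | zero => exact (hK.ker_d_fg hf).map _
  | succ p =>
    have : K.cohomology (p + 1) (rangeOpens hf) = ⊥ := by
      rw [eq_bot_iff]
      rintro _ ⟨s, hs, rfl⟩
      exact (Submodule.Quotient.mk_eq_zero _).2 (K.exists_primitive hK p hf s hs)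
    exact this ▸ Submodule.fg_bot

theorem cohomology_sup_inf_fg [IsNoetherianRing A] {ι : Type} [DecidableEq ι] (U : ι → Opens X)
    (hU : ∀ s : Finset ι, s.Nonempty → ∀ p, (K.cohomology p (s.inf U)).FG) (s : Finset ι) :
    ∀ t : Finset ι, t.Nonempty → ∀ p, (K.cohomology p (s.sup U ⊓ t.inf U)).FG := by
  induction s using Finset.induction_on with
  | empty =>
    intro t _ p
    rw [Finset.sup_empty, bot_inf_eq]
    exact cohomology_bot_fg p
  | insert j s _ ih =>
    intro t ht
    have e : U j ⊓ t.inf U = (insert j t).inf U := (Finset.inf_insert).symm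
    rw [Finset.sup_insert, inf_sup_right, e]
    refine cohomology_sup_fg (hU _ (Finset.insert_nonempty j t)) (ih t ht) ?_
    have e' : (insert j t).inf U ⊓ (s.sup U ⊓ t.inf U) = s.sup U ⊓ (insert j t).inf U := by
      rw [← e, inf_left_comm, inf_assoc, inf_idem]
    rw [e']
    exact ih _ (Finset.insert_nonempty j t)

theorem cohomology_sup_fg_of_inf_fg [IsNoetherianRing A] {ι : Type} [DecidableEq ι]
    (U : ι → Opens X) (hU : ∀ s : Finset ι, s.Nonempty → ∀ p, (K.cohomology p (s.inf U)).FG)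
    (s : Finset ι) (p : ℕ) : (K.cohomology p (s.sup U)).FG := by
  induction s using Finset.induction_on generalizing p with
  | empty => exact cohomology_bot_fg p
  | insert j s _ ih =>
    have e : ({j} : Finset ι).inf U = U j := Finset.inf_singleton
    rw [Finset.sup_insert]
    refine cohomology_sup_fg ?_ ih ?_ p
    · exact e ▸ hU {j} (Finset.singleton_nonempty j)
    · rw [inf_comm, ← e]
      exact cohomology_sup_inf_fg U hU s {j} (Finset.singleton_nonempty j)

end FiniteCohomology

end FlasqueComplex

theorem HasFiniteGoodCover.cohomology_top_fg {X : TopCat} {n : ℕ} (hX : HasFiniteGoodCover X n)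
    {A : Type} [CommRing A] [IsNoetherianRing A] {K : FlasqueComplex X A}
    (hK : K.IsLocallyConstant) (p : ℕ) : (K.cohomology p ⊤).FG := by
  classical
  obtain ⟨ι, hι, U, hU, hs⟩ := hX
  have := Fintype.ofFinite ι
  rw [← hU, ← Finset.sup_univ_eq_iSup]
  refine FlasqueComplex.cohomology_sup_fg_of_inf_fg U (fun s hne p ↦ ?_) _ p
  rcases hs s hne with h | ⟨⟨e⟩⟩
  · rw [h]
    exact FlasqueComplex.cohomology_bot_fg p
  · let e' := (EuclideanSpace.equiv (Fin n) ℝ).toHomeomorph.symm.trans e.symm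
    have hf : Topology.IsOpenEmbedding (Subtype.val ∘ e' : (Fin n → ℝ) → X) :=
      (s.inf U).isOpen.isOpenEmbedding_subtypeVal.comp e'.isOpenEmbedding
    have : rangeOpens hf = s.inf U := by
      refine Opens.ext ?_
      change Set.range (Subtype.val ∘ e') = _
      rw [Set.range_comp, e'.surjective.range_eq, Set.image_univ, Subtype.range_coe]
    exact this ▸ hK.cohomology_rangeOpens_fg hf p

section Resolution

variable {X : TopCat.{0}} {A : Type} [CommRing A]

/-- Restriction maps of injective sheaves are surjective. -/
theorem surjective_map_of_injective (I : Sheaf (Opens.grothendieckTopology X) (ModuleCat.{0} A))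
    [Injective I] {V W : Opens X} (h : W ≤ V) :
    Function.Surjective (I.obj.map (homOfLE h).op).hom := by
  intro s
  have : Injective I.obj := Injective.injective_of_adjoint
    (sheafificationAdjunction (Opens.grothendieckTopology X) (ModuleCat.{0} A)) I
  let adj := (ModuleCat.adj A).whiskerRight (Opens X)ᵒᵖ
  let φ := ((Functor.whiskeringRight (Opens X)ᵒᵖ _ _).obj (ModuleCat.free A)).map
    (yoneda.map (homOfLE h))
  have hφ : Mono φ := by
    have : ∀ T, Mono (φ.app T) := fun T ↦ by
      rw [ModuleCat.mono_iff_injective]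
      exact Finsupp.mapDomain_injective fun a b _ ↦
        (inferInstance : Subsingleton (T.unop ⟶ W)).elim a b
    exact NatTrans.mono_of_mono_app φ
  let ψ := (adj.homEquiv _ I.obj).symm
    ((yonedaEquiv (F := I.obj ⋙ CategoryTheory.forget (ModuleCat.{0} A))).symm s)
  refine ⟨yonedaEquiv (F := I.obj ⋙ CategoryTheory.forget (ModuleCat.{0} A))
    (adj.homEquiv _ _ (Injective.factorThru ψ φ)), ?_⟩
  refine (yonedaEquiv_naturality (F := I.obj ⋙ CategoryTheory.forget (ModuleCat.{0} A))
    (adj.homEquiv _ _ (Injective.factorThru ψ φ)) (homOfLE h)).trans ?_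
  rw [← Adjunction.homEquiv_naturality_left, Injective.comp_factorThru, Equiv.apply_symm_apply,
    Equiv.apply_symm_apply]

/-- Sections of a left exact sequence of sheaves. -/
theorem exists_app_eq_of_exact
    {S : ShortComplex (Sheaf (Opens.grothendieckTopology X) (ModuleCat.{0} A))} (hS : S.Exact)
    [Mono S.f] (W : Opens X) :
    Function.Injective (S.f.hom.app (op W)).hom ∧
      ∀ s : S.X₂.obj.obj (op W), (S.g.hom.app (op W)).hom s = 0 →
        ∃ t : S.X₁.obj.obj (op W), (S.f.hom.app (op W)).hom t = s := by
  let F : Sheaf (Opens.grothendieckTopology X) (ModuleCat.{0} A) ⥤ ModuleCat.{0} A :=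
    sheafToPresheaf _ _ ⋙ (evaluation ((Opens X)ᵒᵖ) (ModuleCat.{0} A)).obj (op W)
  have : PreservesFiniteLimits F := inferInstance
  obtain ⟨h₁, h₂⟩ := ((F.preservesFiniteLimits_tfae).out 1 3 rfl rfl).mpr this S ⟨hS, ‹_›⟩
  exact ⟨(ModuleCat.mono_iff_injective _).1 h₂, (ShortComplex.moduleCat_exact_iff _).1 h₁⟩

theorem exists_local_lift_of_exact
    {S : ShortComplex (Sheaf (Opens.grothendieckTopology X) (ModuleCat.{0} A))} (hS : S.Exact)
    {W : Opens X} (s : S.X₂.obj.obj (op W)) (hs : (S.g.hom.app (op W)).hom s = 0) (x : X)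
    (hx : x ∈ W) :
    ∃ (V : Opens X) (h : V ≤ W), x ∈ V ∧ ∃ t : S.X₁.obj.obj (op V),
      (S.f.hom.app (op V)).hom t = (S.X₂.obj.map (homOfLE h).op).hom s := by
  have hx' := (TopCat.Sheaf.exact_iff_stalkFunctor_map_exact S).1 hS x
  rw [ShortComplex.moduleCat_exact_iff] at hx'
  obtain ⟨t, ht⟩ := hx' (TopCat.Presheaf.germ S.X₂.obj W x hx s) (by
    refine (TopCat.Presheaf.stalkFunctor_map_germ_apply W x hx S.g.hom s).trans ?_
    erw [hs]
    exact map_zero _)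
  obtain ⟨V, hV, t, rfl⟩ := TopCat.Presheaf.exists_germ_eq S.X₁.obj t
  have ht' := (TopCat.Presheaf.stalkFunctor_map_germ_apply V x hV S.f.hom t).symm.trans ht
  obtain ⟨T, hT, i, j, e⟩ := TopCat.Presheaf.germ_eq S.X₂.obj x hV hx _ _ ht'
  refine ⟨T, j.le, hT, S.X₁.obj.map i.op t, ?_⟩
  exact (NatTrans.naturality_apply S.f.hom i.op t).trans e

end Resolution

section Comparison

variable {X : TopCat.{0}} {A : Type} [CommRing A]
  {V : Sheaf (Opens.grothendieckTopology X) (ModuleCat.{0} A)}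

/-- The sections of an injective resolution of a sheaf. -/
noncomputable def CategoryTheory.InjectiveResolution.flasqueComplex (I : InjectiveResolution V) :
    FlasqueComplex X A where
  sec q W := (I.cocomplex.X q).obj.obj (op W)
  res q _ _ h := ((I.cocomplex.X q).obj.map (homOfLE h).op).hom
  res_res q _ _ _ h h' s := by
    rw [← ModuleCat.comp_apply, ← Functor.map_comp]
    rfl
  res_self q _ s := by
    exact congrArg (fun f ↦ f.hom s) ((I.cocomplex.X q).obj.map_id _)
  d q W := ((I.cocomplex.d q (q + 1)).hom.app (op W)).hom
  d_res q _ _ h s := NatTrans.naturality_apply (I.cocomplex.d q (q + 1)).hom (homOfLE h).op s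
  d_d q W s := by
    have := congrArg (fun f ↦ (f.hom.app (op W)).hom s) (I.cocomplex.d_comp_d q (q + 1) (q + 2))
    exact this
  glue q ι U W hU hW s hs := by
    obtain ⟨t, ht, -⟩ := TopCat.Sheaf.existsUnique_gluing' (I.cocomplex.X q) U W
      (fun i ↦ homOfLE (hU i)) hW s hs
    exact ⟨t, ht⟩
  eq_of_locally_eq q ι U W hU hW s t h :=
    TopCat.Sheaf.eq_of_locally_eq' (I.cocomplex.X q) U W (fun i ↦ homOfLE (hU i)) hW s t h
  flasque q _ _ h := surjective_map_of_injective (I.cocomplex.X q) h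
  exact q _ s hs x hx := exists_local_lift_of_exact (I.exact_succ q) s hs x hx

theorem IsLocallyConstantFG.flasqueComplex (hV : IsLocallyConstantFG V.obj)
    (I : InjectiveResolution V) : I.flasqueComplex.IsLocallyConstant := by
  intro x
  obtain ⟨N, hxN, hN⟩ := hV.2 x
  have hS := fun W ↦ exists_app_eq_of_exact I.exact₀ W
  let ε : ∀ W : Opens X, V.obj.obj (op W) →ₗ[A] I.flasqueComplex.sec 0 W :=
    fun W ↦ ((I.ι.f 0).hom.app (op W)).hom
  have hε : ∀ W, Function.Injective (ε W) := fun W ↦ (hS W).1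
  have hεd : ∀ W v, I.flasqueComplex.d 0 W (ε W v) = 0 := fun W v ↦ by
    have := congrArg (fun f ↦ (f.hom.app (op W)).hom v) I.ι_f_zero_comp_complex_d
    exact this
  have hεs : ∀ W s, I.flasqueComplex.d 0 W s = 0 → ∃ v, ε W v = s := fun W ↦ (hS W).2
  have hεr : ∀ {W W' : Opens X} (h : W' ≤ W) v, I.flasqueComplex.res 0 h (ε W v) =
      ε W' ((V.obj.map (homOfLE h).op).hom v) := fun h v ↦
    (NatTrans.naturality_apply (I.ι.f 0).hom (homOfLE h).op v).symm
  have hbij : ∀ y hy, Function.Bijective (TopCat.Presheaf.germ V.obj N y hy).hom := fun y hy ↦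
    have := hN y hy
    ConcreteCategory.bijective_of_isIso (TopCat.Presheaf.germ V.obj N y hy)
  refine ⟨N, hxN, ?_, ?_, ?_⟩
  · rintro y hy t ht ⟨W, hW, hyW, h0⟩
    obtain ⟨v, rfl⟩ := hεs N t ht
    rw [hεr] at h0
    have h1 : (V.obj.map (homOfLE hW).op).hom v = 0 := hε W (h0.trans (map_zero _).symm)
    have h2 := TopCat.Presheaf.germ_res_apply V.obj (homOfLE hW) y hyW v
    have h3 : (TopCat.Presheaf.germ V.obj N y hy).hom v = 0 := by
      refine h2.symm.trans ?_
      erw [h1]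
      exact map_zero _
    rw [(hbij y hy).1 (h3.trans (map_zero _).symm), map_zero]
  · intro y hy W s hyW hs
    obtain ⟨v, rfl⟩ := hεs W s hs
    obtain ⟨v', hv'⟩ := (hbij y hy).2 (TopCat.Presheaf.germ V.obj W y hyW v)
    obtain ⟨T, hT, i, j, e⟩ := TopCat.Presheaf.germ_eq V.obj y hy hyW _ _ hv'
    refine ⟨ε N v', hεd N v', T, j.le, i.le, hT, ?_⟩
    rw [hεr, hεr]
    exact congrArg (ε T) e
  · have := hN x hxN
    have := hV.1 x
    have hfin : Module.Finite A (V.obj.obj (op N)) :=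
      Module.Finite.equiv (asIso (TopCat.Presheaf.germ V.obj N x hxN)).toLinearEquiv.symm
    have hker : LinearMap.ker (I.flasqueComplex.d 0 N) = Submodule.map (ε N) ⊤ := by
      ext s
      exact ⟨fun hs ↦ (hεs N s hs).imp fun v hv ↦ ⟨trivial, hv⟩, fun ⟨v, _, hv⟩ ↦ hv ▸ hεd N v⟩
    exact hker ▸ hfin.fg_top.map (ε N)

theorem Submodule.finite_quotient_of_map_mkQ_fg {M : Type*} [AddCommGroup M] [Module A M]
    {Z B : Submodule A M} (h : (Z.map B.mkQ).FG) {R : Submodule A Z}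
    (hR : R = B.comap Z.subtype) : Module.Finite A (Z ⧸ R) := by
  have hinj : Function.Injective (R.mapQ B Z.subtype hR.le) := by
    rw [← LinearMap.ker_eq_bot, Submodule.mapQ, Submodule.ker_liftQ, LinearMap.ker_comp,
      Submodule.ker_mkQ, ← hR, Submodule.mkQ_map_self]
  refine ⟨Submodule.fg_of_fg_map_injective _ hinj ?_⟩
  rwa [Submodule.map_top, Submodule.mapQ, Submodule.range_liftQ, LinearMap.range_comp,
    Submodule.range_subtype]

theorem CategoryTheory.ShortComplex.finite_homology_of_map_mkQ_fg
    (S : ShortComplex (ModuleCat.{0} A)) {B : Submodule A S.X₂} (hB : B = LinearMap.range S.f.hom)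
    (h : ((LinearMap.ker S.g.hom).map B.mkQ).FG) : Module.Finite A S.homology := by
  have : Module.Finite A S.moduleCatLeftHomologyData.H := by
    refine Submodule.finite_quotient_of_map_mkQ_fg h ?_
    rw [hB]
    ext z
    exact ⟨fun ⟨x, hx⟩ ↦ ⟨x, congrArg Subtype.val hx⟩, fun ⟨x, hx⟩ ↦ ⟨x, Subtype.ext hx⟩⟩
  exact Module.Finite.equiv S.moduleCatHomologyIso.toLinearEquiv.symm

theorem finite_sheafCoh_of_cohomology_fg
    [EnoughInjectives (Sheaf (Opens.grothendieckTopology X) (ModuleCat.{0} A))]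
    (I : InjectiveResolution V) (p : ℕ) (h : (I.flasqueComplex.cohomology p ⊤).FG) :
    Module.Finite A ((sheafCoh X A p).obj V) := by
  let C := ((globalSections X A).mapHomologicalComplex (ComplexShape.up ℕ)).obj I.cocomplex
  have : Module.Finite A ((HomologicalComplex.homologyFunctor (ModuleCat.{0} A)
      (ComplexShape.up ℕ) p).obj C) := by
    cases p with
    | zero =>
      have : Module.Finite A (C.sc' 0 0 1).homology := by
        refine ShortComplex.finite_homology_of_map_mkQ_fg _ (B := ⊥) ?_ h
        have : (C.sc' 0 0 1).f = 0 := C.shape 0 0 (by simp)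
        rw [this]
        exact LinearMap.range_zero.symm
      exact Module.Finite.equiv (C.homologyIsoSc' 0 0 1 (by simp) (by simp)).toLinearEquiv.symm
    | succ p =>
      have : Module.Finite A (C.sc' p (p + 1) (p + 2)).homology :=
        ShortComplex.finite_homology_of_map_mkQ_fg _ rfl h
      exact Module.Finite.equiv
        (C.homologyIsoSc' p (p + 1) (p + 2) (by simp) (by simp)).toLinearEquiv.symm
  exact Module.Finite.equiv (I.isoRightDerivedObj (globalSections X A) p).toLinearEquiv.symm

end Comparison

/-- if `X` is a topological manifold with a finite good cover, `A` a
noetherian ring and `V` a locally constant sheaf of `A`-modules with finitely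
generated stalks, then each cohomology module `H^p(X, V)` is finitely generated. -/
theorem sheafCoh_finite (X : TopCat) (n : ℕ) (hX : HasFiniteGoodCover X n)
    (A : Type) [CommRing A] [IsNoetherianRing A]
    [EnoughInjectives (Sheaf (Opens.grothendieckTopology X) (ModuleCat.{0} A))]
    (V : Sheaf (Opens.grothendieckTopology X) (ModuleCat.{0} A))
    (hV : IsLocallyConstantFG V.val) (p : ℕ) :
    Module.Finite A ((sheafCoh X A p).obj V) := by
  exact finite_sheafCoh_of_cohomology_fg (InjectiveResolution.of V) p
    (hX.cohomology_top_fg (IsLocallyConstantFG.flasqueComplex hV _) p)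
end
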